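/- arXiv:1707.01016 — 6 statements merged into one kernel-verified Lean document; each statement's English description precedes it below -/
import Mathlib

section
/- For all integers n, m ≥ 1, the set C_qa^s(n,m) of synchronous quantum approximate correlations equals the closure of C_q^s(n,m) in ℝ^{n²m²}. In other words, a synchronous tuple lies in the closure of C_q(n,m) if and only if it is a limit of synchronous correlations from C_q(n,m). -/
open Matrix

noncomputable section

/-- The set of quantum correlations with input set `I` and output set `O`:
`p x y a b` is the probability of outputs `(a,b)` on inputs `(x,y)`, realised by
finite-dimensional PVMs `E`, `F` and a unit vector `ψ` in the tensor product
(Kronecker) Hilbert space. -/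
def QCorr (I O : Type) [Fintype I] [Fintype O] : Set (I → I → O → O → ℝ) :=
  {p | ∃ dA dB : ℕ, 0 < dA ∧ 0 < dB ∧
    ∃ (E : I → O → Matrix (Fin dA) (Fin dA) ℂ)
      (F : I → O → Matrix (Fin dB) (Fin dB) ℂ)
      (ψ : Fin dA × Fin dB → ℂ),
      (∀ x a, (E x a).IsHermitian ∧ E x a * E x a = E x a) ∧
      (∀ x, ∑ a, E x a = 1) ∧
      (∀ y b, (F y b).IsHermitian ∧ F y b * F y b = F y b) ∧
      (∀ y, ∑ b, F y b = 1) ∧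
      star ψ ⬝ᵥ ψ = 1 ∧
      (∀ x y a b, (p x y a b : ℂ) =
        star ψ ⬝ᵥ (Matrix.kroneckerMap (· * ·) (E x a) (F y b)).mulVec ψ) }

/-- A correlation is synchronous if `p(a,b|x,x) = 0` whenever `a ≠ b`. -/
def Synchronous {I O : Type} (p : I → I → O → O → ℝ) : Prop :=
  ∀ x a b, a ≠ b → p x x a b = 0


open scoped Matrix.Norms.Frobenius
namespace SyncQ
set_option linter.unusedSectionVars false
set_option linter.unusedSimpArgs false

variable {α β γ : Type} [Fintype α] [Fintype β] [Fintype γ] [DecidableEq α] [DecidableEq β]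

def IsProj (P : Matrix α α ℂ) : Prop := P.IsHermitian ∧ P * P = P

lemma frob_sq (X : Matrix α β ℂ) : ‖X‖ ^ 2 = ∑ i, ∑ j, ‖X i j‖ ^ 2 := by
  rw [Matrix.frobenius_norm_def, ← Real.sqrt_eq_rpow, Real.sq_sqrt]
  · simp
  · positivity

lemma frob_sq_trace (X : Matrix α β ℂ) : ((‖X‖ ^ 2 : ℝ) : ℂ) = (Xᴴ * X).trace := by
  rw [frob_sq, Finset.sum_comm]
  simp only [Matrix.trace, Matrix.diag, Matrix.mul_apply, Matrix.conjTranspose_apply]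
  push_cast
  refine Finset.sum_congr rfl fun i _ => Finset.sum_congr rfl fun j _ => ?_
  have := Complex.conj_mul' (X j i)
  simpa using this.symm

lemma trace_le (X Y : Matrix α β ℂ) : ‖(Xᴴ * Y).trace‖ ≤ ‖X‖ * ‖Y‖ := by
  have h1 : ‖(Xᴴ * Y).trace‖ ≤ ∑ p : β × α, ‖X p.2 p.1‖ * ‖Y p.2 p.1‖ := by
    rw [Fintype.sum_prod_type]
    simp only [Matrix.trace, Matrix.diag, Matrix.mul_apply, Matrix.conjTranspose_apply]
    refine (norm_sum_le _ _).trans (Finset.sum_le_sum fun i _ => ?_)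
    refine (norm_sum_le _ _).trans (Finset.sum_le_sum fun j _ => ?_)
    simp
  refine h1.trans ((Real.sum_mul_le_sqrt_mul_sqrt _ _ _).trans (le_of_eq ?_))
  have h2 : ∀ Z : Matrix α β ℂ, √(∑ p : β × α, ‖Z p.2 p.1‖ ^ 2) = ‖Z‖ := by
    intro Z
    rw [← Real.sqrt_sq (norm_nonneg Z), frob_sq, Fintype.sum_prod_type, Finset.sum_comm]
  rw [h2, h2]

lemma proj_mul_le {P : Matrix α α ℂ} (hP : IsProj P) (X : Matrix α β ℂ) : ‖P * X‖ ≤ ‖X‖ := by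
  have h := trace_le X (P * X)
  have h2 := frob_sq_trace (P * X)
  have h3 : (P * X)ᴴ * (P * X) = Xᴴ * (P * X) := by
    rw [Matrix.conjTranspose_mul, hP.1.eq, Matrix.mul_assoc, ← Matrix.mul_assoc P P, hP.2]
  rw [h3] at h2
  rw [← h2, Complex.norm_real, Real.norm_of_nonneg (by positivity)] at h
  nlinarith [norm_nonneg X, norm_nonneg (P * X)]

lemma frob_ct (X : Matrix α β ℂ) : ‖Xᴴ‖ = ‖X‖ := Matrix.frobenius_norm_conjTranspose X

lemma mul_proj_le {P : Matrix β β ℂ} (hP : IsProj P) (X : Matrix α β ℂ) : ‖X * P‖ ≤ ‖X‖ := by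
  rw [← frob_ct (X * P), ← frob_ct X, Matrix.conjTranspose_mul, hP.1.eq]
  exact proj_mul_le hP _

lemma unit_mul {U : Matrix α α ℂ} (hU : Uᴴ * U = 1) (X : Matrix α β ℂ) : ‖U * X‖ = ‖X‖ := by
  have h1 := frob_sq_trace (U * X)
  have h3 : (U * X)ᴴ * (U * X) = Xᴴ * X := by
    rw [Matrix.conjTranspose_mul, Matrix.mul_assoc, ← Matrix.mul_assoc Uᴴ, hU, Matrix.one_mul]
  rw [h3, ← frob_sq_trace] at h1
  have h4 : ‖U * X‖ ^ 2 = ‖X‖ ^ 2 := by exact_mod_cast h1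
  exact (sq_eq_sq₀ (norm_nonneg _) (norm_nonneg _)).1 h4

lemma unit_conj {U : Matrix α α ℂ} (hU : Uᴴ * U = 1) (X : Matrix α α ℂ) :
    ‖U * X * Uᴴ‖ = ‖X‖ := by
  rw [← frob_ct, Matrix.conjTranspose_mul, Matrix.conjTranspose_conjTranspose, unit_mul hU,
    frob_ct, unit_mul hU]

lemma spectral {B : Matrix α α ℂ} (hB : B.IsHermitian) :
    ∃ (U : Matrix α α ℂ) (l : α → ℝ), Uᴴ * U = 1 ∧ U * Uᴴ = 1 ∧
      B = U * Matrix.diagonal (fun i => (l i : ℂ)) * Uᴴ := by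
  refine ⟨hB.eigenvectorUnitary, hB.eigenvalues, ?_, ?_, ?_⟩
  · exact Unitary.coe_star_mul_self hB.eigenvectorUnitary
  · exact Unitary.coe_mul_star_self hB.eigenvectorUnitary
  · have := hB.spectral_theorem
    rw [Unitary.conjStarAlgAut_apply] at this
    exact this

lemma frob_diag_le (f g : α → ℂ) (h : ∀ i, ‖f i‖ ≤ ‖g i‖) :
    ‖Matrix.diagonal f‖ ≤ ‖Matrix.diagonal g‖ := by
  rw [← sq_le_sq₀ (norm_nonneg _) (norm_nonneg _), frob_sq, frob_sq]
  gcongr with i _ j _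
  by_cases hij : i = j
  · subst hij; simpa using h i
  · simp [hij]

lemma round {B R : Matrix α α ℂ} (hB : B.IsHermitian) (hR : R * B = B) :
    ∃ P, IsProj P ∧ R * P = P ∧ ‖P - B‖ ≤ 2 * ‖B - B * B‖ := by
  obtain ⟨U, l, hU, hU', hBe⟩ := spectral hB
  have key : ∀ X Y : Matrix α α ℂ, (U * X * Uᴴ) * (U * Y * Uᴴ) = U * (X * Y) * Uᴴ := by
    intro X Y
    calc _ = U * X * (Uᴴ * U) * Y * Uᴴ := by simp only [Matrix.mul_assoc]
      _ = _ := by rw [hU]; simp only [Matrix.mul_assoc, Matrix.mul_one]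
  let f : α → ℂ := fun i => if 1/2 < l i then 1 else 0
  let g : α → ℂ := fun i => if 1/2 < l i then ((l i)⁻¹ : ℂ) else 0
  refine ⟨U * Matrix.diagonal f * Uᴴ, ⟨?_, ?_⟩, ?_, ?_⟩
  · unfold Matrix.IsHermitian
    rw [Matrix.conjTranspose_mul, Matrix.conjTranspose_mul, Matrix.conjTranspose_conjTranspose,
      Matrix.diagonal_conjTranspose, Matrix.mul_assoc]
    congr 3
    ext i
    simp only [f, Pi.star_apply]
    split_ifs <;> simp
  · rw [key, Matrix.diagonal_mul_diagonal]
    congr 3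
    ext i
    simp only [f]
    split_ifs <;> simp
  · have : U * Matrix.diagonal f * Uᴴ = B * (U * Matrix.diagonal g * Uᴴ) := by
      conv_rhs => rw [hBe]
      rw [key, Matrix.diagonal_mul_diagonal]
      congr 3
      ext i
      simp only [f, g]
      split_ifs with h
      · have : (l i : ℂ) ≠ 0 := by
          have : l i ≠ 0 := by linarith
          exact_mod_cast this
        field_simp
      · simp
    rw [this, ← Matrix.mul_assoc, hR]
  · have e1 : U * Matrix.diagonal f * Uᴴ - B
        = U * (Matrix.diagonal (fun i => f i - (l i : ℂ))) * Uᴴ := by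
      conv_lhs => rw [hBe]
      rw [← Matrix.diagonal_sub, Matrix.mul_sub, Matrix.sub_mul]
    have e2 : B - B * B
        = U * (Matrix.diagonal (fun i => (l i : ℂ) - (l i : ℂ) * (l i : ℂ))) * Uᴴ := by
      conv_lhs => rw [hBe, key, Matrix.diagonal_mul_diagonal]
      rw [← Matrix.diagonal_sub, Matrix.mul_sub, Matrix.sub_mul]
    have e3 : 2 * ‖B - B * B‖ = ‖(2 : ℂ) • (B - B * B)‖ := by
      rw [norm_smul]; simp
    rw [e3, e1, e2, ← Matrix.smul_mul, ← Matrix.mul_smul, unit_conj hU, unit_conj hU,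
      ← Matrix.diagonal_smul]
    apply frob_diag_le
    intro i
    have c1 : f i - (l i : ℂ) = (((if 1/2 < l i then 1 else 0) - l i : ℝ) : ℂ) := by
      simp only [f]; split_ifs <;> simp
    have c2 : ((2 : ℂ) • fun i => (l i : ℂ) - (l i : ℂ) * (l i : ℂ)) i
        = ((2 * (l i - l i * l i) : ℝ) : ℂ) := by
      simp
    rw [c1, c2, Complex.norm_real, Complex.norm_real, Real.norm_eq_abs, Real.norm_eq_abs,
      ← sq_le_sq]
    split_ifs with h
    · have : (2 * (l i - l i * l i))^2 - (1 - l i)^2 = (1 - l i)^2 * ((2 * l i - 1) * (2 * l i + 1)) := by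
        ring
      have : 0 ≤ (1 - l i)^2 * ((2 * l i - 1) * (2 * l i + 1)) :=
        mul_nonneg (sq_nonneg _) (mul_nonneg (by linarith) (by linarith))
      linarith
    · have : (2 * (l i - l i * l i))^2 - (0 - l i)^2 = (l i)^2 * ((1 - 2 * l i) * (3 - 2 * l i)) := by
        ring
      have : 0 ≤ (l i)^2 * ((1 - 2 * l i) * (3 - 2 * l i)) :=
        mul_nonneg (sq_nonneg _) (mul_nonneg (by linarith) (by linarith))
      linarith

lemma pvm_orth {O : Type} [Fintype O] {E : O → Matrix α α ℂ} (hE : ∀ a, IsProj (E a))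
    (hs : ∑ a, E a = 1) {a b : O} (hab : a ≠ b) : E a * E b = 0 := by
  classical
  have key : ∀ c, ((‖E c * E b‖ ^ 2 : ℝ) : ℂ) = (E b * E c * E b).trace := by
    intro c
    rw [frob_sq_trace, Matrix.conjTranspose_mul, (hE b).1.eq, (hE c).1.eq, Matrix.mul_assoc,
      ← Matrix.mul_assoc (E c), (hE c).2, Matrix.mul_assoc]
  have h1 : ∑ c, ‖E c * E b‖ ^ 2 = ‖E b * E b‖ ^ 2 := by
    have : ((∑ c, ‖E c * E b‖ ^ 2 : ℝ) : ℂ) = ((‖E b * E b‖ ^ 2 : ℝ) : ℂ) := by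
      rw [Complex.ofReal_sum, Finset.sum_congr rfl fun c _ => key c, key, ← Matrix.trace_sum,
        ← Finset.sum_mul, ← Finset.mul_sum, hs, Matrix.mul_one, (hE b).2, (hE b).2]
    exact_mod_cast this
  rw [← Finset.add_sum_erase _ _ (Finset.mem_univ b)] at h1
  have h2 : ∑ c ∈ Finset.univ.erase b, ‖E c * E b‖ ^ 2 = 0 := by linarith
  rw [Finset.sum_eq_zero_iff_of_nonneg (fun _ _ => by positivity)] at h2
  have h3 := h2 a (by simp [hab])
  exact norm_eq_zero.1 (pow_eq_zero_iff (two_ne_zero)|>.1 h3)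

set_option maxHeartbeats 800000 in
lemma seq_round {O : Type} [Fintype O] [DecidableEq O] (S : Finset O) :
    ∃ c : ℝ, 0 ≤ c ∧ ∀ (α : Type) [Fintype α] [DecidableEq α] (D : Matrix α α ℂ)
      (E : O → Matrix α α ℂ) (δ : ℝ), IsProj D → (∀ a, IsProj (E a)) →
      (∀ a b, a ≠ b → E a * E b = 0) → 0 ≤ δ → (∀ a, ‖(1 - D) * (E a * D)‖ ≤ δ) →
      ∃ P : O → Matrix α α ℂ, (∀ a, IsProj (P a)) ∧ (∀ a, D * P a = P a) ∧
        (∀ a b, a ≠ b → P a * P b = 0) ∧ (∀ a, a ∉ S → P a = 0) ∧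
        ∀ a ∈ S, ‖P a - E a * D‖ ≤ c * δ := by
  induction S using Finset.induction_on with
  | empty =>
    refine ⟨0, le_rfl, ?_⟩
    intro α _ _ D E δ hD hE ho hδ h
    refine ⟨fun _ => 0, ?_, ?_, ?_, ?_, ?_⟩ <;> simp [IsProj]
  | insert k S hk ih =>
    obtain ⟨c, hc, ih⟩ := ih
    refine ⟨c + 3 + 4 * (Fintype.card O * c), by positivity, ?_⟩
    intro α _ _ D E δ hD hE ho hδ h
    obtain ⟨P, hP, hDP, hPo, hP0, hPS⟩ := ih α D E δ hD hE ho hδ h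
    have hPD : ∀ a, P a * D = P a := by
      intro a
      have := congrArg Matrix.conjTranspose (hDP a)
      rwa [Matrix.conjTranspose_mul, (hP a).1.eq, hD.1.eq] at this
    set T := ∑ b, P b with hT
    have hTh : Tᴴ = T := by
      rw [hT, Matrix.conjTranspose_sum]
      exact Finset.sum_congr rfl fun b _ => (hP b).1.eq
    have hDT : D * T = T := by
      rw [hT, Finset.mul_sum]; exact Finset.sum_congr rfl fun b _ => hDP b
    have hTD : T * D = T := by
      rw [hT, Finset.sum_mul]; exact Finset.sum_congr rfl fun b _ => hPD b
    have hTP : ∀ b, T * P b = P b := by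
      intro b
      rw [hT, Finset.sum_mul, Finset.sum_eq_single b]
      · exact (hP b).2
      · intro a _ hab; exact hPo a b hab
      · simp
    have hTT : T * T = T := by
      conv_lhs => rw [hT, Finset.mul_sum]
      exact Finset.sum_congr rfl fun b _ => hTP b
    obtain ⟨R, hRdef⟩ : ∃ R, R = D - T := ⟨_, rfl⟩
    have hR : IsProj R := by
      constructor
      · unfold Matrix.IsHermitian
        rw [hRdef, Matrix.conjTranspose_sub, hTh, hD.1.eq]
      · rw [hRdef, Matrix.sub_mul, Matrix.mul_sub, Matrix.mul_sub, hD.2, hTT, hDT, hTD]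
        simp
    have hRP : ∀ b, R * P b = 0 := by
      intro b; rw [hRdef, Matrix.sub_mul, hDP, hTP, sub_self]
    have hDR : D * R = R := by rw [hRdef, Matrix.mul_sub, hD.2, hDT]
    have hBh : (R * E k * R).IsHermitian := by
      unfold Matrix.IsHermitian
      rw [Matrix.conjTranspose_mul, Matrix.conjTranspose_mul, hR.1.eq, (hE k).1.eq,
        Matrix.mul_assoc]
    obtain ⟨Q, hQ, hRQ, hQB⟩ := round (R := R) hBh (by
      rw [← Matrix.mul_assoc, ← Matrix.mul_assoc, hR.2])
    have hQR : Q * R = Q := by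
      have := congrArg Matrix.conjTranspose hRQ
      rwa [Matrix.conjTranspose_mul, hQ.1.eq, hR.1.eq] at this
    have hQP : ∀ b, Q * P b = 0 := by
      intro b; rw [← hQR, Matrix.mul_assoc, hRP, Matrix.mul_zero]
    have hPQ : ∀ b, P b * Q = 0 := by
      intro b
      have := congrArg Matrix.conjTranspose (hQP b)
      rwa [Matrix.conjTranspose_mul, hQ.1.eq, (hP b).1.eq, Matrix.conjTranspose_zero] at this
    have hv : ‖T * E k‖ ≤ Fintype.card O * c * δ := by
      rw [hT, Finset.sum_mul]
      refine (norm_sum_le _ _).trans ?_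
      have : ∀ b ∈ (Finset.univ : Finset O), ‖P b * E k‖ ≤ c * δ := by
        intro b _
        by_cases hb : b ∈ S
        · have hbk : b ≠ k := fun e => hk (e ▸ hb)
          have e : P b * E k = (P b - E b * D)ᴴ * E k := by
            rw [Matrix.conjTranspose_sub, Matrix.conjTranspose_mul, (hP b).1.eq, (hE b).1.eq,
              hD.1.eq, Matrix.sub_mul, Matrix.mul_assoc D, ho b k hbk, Matrix.mul_zero, sub_zero]
          rw [e]
          refine (mul_proj_le (hE k) _).trans ?_
          rw [frob_ct]
          exact hPS b hb
        · rw [hP0 b hb, Matrix.zero_mul, norm_zero]; positivity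
      refine (Finset.sum_le_card_nsmul _ _ _ this).trans (le_of_eq ?_)
      rw [nsmul_eq_mul, Finset.card_univ]; ring
    obtain ⟨w, hw⟩ : ∃ w, w = (1 - R) * (E k * R) := ⟨_, rfl⟩
    have hwn : ‖w‖ ≤ δ + Fintype.card O * c * δ := by
      have e : w = (1 - D) * (E k * D) * R + T * E k * R := by
        rw [Matrix.mul_assoc (1 - D), Matrix.mul_assoc (E k), hDR, hw, Matrix.mul_assoc T,
          ← Matrix.add_mul]
        congr 1
        rw [hRdef]; abel
      rw [e]
      refine (norm_add_le _ _).trans (add_le_add ?_ ?_)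
      · exact (mul_proj_le hR _).trans (h k)
      · exact (mul_proj_le hR _).trans hv
    have hBB : ‖R * E k * R - R * E k * R * (R * E k * R)‖ ≤ ‖w‖ := by
      have e : R * E k * R - R * E k * R * (R * E k * R) = R * (E k * w) := by
        rw [hw]
        have e1 : R * E k * R * (R * E k * R) = R * E k * R * E k * R := by
          calc _ = R * E k * (R * R) * E k * R := by simp only [Matrix.mul_assoc]
            _ = _ := by rw [hR.2]
        rw [e1, Matrix.sub_mul, Matrix.one_mul, Matrix.mul_sub, Matrix.mul_sub,
          ← Matrix.mul_assoc (E k) (E k), (hE k).2]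
        simp only [Matrix.mul_assoc]
      rw [e]
      exact (proj_mul_le hR _).trans (proj_mul_le (hE k) _)
    have hfin : ‖Q - E k * D‖ ≤ (3 + 4 * (Fintype.card O * c)) * δ := by
      have e : Q - E k * D = (Q - R * E k * R) - w - (T * E k)ᴴ := by
        rw [Matrix.conjTranspose_mul, hTh, (hE k).1.eq, hw]
        have : D = R + T := by rw [hRdef]; abel
        rw [this]
        simp only [Matrix.mul_add, Matrix.sub_mul, Matrix.one_mul, Matrix.mul_assoc]
        abel
      rw [e]
      have n1 := norm_sub_le (Q - R * E k * R - w) (T * E k)ᴴ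
      have n2 := norm_sub_le (Q - R * E k * R) w
      rw [frob_ct] at n1
      nlinarith
    refine ⟨Function.update P k Q, ?_, ?_, ?_, ?_, ?_⟩
    · intro a
      by_cases hak : a = k
      · subst hak; simpa using hQ
      · simpa [hak] using hP a
    · intro a
      by_cases hak : a = k
      · subst hak
        simp only [Function.update_self]
        rw [← hRQ, ← Matrix.mul_assoc, hDR]
      · simpa [hak] using hDP a
    · intro a b hab
      by_cases hak : a = k
      · subst hak
        simpa [hab.symm] using hQP b
      · by_cases hbk : b = k
        · subst hbk
          simpa [hak] using hPQ a
        · simpa [hak, hbk] using hPo a b hab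
    · intro a ha
      simp only [Finset.mem_insert, not_or] at ha
      simpa [ha.1] using hP0 a ha.2
    · intro a ha
      have hcδ : 0 ≤ c * δ := by positivity
      have hMδ : 0 ≤ Fintype.card O * c * δ := by positivity
      by_cases hak : a = k
      · subst hak
        simp only [Function.update_self]
        nlinarith
      · simp only [Function.update_of_ne hak]
        have := hPS a (by simpa [hak] using ha)
        nlinarith

lemma pvm_round {O : Type} [Fintype O] [DecidableEq O] (a₀ : O) :
    ∃ c : ℝ, 0 ≤ c ∧ ∀ (α : Type) [Fintype α] [DecidableEq α] (D : Matrix α α ℂ)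
      (E : O → Matrix α α ℂ) (δ : ℝ), IsProj D → (∀ a, IsProj (E a)) →
      ∑ a, E a = 1 → 0 ≤ δ → (∀ a, ‖(1 - D) * (E a * D)‖ ≤ δ) →
      ∃ P : O → Matrix α α ℂ, (∀ a, IsProj (P a)) ∧ (∀ a, D * P a = P a * D) ∧
        ∑ a, P a = 1 ∧ ∀ a, ‖E a * D - P a * D‖ ≤ c * δ := by
  obtain ⟨c, hc, H⟩ := seq_round (Finset.univ : Finset O)
  refine ⟨c + Fintype.card O * c, by positivity, ?_⟩
  intro α _ _ D E δ hD hE hs hδ h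
  obtain ⟨P, hP, hDP, hPo, -, hPS⟩ := H α D E δ hD hE (fun a b hab => pvm_orth hE hs hab) hδ h
  have hPD : ∀ a, P a * D = P a := by
    intro a
    have := congrArg Matrix.conjTranspose (hDP a)
    rwa [Matrix.conjTranspose_mul, (hP a).1.eq, hD.1.eq] at this
  set T := ∑ b, P b with hT
  have hTh : Tᴴ = T := by
    rw [hT, Matrix.conjTranspose_sum]
    exact Finset.sum_congr rfl fun b _ => (hP b).1.eq
  have hDT : D * T = T := by
    rw [hT, Finset.mul_sum]; exact Finset.sum_congr rfl fun b _ => hDP b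
  have hTD : T * D = T := by
    rw [hT, Finset.sum_mul]; exact Finset.sum_congr rfl fun b _ => hPD b
  have hTP : ∀ b, T * P b = P b := by
    intro b
    rw [hT, Finset.sum_mul, Finset.sum_eq_single b]
    · exact (hP b).2
    · intro a _ hab; exact hPo a b hab
    · simp
  have hPT : ∀ b, P b * T = P b := by
    intro b
    have := congrArg Matrix.conjTranspose (hTP b)
    rwa [Matrix.conjTranspose_mul, (hP b).1.eq, hTh] at this
  have hTT : T * T = T := by
    conv_lhs => rw [hT, Finset.mul_sum]
    exact Finset.sum_congr rfl fun b _ => hTP b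
  have hDTn : ‖D - T‖ ≤ Fintype.card O * c * δ := by
    have e : D - T = ∑ a, (E a * D - P a) := by
      rw [Finset.sum_sub_distrib, ← Finset.sum_mul, hs, Matrix.one_mul]
    rw [e]
    refine (norm_sum_le _ _).trans ?_
    refine (Finset.sum_le_card_nsmul _ _ (c * δ) ?_).trans (le_of_eq ?_)
    · intro a _
      rw [norm_sub_rev]; exact hPS a (Finset.mem_univ a)
    · rw [nsmul_eq_mul, Finset.card_univ]; ring
  refine ⟨fun a => P a + if a = a₀ then 1 - T else 0, ?_, ?_, ?_, ?_⟩
  · intro a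
    dsimp only
    split_ifs
    · constructor
      · unfold Matrix.IsHermitian
        rw [Matrix.conjTranspose_add, Matrix.conjTranspose_sub, hTh, (hP a).1.eq,
          Matrix.conjTranspose_one]
      · simp only [Matrix.add_mul, Matrix.mul_add, Matrix.sub_mul, Matrix.mul_sub, hTT, hTP, hPT,
          (hP a).2, Matrix.one_mul, Matrix.mul_one]
        abel
    · simpa using hP a
  · intro a
    dsimp only
    split_ifs
    · simp only [Matrix.add_mul, Matrix.mul_add, Matrix.sub_mul, Matrix.mul_sub, hDT, hTD, hPD,
          hDP, Matrix.one_mul, Matrix.mul_one]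
    · simp [hDP, hPD]
  · rw [Finset.sum_add_distrib]
    simp [← hT]
  · intro a
    have h1 : ‖E a * D - P a‖ ≤ c * δ := by
      rw [norm_sub_rev]; exact hPS a (Finset.mem_univ a)
    have hMδ : 0 ≤ Fintype.card O * c * δ := by positivity
    dsimp only
    split_ifs
    · have e : E a * D - (P a + (1 - T)) * D = (E a * D - P a) - (D - T) := by
        rw [Matrix.add_mul, Matrix.sub_mul, hPD, hTD, Matrix.one_mul]; abel
      rw [e]
      have := norm_sub_le (E a * D - P a) (D - T)
      nlinarith
    · rw [add_zero, hPD]; nlinarith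

lemma frob_mul_sq {C : Matrix α α ℂ} {K : Matrix α β ℂ} {l : α → ℝ}
    (hK : K * Kᴴ = Matrix.diagonal (fun i => (l i : ℂ))) :
    ‖C * K‖ ^ 2 = ∑ i, ∑ k, ‖C i k‖ ^ 2 * l k := by
  have h := frob_sq_trace (C * K)ᴴ
  rw [frob_ct, Matrix.conjTranspose_conjTranspose, Matrix.conjTranspose_mul, Matrix.mul_assoc,
    ← Matrix.mul_assoc K, hK] at h
  have h2 : ((‖C * K‖ ^ 2 : ℝ) : ℂ) = ((∑ i, ∑ k, ‖C i k‖ ^ 2 * l k : ℝ) : ℂ) := by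
    rw [h]
    simp only [Matrix.trace, Matrix.diag, Matrix.mul_apply, Matrix.diagonal_apply, ite_mul, mul_ite, zero_mul, mul_zero,
      Finset.sum_ite_eq, Finset.sum_ite_eq', Finset.mem_univ, if_true, Matrix.conjTranspose_apply]
    push_cast
    refine Finset.sum_congr rfl fun i _ => Finset.sum_congr rfl fun j _ => ?_
    have := Complex.mul_conj' (C i j)
    rw [← this]
    simp only [RCLike.star_def]
    ring
  exact_mod_cast h2

lemma diag_nonneg {K : Matrix α β ℂ} {l : α → ℝ}
    (hK : K * Kᴴ = Matrix.diagonal (fun i => (l i : ℂ))) (k : α) : 0 ≤ l k := by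
  have h : (l k : ℂ) = ((∑ j, ‖K k j‖ ^ 2 : ℝ) : ℂ) := by
    have := congrFun (congrFun hK k) k
    rw [Matrix.diagonal_apply_eq, Matrix.mul_apply] at this
    rw [← this]
    push_cast
    refine Finset.sum_congr rfl fun j _ => ?_
    rw [← Complex.mul_conj' (K k j)]
    simp
  have h' : l k = ∑ j, ‖K k j‖ ^ 2 := by exact_mod_cast h
  rw [h']; positivity

lemma hadamard_le {C E : Matrix α α ℂ} {K : Matrix α β ℂ} {l : α → ℝ}
    (hK : K * Kᴴ = Matrix.diagonal (fun i => (l i : ℂ)))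
    (h : ∀ i k, ‖C i k‖ ≤ ‖E i k‖) : ‖C * K‖ ≤ ‖E * K‖ := by
  rw [← sq_le_sq₀ (norm_nonneg _) (norm_nonneg _), frob_mul_sq hK, frob_mul_sq hK]
  gcongr with i _ k _
  · exact diag_nonneg hK k
  · exact h i k

lemma comm_bound {E : Matrix α α ℂ} {G : Matrix β β ℂ} {K : Matrix α β ℂ} {l : α → ℝ}
    (hK : K * Kᴴ = Matrix.diagonal (fun i => (l i : ℂ))) (hE : IsProj E) (hG : IsProj G)
    (hK1 : ‖K‖ ≤ 1) :
    ∑ i, ∑ k, ‖E i k‖ ^ 2 * |l i - l k| ≤ 2 * ‖E * K - K * G‖ := by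
  set u := E * K - K * G with hu
  let C : Matrix α α ℂ := Matrix.of fun i k => ((SignType.sign (l k - l i) : ℝ) : ℂ) * E i k
  have hsign : ∀ i k, |((SignType.sign (l k - l i) : ℝ))| ≤ 1 := by
    intro i k
    rcases lt_trichotomy (l k - l i) 0 with h | h | h
    · simp [h]
    · simp [h]
    · simp [h]
  have hC : ∀ i k, ‖C i k‖ ≤ ‖E i k‖ := by
    intro i k
    simp only [C, Matrix.of_apply, norm_mul, Complex.norm_real, Real.norm_eq_abs]
    exact mul_le_of_le_one_left (norm_nonneg _) (hsign i k)
  have hC' : ∀ i k, ‖Cᴴ i k‖ ≤ ‖E i k‖ := by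
    intro i k
    rw [Matrix.conjTranspose_apply, norm_star]
    refine (hC k i).trans (le_of_eq ?_)
    rw [← norm_star, ← Matrix.conjTranspose_apply, hE.1.eq]
  have hEK : ‖E * K‖ ≤ 1 := (proj_mul_le hE K).trans hK1
  have hCK : ‖C * K‖ ≤ 1 := (hadamard_le hK hC).trans hEK
  have hCK' : ‖Cᴴ * K‖ ≤ 1 := (hadamard_le hK hC').trans hEK
  have e1 : E * (K * Kᴴ) - (K * Kᴴ) * E = u * Kᴴ - K * uᴴ := by
    rw [hu, Matrix.conjTranspose_sub, Matrix.conjTranspose_mul, Matrix.conjTranspose_mul,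
      hE.1.eq, hG.1.eq]
    simp only [Matrix.sub_mul, Matrix.mul_sub, Matrix.mul_assoc]
    abel
  have e2 : ((∑ i, ∑ k, ‖E i k‖ ^ 2 * |l i - l k| : ℝ) : ℂ)
      = (Cᴴ * (E * (K * Kᴴ) - (K * Kᴴ) * E)).trace := by
    rw [hK, Finset.sum_comm]
    simp only [Matrix.trace, Matrix.diag, Matrix.mul_apply, Matrix.sub_apply,
      Matrix.diagonal_apply, ite_mul, mul_ite, zero_mul, mul_zero,
      Finset.sum_ite_eq, Finset.sum_ite_eq', Finset.mem_univ, if_true, Matrix.conjTranspose_apply]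
    push_cast
    refine Finset.sum_congr rfl fun i _ => Finset.sum_congr rfl fun j _ => ?_
    simp only [C, Matrix.of_apply, RCLike.star_def, map_mul, Complex.conj_ofReal]
    rw [← Complex.conj_mul' (E j i), abs_sub_comm, ← sign_mul_self (l i - l j)]
    push_cast
    ring
  have e3 : (Cᴴ * (E * (K * Kᴴ) - (K * Kᴴ) * E)).trace
      = ((C * K)ᴴ * u).trace - (uᴴ * (Cᴴ * K)).trace := by
    rw [e1, Matrix.mul_sub, Matrix.trace_sub, Matrix.conjTranspose_mul,
      ← Matrix.mul_assoc Cᴴ u, Matrix.trace_mul_comm (Cᴴ * u), ← Matrix.mul_assoc Cᴴ K,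
      Matrix.trace_mul_comm (Cᴴ * K), Matrix.mul_assoc]
  have e4 : |(∑ i, ∑ k, ‖E i k‖ ^ 2 * |l i - l k| : ℝ)| ≤ 2 * ‖u‖ := by
    rw [← Real.norm_eq_abs, ← Complex.norm_real, e2, e3]
    refine (norm_sub_le _ _).trans ?_
    have t1 := trace_le (C * K) u
    have t2 := trace_le u (Cᴴ * K)
    nlinarith [norm_nonneg u]
  exact (le_abs_self _).trans e4

/-- cut-down projection -/
def Dm (p : α → ℕ) (M : ℕ) : Matrix (α × Fin M) (α × Fin M) ℂ :=
  Matrix.diagonal fun x => if (x.2 : ℕ) < p x.1 then 1 else 0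

def amp (M : ℕ) (E : Matrix α α ℂ) : Matrix (α × Fin M) (α × Fin M) ℂ :=
  Matrix.kroneckerMap (· * ·) E 1

lemma Dm_proj (p : α → ℕ) (M : ℕ) : IsProj (Dm p M) := by
  constructor
  · unfold Matrix.IsHermitian Dm
    rw [Matrix.diagonal_conjTranspose]
    congr 1
    ext x
    simp only [Pi.star_apply]
    split_ifs <;> simp
  · unfold Dm
    rw [Matrix.diagonal_mul_diagonal]
    congr 1
    ext x
    split_ifs <;> simp

lemma amp_mul (M : ℕ) (E F : Matrix α α ℂ) : amp M E * amp M F = amp M (E * F) := by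
  unfold amp
  have := Matrix.mul_kronecker_mul E F (1 : Matrix (Fin M) (Fin M) ℂ)
    (1 : Matrix (Fin M) (Fin M) ℂ)
  rw [Matrix.mul_one] at this
  exact this.symm

lemma amp_ct (M : ℕ) (E : Matrix α α ℂ) : (amp M E)ᴴ = amp M Eᴴ := by
  unfold amp
  have := Matrix.conjTranspose_kronecker E (1 : Matrix (Fin M) (Fin M) ℂ)
  rw [Matrix.conjTranspose_one] at this
  exact this

lemma amp_proj (M : ℕ) {E : Matrix α α ℂ} (hE : IsProj E) : IsProj (amp M E) :=
  ⟨by unfold Matrix.IsHermitian; rw [amp_ct, hE.1.eq], by rw [amp_mul, hE.2]⟩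

lemma amp_sum (M : ℕ) {O : Type} [Fintype O] {E : O → Matrix α α ℂ} (h : ∑ a, E a = 1) :
    ∑ a, amp M (E a) = 1 := by
  have : ∑ a, amp M (E a) = amp M (∑ a, E a) := by
    ext x y
    simp only [amp, Matrix.sum_apply, Matrix.kroneckerMap_apply, Finset.sum_mul]
  rw [this, h]
  exact Matrix.one_kronecker_one

lemma card_lt (M k : ℕ) (h : k ≤ M) :
    (Finset.univ.filter fun j : Fin M => (j : ℕ) < k).card = k := by
  rw [Fin.card_filter_val_lt]
  exact min_eq_right h

lemma trace_Dm (p : α → ℕ) (M : ℕ) (hM : ∀ i, p i ≤ M) (X : Matrix α α ℂ) :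
    (Dm p M * amp M X).trace = ∑ i, (p i : ℂ) * X i i := by
  simp only [Matrix.trace, Matrix.diag, Dm, Matrix.diagonal_mul, amp, Matrix.kroneckerMap_apply,
    Fintype.sum_prod_type, Matrix.one_apply_eq, mul_one]
  refine Finset.sum_congr rfl fun i _ => ?_
  rw [← Finset.sum_mul, Finset.sum_boole, card_lt M _ (hM i)]

lemma defect_bound (p : α → ℕ) (M : ℕ) (X : Matrix α α ℂ) :
    ‖(1 - Dm p M) * (amp M X * Dm p M)‖ ^ 2 ≤ ∑ i, ∑ k, ‖X i k‖ ^ 2 * |(p i : ℝ) - p k| := by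
  have h1 : (1 - Dm p M) = Matrix.diagonal fun x : α × Fin M =>
      if (x.2 : ℕ) < p x.1 then (0 : ℂ) else 1 := by
    rw [← Matrix.diagonal_one, Dm, Matrix.diagonal_sub]
    congr 1
    ext x
    split_ifs <;> simp
  rw [frob_sq, h1]
  simp only [Dm, amp, Matrix.diagonal_mul, Matrix.mul_diagonal, Matrix.kroneckerMap_apply,
    Fintype.sum_prod_type, Matrix.one_apply]
  refine Finset.sum_le_sum fun i _ => ?_
  rw [Finset.sum_comm]
  refine Finset.sum_le_sum fun k _ => ?_
  have h2 : ∀ j : Fin M, ∑ j' : Fin M, ‖(if (j : ℕ) < p i then (0 : ℂ) else 1) *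
      (X i k * (if j = j' then 1 else 0) * if (j' : ℕ) < p k then 1 else 0)‖ ^ 2
      = if (p i ≤ (j : ℕ) ∧ (j : ℕ) < p k) then ‖X i k‖ ^ 2 else 0 := by
    intro j
    rw [Finset.sum_eq_single j]
    · by_cases ha : (j : ℕ) < p i
      · have : ¬ (p i ≤ (j : ℕ)) := by omega
        simp [ha, this]
      · have : (p i ≤ (j : ℕ)) := by omega
        by_cases hb : (j : ℕ) < p k <;> simp [ha, this, hb]
    · intro b _ hb
      simp [hb.symm]
    · simp
  rw [Finset.sum_congr rfl fun j _ => h2 j, ← Finset.sum_filter, Finset.sum_const, nsmul_eq_mul,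
    mul_comm]
  gcongr
  have h3 : (Finset.univ.filter fun j : Fin M => p i ≤ (j : ℕ) ∧ (j : ℕ) < p k).card
      ≤ (Finset.Ico (p i) (p k)).card := by
    refine Finset.card_le_card_of_injOn (fun j => (j : ℕ)) ?_ ?_
    · intro j hj
      simpa using hj
    · intro a _ b _ h
      exact Fin.ext h
  rw [Nat.card_Ico] at h3
  have h4 : ((p k - p i : ℕ) : ℝ) ≤ |(p i : ℝ) - p k| := by
    rcases le_total (p i) (p k) with h | h
    · rw [Nat.cast_sub h, abs_sub_comm]; exact le_abs_self _
    · rw [Nat.sub_eq_zero_of_le h]; simp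
  exact (Nat.cast_le.2 h3).trans h4

lemma quad_form (E : Matrix α α ℂ) (F : Matrix β β ℂ) (ψ : α × β → ℂ) :
    star ψ ⬝ᵥ (Matrix.kroneckerMap (· * ·) E F).mulVec ψ
      = ((Matrix.of fun i j => ψ (i, j))ᴴ * E * (Matrix.of fun i j => ψ (i, j)) * Fᵀ).trace := by
  simp only [dotProduct, Matrix.mulVec, Matrix.trace, Matrix.diag, Matrix.mul_apply,
    Matrix.conjTranspose_apply, Matrix.of_apply, Matrix.transpose_apply, Fintype.sum_prod_type,
    Matrix.kroneckerMap_apply, Pi.star_apply, Finset.mul_sum, Finset.sum_mul]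
  rw [Finset.sum_comm]
  refine Finset.sum_congr rfl fun j _ => ?_
  rw [Finset.sum_congr rfl fun i _ => Finset.sum_comm, Finset.sum_comm]
  refine Finset.sum_congr rfl fun l _ => ?_
  rw [Finset.sum_comm]
  refine Finset.sum_congr rfl fun k _ => Finset.sum_congr rfl fun i _ => ?_
  ring

lemma norm_form (ψ : α × β → ℂ) :
    star ψ ⬝ᵥ ψ = ((Matrix.of fun i j => ψ (i, j))ᴴ * (Matrix.of fun i j => ψ (i, j))).trace := by
  simp only [dotProduct, Matrix.trace, Matrix.diag, Matrix.mul_apply,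
    Matrix.conjTranspose_apply, Matrix.of_apply, Fintype.sum_prod_type, Pi.star_apply]
  rw [Finset.sum_comm]

lemma sync_real_fin {I O : Type} [Fintype I] [Fintype O] (N : ℕ)
    (D : Matrix (Fin N) (Fin N) ℂ) (P : I → O → Matrix (Fin N) (Fin N) ℂ) (q : ℝ) (hq : 0 < q)
    (hD : IsProj D) (hP : ∀ x a, IsProj (P x a)) (hs : ∀ x, ∑ a, P x a = 1)
    (hc : ∀ x a, D * P x a = P x a * D) (htr : D.trace = q) :
    ∃ p ∈ QCorr I O, Synchronous p ∧
      ∀ x y a b, (p x y a b : ℂ) = ((P x a * D)ᴴ * (P y b * D)).trace / q := by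
  have hN : 0 < N := by
    rcases Nat.eq_zero_or_pos N with h | h
    · subst h
      simp [Matrix.trace] at htr
      exact absurd (by exact_mod_cast htr) hq.ne
    · exact h
  have ht : ∀ x y a b, ((P x a * D)ᴴ * (P y b * D)).trace = (P x a * P y b * D).trace := by
    intro x y a b
    rw [Matrix.conjTranspose_mul, hD.1.eq, (hP x a).1.eq, Matrix.mul_assoc, Matrix.trace_mul_comm]
    simp only [Matrix.mul_assoc, hD.2]
  have hre : ∀ x y a b, (starRingEnd ℂ) ((P x a * D)ᴴ * (P y b * D)).trace
      = ((P x a * D)ᴴ * (P y b * D)).trace := by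
    intro x y a b
    have h1 : (starRingEnd ℂ) ((P x a * D)ᴴ * (P y b * D)).trace
        = ((P y b * D)ᴴ * (P x a * D)).trace := by
      rw [← RCLike.star_def, ← Matrix.trace_conjTranspose, Matrix.conjTranspose_mul,
        Matrix.conjTranspose_conjTranspose]
    rw [h1, ht, ht, Matrix.mul_assoc, Matrix.trace_mul_comm, Matrix.mul_assoc, hc,
      Matrix.mul_assoc]
  have hval : ∀ x y a b, (((((P x a * D)ᴴ * (P y b * D)).trace / q).re : ℝ) : ℂ)
      = ((P x a * D)ᴴ * (P y b * D)).trace / q := by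
    intro x y a b
    rw [← Complex.conj_eq_iff_re, map_div₀, hre, Complex.conj_ofReal]
  have hqc : (q : ℂ) ≠ 0 := by exact_mod_cast hq.ne'
  have hsq : ((√q : ℝ) : ℂ)⁻¹ * ((√q : ℝ) : ℂ)⁻¹ = (q : ℂ)⁻¹ := by
    rw [← mul_inv, ← Complex.ofReal_mul, Real.mul_self_sqrt hq.le]
  refine ⟨fun x y a b => (((P x a * D)ᴴ * (P y b * D)).trace / q).re, ?_, ?_, hval⟩
  · have hK : (Matrix.of fun i j => (fun z : Fin N × Fin N => ((√q : ℝ) : ℂ)⁻¹ * D z.1 z.2) (i, j))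
        = ((√q : ℝ) : ℂ)⁻¹ • D := by
      ext i j; simp
    have hKh : (((√q : ℝ) : ℂ)⁻¹ • D)ᴴ = ((√q : ℝ) : ℂ)⁻¹ • D := by
      rw [Matrix.conjTranspose_smul, hD.1.eq]
      simp
    refine ⟨N, N, hN, hN, P, fun y b => (P y b)ᵀ, fun z => ((√q : ℝ) : ℂ)⁻¹ * D z.1 z.2,
      hP, hs, ?_, ?_, ?_, ?_⟩
    · intro y b
      exact ⟨(hP y b).1.transpose, by rw [← Matrix.transpose_mul, (hP y b).2]⟩
    · intro y
      rw [← Matrix.transpose_sum, hs, Matrix.transpose_one]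
    · rw [norm_form, hK, hKh, Matrix.smul_mul, Matrix.mul_smul, smul_smul, hD.2, hsq,
        Matrix.trace_smul, htr, smul_eq_mul, inv_mul_cancel₀ hqc]
    · intro x y a b
      rw [hval, quad_form, hK, hKh, ht, Matrix.transpose_transpose]
      simp only [Matrix.smul_mul, Matrix.mul_smul, smul_smul, hsq, Matrix.trace_smul, smul_eq_mul]
      have : D * P x a * D * P y b = P x a * P y b * D := by
        rw [hc, Matrix.mul_assoc (P x a), hD.2, Matrix.mul_assoc, hc, Matrix.mul_assoc]
      rw [this, div_eq_inv_mul]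
  · intro x a b hab
    dsimp only
    rw [ht, pvm_orth (hP x) (hs x) hab]
    simp

lemma trace_equiv {κ : Type} [Fintype κ] (N : ℕ) (e : Fin N ≃ κ) (X : Matrix κ κ ℂ) :
    (X.submatrix e e).trace = X.trace := by
  simp only [Matrix.trace, Matrix.diag, Matrix.submatrix_apply]
  exact Equiv.sum_comp e fun i => X i i

lemma sync_real {I O κ : Type} [Fintype I] [Fintype O] [Fintype κ] [DecidableEq κ]
    (D : Matrix κ κ ℂ) (P : I → O → Matrix κ κ ℂ) (q : ℝ) (hq : 0 < q)
    (hD : IsProj D) (hP : ∀ x a, IsProj (P x a)) (hs : ∀ x, ∑ a, P x a = 1)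
    (hc : ∀ x a, D * P x a = P x a * D) (htr : D.trace = q) :
    ∃ p ∈ QCorr I O, Synchronous p ∧
      ∀ x y a b, (p x y a b : ℂ) = ((P x a * D)ᴴ * (P y b * D)).trace / q := by
  let e : Fin (Fintype.card κ) ≃ κ := (Fintype.equivFin κ).symm
  have hpr : ∀ X : Matrix κ κ ℂ, IsProj X → IsProj (X.submatrix e e) := by
    intro X hX
    exact ⟨hX.1.submatrix e, by rw [Matrix.submatrix_mul_equiv, hX.2]⟩
  obtain ⟨p, h1, h2, h3⟩ := sync_real_fin (I := I) (O := O) (Fintype.card κ) (D.submatrix e e)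
    (fun x a => (P x a).submatrix e e) q hq (hpr D hD) (fun x a => hpr _ (hP x a))
    (fun x => by
      have : ∑ a, (P x a).submatrix e e = (∑ a, P x a).submatrix e e := by
        ext i j; simp [Matrix.sum_apply]
      rw [this, hs, Matrix.submatrix_one_equiv])
    (fun x a => by rw [Matrix.submatrix_mul_equiv, Matrix.submatrix_mul_equiv, hc])
    (by rw [trace_equiv, htr])
  refine ⟨p, h1, h2, fun x y a b => ?_⟩
  rw [h3]
  simp only [Matrix.submatrix_mul_equiv, Matrix.conjTranspose_submatrix, trace_equiv]

open Filter Topology in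
lemma approx_l (l : α → ℝ) (h0 : ∀ i, 0 ≤ l i) (h1 : ∑ i, l i = 1) :
    (∀ i, Tendsto (fun N : ℕ => (⌊l i * N⌋₊ : ℝ) / ∑ j, (⌊l j * N⌋₊ : ℝ)) atTop (𝓝 (l i))) ∧
    ∀ᶠ N : ℕ in atTop, 0 < ∑ j, (⌊l j * N⌋₊ : ℝ) := by
  have hf : ∀ i, Tendsto (fun N : ℕ => (⌊l i * N⌋₊ : ℝ) / N) atTop (𝓝 (l i)) := fun i =>
    (tendsto_nat_floor_mul_div_atTop (h0 i)).comp tendsto_natCast_atTop_atTop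
  have hsum : Tendsto (fun N : ℕ => (∑ j, (⌊l j * N⌋₊ : ℝ)) / N) atTop (𝓝 1) := by
    rw [← h1]
    simp only [Finset.sum_div]
    exact tendsto_finsetSum _ fun i _ => hf i
  constructor
  · intro i
    have := (hf i).div hsum one_ne_zero
    rw [div_one] at this
    refine this.congr' ?_
    filter_upwards [eventually_gt_atTop 0] with N hN
    have : (N : ℝ) ≠ 0 := by positivity
    simp only [Pi.div_apply]
    rw [div_div_div_cancel_right₀ this]
  · filter_upwards [hsum.eventually (lt_mem_nhds (zero_lt_one)), eventually_gt_atTop 0]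
      with N hN hN0
    have : (0 : ℝ) < N := by positivity
    by_contra hcon
    push Not at hcon
    have := div_nonpos_of_nonpos_of_nonneg hcon this.le
    linarith

open Filter Topology in
lemma core {I O : Type} [Fintype I] [Fintype O] [DecidableEq O] (c : ℝ) (hc : 0 ≤ c)
    (hround : ∀ (α : Type) [Fintype α] [DecidableEq α] (D : Matrix α α ℂ)
      (E : O → Matrix α α ℂ) (δ : ℝ), IsProj D → (∀ a, IsProj (E a)) →
      ∑ a, E a = 1 → 0 ≤ δ → (∀ a, ‖(1 - D) * (E a * D)‖ ≤ δ) →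
      ∃ P : O → Matrix α α ℂ, (∀ a, IsProj (P a)) ∧ (∀ a, D * P a = P a * D) ∧
        ∑ a, P a = 1 ∧ ∀ a, ‖E a * D - P a * D‖ ≤ c * δ)
    (E : I → O → Matrix α α ℂ) (G : I → O → Matrix β β ℂ) (K : Matrix α β ℂ) (l : α → ℝ)
    (hE : ∀ x a, IsProj (E x a)) (hEs : ∀ x, ∑ a, E x a = 1)
    (hG : ∀ x a, IsProj (G x a))
    (hK : K * Kᴴ = Matrix.diagonal (fun i => (l i : ℂ))) (hK1 : (Kᴴ * K).trace = 1)
    (ω η : ℝ) (hη : 0 < η) (hω : ∀ x a, ‖E x a * K - K * G x a‖ ≤ ω) (hω0 : 0 ≤ ω) :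
    ∃ p ∈ QCorr I O, Synchronous p ∧ ∀ x y a b,
      ‖(p x y a b : ℂ) - (Kᴴ * E x a * K * G y b).trace‖ ≤ ω + η + 2 * (c * √(2 * ω + η)) := by
  have hKn : ‖K‖ = 1 := by
    have h := frob_sq_trace K
    rw [hK1] at h
    have h' : ‖K‖ ^ 2 = 1 := by exact_mod_cast h
    nlinarith [norm_nonneg K]
  have hl0 : ∀ i, 0 ≤ l i := diag_nonneg hK
  have hl1 : ∑ i, l i = 1 := by
    have h : (K * Kᴴ).trace = 1 := by rw [Matrix.trace_mul_comm, hK1]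
    rw [hK, Matrix.trace_diagonal] at h
    exact_mod_cast h
  obtain ⟨hlim, hpos⟩ := approx_l l hl0 hl1
  -- step 1: the tracial form of the correlation
  have s1 : ∀ x y a b, ‖(∑ i, (l i : ℂ) * (E x a * E y b) i i) -
      (Kᴴ * E x a * K * G y b).trace‖ ≤ ω := by
    intro x y a b
    have e1 : (∑ i, (l i : ℂ) * (E x a * E y b) i i) = (Kᴴ * E x a * (E y b * K)).trace := by
      rw [← Matrix.mul_assoc, Matrix.trace_mul_comm, ← Matrix.mul_assoc, ← Matrix.mul_assoc, hK]
      simp only [Matrix.trace, Matrix.diag, Matrix.mul_assoc, Matrix.diagonal_mul]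
    have e2 : Kᴴ * E x a * (E y b * K) - Kᴴ * E x a * K * G y b
        = (E x a * K)ᴴ * (E y b * K - K * G y b) := by
      rw [Matrix.conjTranspose_mul, (hE x a).1.eq, Matrix.mul_sub]
      simp only [Matrix.mul_assoc]
    rw [e1, ← Matrix.trace_sub, e2]
    refine (trace_le _ _).trans ?_
    have h1 := proj_mul_le (hE x a) K
    rw [hKn] at h1
    exact (mul_le_of_le_one_left (norm_nonneg _) h1).trans (hω y b)
  -- step 2: rational approximation
  have s2 : ∀ᶠ N : ℕ in atTop, ∀ x a,
      ∑ i, ∑ k, ‖E x a i k‖ ^ 2 * |(⌊l i * N⌋₊ : ℝ) / (∑ j, (⌊l j * N⌋₊ : ℝ))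
        - (⌊l k * N⌋₊ : ℝ) / (∑ j, (⌊l j * N⌋₊ : ℝ))| < 2 * ω + η := by
    rw [eventually_all]; intro x
    rw [eventually_all]; intro a
    have ht : Tendsto (fun N : ℕ =>
        ∑ i, ∑ k, ‖E x a i k‖ ^ 2 * |(⌊l i * N⌋₊ : ℝ) / (∑ j, (⌊l j * N⌋₊ : ℝ))
        - (⌊l k * N⌋₊ : ℝ) / (∑ j, (⌊l j * N⌋₊ : ℝ))|) atTop
        (𝓝 (∑ i, ∑ k, ‖E x a i k‖ ^ 2 * |l i - l k|)) :=
      tendsto_finsetSum _ fun i _ => tendsto_finsetSum _ fun k _ =>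
        (((hlim i).sub (hlim k)).abs).const_mul _
    refine ht.eventually (gt_mem_nhds ?_)
    have := comm_bound hK (hE x a) (hG x a) hKn.le
    linarith [hω x a]
  have s3 : ∀ᶠ N : ℕ in atTop, ∀ x y a b,
      ‖(∑ i, ((((⌊l i * N⌋₊ : ℝ) / (∑ j, (⌊l j * N⌋₊ : ℝ)) : ℝ)) : ℂ) * (E x a * E y b) i i)
        - (∑ i, (l i : ℂ) * (E x a * E y b) i i)‖ < η := by
    rw [eventually_all]; intro x
    rw [eventually_all]; intro y
    rw [eventually_all]; intro a
    rw [eventually_all]; intro b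
    have ht : Tendsto (fun N : ℕ =>
        ∑ i, ((((⌊l i * N⌋₊ : ℝ) / (∑ j, (⌊l j * N⌋₊ : ℝ)) : ℝ)) : ℂ) * (E x a * E y b) i i) atTop
        (𝓝 (∑ i, (l i : ℂ) * (E x a * E y b) i i)) :=
      tendsto_finsetSum _ fun i _ =>
        ((Complex.continuous_ofReal.tendsto _).comp (hlim i)).mul_const _
    have := (tendsto_iff_norm_sub_tendsto_zero.1 ht).eventually (gt_mem_nhds hη)
    exact this
  obtain ⟨N, hN1, hN2, hN3⟩ := (hpos.and (s2.and s3)).exists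
  obtain ⟨p, hp⟩ : ∃ p : α → ℕ, p = fun i => ⌊l i * N⌋₊ := ⟨_, rfl⟩
  have hpi : ∀ i, ⌊l i * N⌋₊ = p i := fun i => by rw [hp]
  simp only [hpi] at hN1 hN2 hN3
  obtain ⟨q, hq⟩ : ∃ q : ℝ, q = ∑ j, (p j : ℝ) := ⟨_, rfl⟩
  rw [← hq] at hN1
  simp only [← hq] at hN2 hN3
  obtain ⟨M, hM⟩ : ∃ M : ℕ, ∀ i, p i ≤ M :=
    ⟨∑ i, p i, fun i => Finset.single_le_sum (f := p) (fun _ _ => Nat.zero_le _) (Finset.mem_univ i)⟩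
  have hDp := Dm_proj p M
  have hDtr : (Dm p M).trace = q := by
    have := trace_Dm p M hM 1
    have h1 : amp M (1 : Matrix α α ℂ) = 1 := Matrix.one_kronecker_one
    rw [h1, Matrix.mul_one] at this
    rw [this, hq]; simp
  have hDn : ‖Dm p M‖ ^ 2 = q := by
    have h := frob_sq_trace (Dm p M)
    rw [hDp.1.eq, hDp.2, hDtr] at h
    exact_mod_cast h
  have hDn' : ‖Dm p M‖ = √q := by rw [← hDn, Real.sqrt_sq (norm_nonneg _)]
  have hdef : ∀ x a, ‖(1 - Dm p M) * (amp M (E x a) * Dm p M)‖ ≤ √q * √(2 * ω + η) := by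
    intro x a
    rw [← Real.sqrt_mul hN1.le]
    apply Real.le_sqrt_of_sq_le
    refine (defect_bound p M (E x a)).trans ?_
    have h := (hN2 x a).le
    have e : ∑ i, ∑ k, ‖E x a i k‖ ^ 2 * |(p i : ℝ) - p k|
        = q * ∑ i, ∑ k, ‖E x a i k‖ ^ 2 * |(p i : ℝ) / q - p k / q| := by
      simp only [Finset.mul_sum]
      refine Finset.sum_congr rfl fun i _ => Finset.sum_congr rfl fun k _ => ?_
      rw [← sub_div, abs_div, abs_of_pos hN1]
      field_simp
    rw [e]
    exact mul_le_mul_of_nonneg_left h hN1.le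
  have hP := fun x => hround (α × Fin M) (Dm p M) (fun a => amp M (E x a)) (√q * √(2 * ω + η)) hDp
    (fun a => amp_proj M (hE x a)) (amp_sum M (hEs x)) (by positivity) (hdef x)
  choose P hP1 hP2 hP3 hP4 using hP
  obtain ⟨p', h1, h2, h3⟩ := sync_real (Dm p M) P q hN1 hDp hP1 hP3 hP2 hDtr
  refine ⟨p', h1, h2, fun x y a b => ?_⟩
  have hqc : (q : ℂ) ≠ 0 := by exact_mod_cast hN1.ne'
  have t1 : ((amp M (E x a) * Dm p M)ᴴ * (amp M (E y b) * Dm p M)).trace / q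
      = ∑ i, (((p i : ℝ) / q : ℝ) : ℂ) * (E x a * E y b) i i := by
    have e : ((amp M (E x a) * Dm p M)ᴴ * (amp M (E y b) * Dm p M)).trace
        = (Dm p M * amp M (E x a * E y b)).trace := by
      rw [Matrix.conjTranspose_mul, hDp.1.eq, (amp_proj M (hE x a)).1.eq, ← amp_mul,
        ← Matrix.mul_assoc, Matrix.trace_mul_comm]
      simp only [← Matrix.mul_assoc, hDp.2]
    rw [e, trace_Dm p M hM, Finset.sum_div]
    refine Finset.sum_congr rfl fun i _ => ?_
    push_cast
    ring
  have t2 : ‖(p' x y a b : ℂ) - ∑ i, (((p i : ℝ) / q : ℝ) : ℂ) * (E x a * E y b) i i‖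
      ≤ 2 * (c * √(2 * ω + η)) := by
    rw [h3, ← t1, ← sub_div, ← Matrix.trace_sub, norm_div, Complex.norm_real,
      Real.norm_of_nonneg hN1.le, div_le_iff₀ hN1]
    have e : (P x a * Dm p M)ᴴ * (P y b * Dm p M)
        - (amp M (E x a) * Dm p M)ᴴ * (amp M (E y b) * Dm p M)
        = -((P x a * Dm p M)ᴴ * (amp M (E y b) * Dm p M - P y b * Dm p M))
          - (amp M (E x a) * Dm p M - P x a * Dm p M)ᴴ * (amp M (E y b) * Dm p M) := by
      rw [Matrix.conjTranspose_sub, Matrix.mul_sub, Matrix.sub_mul]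
      abel
    rw [e, Matrix.trace_sub, Matrix.trace_neg]
    refine (norm_sub_le _ _).trans ?_
    rw [norm_neg]
    have b1 := trace_le (P x a * Dm p M) (amp M (E y b) * Dm p M - P y b * Dm p M)
    have b2 := trace_le (amp M (E x a) * Dm p M - P x a * Dm p M) (amp M (E y b) * Dm p M)
    have n1 := (proj_mul_le (hP1 x a) (Dm p M)).trans hDn'.le
    have n2 := (proj_mul_le (amp_proj M (hE y b)) (Dm p M)).trans hDn'.le
    have n3 := hP4 y b
    have n4 := hP4 x a
    have hsq : √q * √q = q := Real.mul_self_sqrt hN1.le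
    have m1 : ‖P x a * Dm p M‖ * ‖amp M (E y b) * Dm p M - P y b * Dm p M‖
        ≤ √q * (c * (√q * √(2 * ω + η))) :=
      mul_le_mul n1 n3 (norm_nonneg _) (Real.sqrt_nonneg _)
    have m2 : ‖amp M (E x a) * Dm p M - P x a * Dm p M‖ * ‖amp M (E y b) * Dm p M‖
        ≤ (c * (√q * √(2 * ω + η))) * √q :=
      mul_le_mul n4 n2 (norm_nonneg _) (by positivity)
    have : √q * (c * (√q * √(2 * ω + η))) = c * √(2 * ω + η) * q := by
      linear_combination (c * √(2 * ω + η)) * hsq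
    nlinarith
  have t3 := (hN3 x y a b).le
  have t4 := s1 x y a b
  have := norm_sub_le_norm_sub_add_norm_sub (p' x y a b : ℂ)
    (∑ i, (((p i : ℝ) / q : ℝ) : ℂ) * (E x a * E y b) i i) (Kᴴ * E x a * K * G y b).trace
  have := norm_sub_le_norm_sub_add_norm_sub
    (∑ i, (((p i : ℝ) / q : ℝ) : ℂ) * (E x a * E y b) i i)
    (∑ i, (l i : ℂ) * (E x a * E y b) i i) (Kᴴ * E x a * K * G y b).trace
  linarith

lemma defect_sq {I O : Type} [Fintype I] [Fintype O] [DecidableEq O]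
    (E : I → O → Matrix α α ℂ) (G : I → O → Matrix β β ℂ) (K : Matrix α β ℂ)
    (hE : ∀ x a, IsProj (E x a)) (hEs : ∀ x, ∑ a, E x a = 1)
    (hG : ∀ x a, IsProj (G x a)) (hGs : ∀ x, ∑ a, G x a = 1)
    (p : I → I → O → O → ℝ)
    (hp : ∀ x y a b, (p x y a b : ℂ) = (Kᴴ * E x a * K * G y b).trace) (η : ℝ) (hη : 0 ≤ η)
    (hoff : ∀ x a b, a ≠ b → p x x a b ≤ η) (x : I) (a : O) :
    ‖E x a * K - K * G x a‖ ≤ √(2 * Fintype.card O * η) := by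
  apply Real.le_sqrt_of_sq_le
  have t1 : (Kᴴ * E x a * K).trace = ∑ b, (p x x a b : ℂ) := by
    simp only [hp]
    rw [← Matrix.trace_sum, ← Finset.mul_sum, hGs, Matrix.mul_one]
  have t2 : (Kᴴ * K * G x a).trace = ∑ b, (p x x b a : ℂ) := by
    simp only [hp]
    rw [← Matrix.trace_sum, ← Matrix.sum_mul, ← Matrix.sum_mul, ← Matrix.mul_sum, hEs,
      Matrix.mul_one]
  have t3 : (G x a * Kᴴ * E x a * K).trace = (p x x a a : ℂ) := by
    rw [hp]
    simp only [Matrix.mul_assoc]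
    rw [Matrix.trace_mul_comm]
    simp only [Matrix.mul_assoc]
  have t4 : (G x a * Kᴴ * K * G x a).trace = (Kᴴ * K * G x a).trace := by
    rw [Matrix.trace_mul_comm, ← Matrix.mul_assoc, ← Matrix.mul_assoc, (hG x a).2,
      Matrix.mul_assoc, Matrix.trace_mul_comm]
  have e : (E x a * K - K * G x a)ᴴ * (E x a * K - K * G x a)
      = Kᴴ * E x a * K - Kᴴ * E x a * K * G x a - G x a * Kᴴ * E x a * K
        + G x a * Kᴴ * K * G x a := by
    rw [Matrix.conjTranspose_sub, Matrix.conjTranspose_mul, Matrix.conjTranspose_mul,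
      (hE x a).1.eq, (hG x a).1.eq]
    have e1 : Kᴴ * E x a * K = Kᴴ * (E x a * E x a) * K := by rw [(hE x a).2]
    have e2 : Kᴴ * E x a * (E x a * K) = Kᴴ * E x a * K := by
      rw [e1]; simp only [Matrix.mul_assoc]
    rw [Matrix.mul_sub, Matrix.sub_mul, Matrix.sub_mul, e2]
    simp only [Matrix.mul_assoc]
    abel
  have h := frob_sq_trace (E x a * K - K * G x a)
  rw [e, Matrix.trace_add, Matrix.trace_sub, Matrix.trace_sub, t1, ← hp, t3, t4, t2] at h
  have h' : ‖E x a * K - K * G x a‖ ^ 2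
      = (∑ b, p x x a b) - p x x a a - p x x a a + ∑ b, p x x b a := by exact_mod_cast h
  rw [← Finset.add_sum_erase _ _ (Finset.mem_univ a),
    ← Finset.add_sum_erase _ (fun b => p x x b a) (Finset.mem_univ a)] at h'
  have hcard : ((Finset.univ.erase a).card : ℝ) ≤ Fintype.card O := by
    exact_mod_cast Finset.card_le_univ _
  have b1 : ∑ b ∈ Finset.univ.erase a, p x x a b ≤ Fintype.card O * η := by
    refine (Finset.sum_le_card_nsmul _ _ η ?_).trans ?_
    · intro b hb
      exact hoff x a b (Finset.ne_of_mem_erase hb).symm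
    · rw [nsmul_eq_mul]; gcongr
  have b2 : ∑ b ∈ Finset.univ.erase a, p x x b a ≤ Fintype.card O * η := by
    refine (Finset.sum_le_card_nsmul _ _ η ?_).trans ?_
    · intro b hb
      exact hoff x b a (Finset.ne_of_mem_erase hb)
    · rw [nsmul_eq_mul]; gcongr
  rw [h']
  linarith

lemma main_step {I O : Type} [Fintype I] [Fintype O] [DecidableEq O] (a₀ : O) :
    ∃ c : ℝ, 0 ≤ c ∧ ∀ p ∈ QCorr I O, ∀ η : ℝ, 0 < η → (∀ x a b, a ≠ b → p x x a b ≤ η) →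
      ∃ p' ∈ QCorr I O, Synchronous p' ∧ ∀ x y a b, |p' x y a b - p x y a b| ≤
        √(2 * Fintype.card O * η) + η + 2 * (c * √(2 * √(2 * Fintype.card O * η) + η)) := by
  obtain ⟨c, hc, hround⟩ := pvm_round a₀
  refine ⟨c, hc, ?_⟩
  rintro p ⟨dA, dB, -, -, E, F, ψ, hE, hEs, hF, hFs, hψ, hp⟩ η hη hoff
  obtain ⟨K₀, hK₀⟩ : ∃ K₀ : Matrix (Fin dA) (Fin dB) ℂ, K₀ = Matrix.of fun i j => ψ (i, j) :=
    ⟨_, rfl⟩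
  rw [norm_form, ← hK₀] at hψ
  simp only [quad_form, ← hK₀] at hp
  obtain ⟨U, l, hU, hU', hUl⟩ := spectral (Matrix.isHermitian_mul_conjTranspose_self K₀)
  have hk : ∀ X Y : Matrix (Fin dA) (Fin dA) ℂ, (Uᴴ * X * U) * (Uᴴ * Y * U) = Uᴴ * (X * Y) * U := by
    intro X Y
    calc _ = Uᴴ * X * (U * Uᴴ) * Y * U := by simp only [Matrix.mul_assoc]
      _ = _ := by rw [hU']; simp only [Matrix.mul_assoc, Matrix.mul_one]
  have gE : ∀ x a, IsProj (Uᴴ * E x a * U) := by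
    intro x a
    refine ⟨?_, by rw [hk, (hE x a).2]⟩
    unfold Matrix.IsHermitian
    rw [Matrix.conjTranspose_mul, Matrix.conjTranspose_mul, Matrix.conjTranspose_conjTranspose,
      (hE x a).1.eq, Matrix.mul_assoc]
  have gEs : ∀ x, ∑ a, Uᴴ * E x a * U = 1 := by
    intro x
    rw [← Finset.sum_mul, ← Finset.mul_sum, hEs, Matrix.mul_one, hU]
  have gG : ∀ y b, IsProj (F y b)ᵀ := fun y b =>
    ⟨(hF y b).1.transpose, by rw [← Matrix.transpose_mul, (hF y b).2]⟩
  have gGs : ∀ y, ∑ b, (F y b)ᵀ = 1 := fun y => by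
    rw [← Matrix.transpose_sum, hFs, Matrix.transpose_one]
  have gK : (Uᴴ * K₀) * (Uᴴ * K₀)ᴴ = Matrix.diagonal (fun i => (l i : ℂ)) := by
    rw [Matrix.conjTranspose_mul, Matrix.conjTranspose_conjTranspose]
    calc _ = Uᴴ * (K₀ * K₀ᴴ) * U := by simp only [Matrix.mul_assoc]
      _ = (Uᴴ * U) * Matrix.diagonal (fun i => (l i : ℂ)) * (Uᴴ * U) := by
        rw [hUl]; simp only [Matrix.mul_assoc]
      _ = _ := by rw [hU, Matrix.one_mul, Matrix.mul_one]
  have gK1 : ((Uᴴ * K₀)ᴴ * (Uᴴ * K₀)).trace = 1 := by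
    rw [Matrix.conjTranspose_mul, Matrix.conjTranspose_conjTranspose, Matrix.mul_assoc,
      ← Matrix.mul_assoc U, hU', Matrix.one_mul, ← hψ]
  have gp : ∀ x y a b, (p x y a b : ℂ)
      = ((Uᴴ * K₀)ᴴ * (Uᴴ * E x a * U) * (Uᴴ * K₀) * (F y b)ᵀ).trace := by
    intro x y a b
    rw [hp, Matrix.conjTranspose_mul, Matrix.conjTranspose_conjTranspose]
    have : K₀ᴴ * U * (Uᴴ * E x a * U) * (Uᴴ * K₀)
        = K₀ᴴ * (U * Uᴴ) * E x a * (U * Uᴴ) * K₀ := by simp only [Matrix.mul_assoc]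
    rw [this, hU', Matrix.mul_one, Matrix.mul_one]
  obtain ⟨p', h1, h2, h3⟩ := core c hc hround (fun x a => Uᴴ * E x a * U) (fun y b => (F y b)ᵀ)
    (Uᴴ * K₀) l gE gEs gG gK gK1 (√(2 * Fintype.card O * η)) η hη
    (defect_sq _ _ _ gE gEs gG gGs p gp η hη.le hoff) (Real.sqrt_nonneg _)
  refine ⟨p', h1, h2, fun x y a b => ?_⟩
  have := h3 x y a b
  rwa [← gp, ← Complex.ofReal_sub, Complex.norm_real, Real.norm_eq_abs] at this

end SyncQ

/-- The synchronous part of the closure of `C_q(n,m)` equals the closure of the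
synchronous part of `C_q(n,m)`. -/
theorem syncPartOfClosure_eq_closureOfSyncPart (n m : ℕ) (hn : 1 ≤ n) (hm : 1 ≤ m) :
    {p ∈ closure (QCorr (Fin n) (Fin m)) | Synchronous p} =
      closure {p ∈ QCorr (Fin n) (Fin m) | Synchronous p} := by
  apply Set.Subset.antisymm
  · rintro p ⟨hpc, hps⟩
    obtain ⟨c, hc, H⟩ := SyncQ.main_step (I := Fin n) (O := Fin m) ⟨0, hm⟩
    rw [Metric.mem_closure_iff]
    intro ε hε
    have hcont : Continuous fun η : ℝ => η + (√(2 * Fintype.card (Fin m) * η) + η +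
        2 * (c * √(2 * √(2 * Fintype.card (Fin m) * η) + η))) := by fun_prop
    have h0 := hcont.tendsto 0
    simp only [mul_zero, Real.sqrt_zero, add_zero] at h0
    have h1 := (h0.eventually (gt_mem_nhds hε)).filter_mono
      (nhdsWithin_le_nhds (s := Set.Ioi (0 : ℝ)))
    obtain ⟨η, hη1, hη⟩ := (h1.and self_mem_nhdsWithin).exists
    have hη0 : 0 < η := hη
    obtain ⟨p₁, hp₁, hd⟩ := Metric.mem_closure_iff.1 hpc η hη0
    have hentry : ∀ x y a b, |p x y a b - p₁ x y a b| ≤ η := by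
      intro x y a b
      rw [← Real.dist_eq]
      exact (((dist_le_pi_dist _ _ b).trans (dist_le_pi_dist _ _ a)).trans
        ((dist_le_pi_dist _ _ y).trans (dist_le_pi_dist _ _ x))).trans hd.le
    obtain ⟨p', h1, h2, h3⟩ := H p₁ hp₁ η hη0 (by
      intro x a b hab
      have := hentry x x a b
      rw [hps x a b hab, zero_sub, abs_neg] at this
      exact (le_abs_self _).trans this)
    refine ⟨p', ⟨h1, h2⟩, lt_of_le_of_lt ?_ hη1⟩
    have hB : 0 ≤ η + (√(2 * Fintype.card (Fin m) * η) + η +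
        2 * (c * √(2 * √(2 * Fintype.card (Fin m) * η) + η))) := by positivity
    refine (dist_pi_le_iff hB).2 fun x => (dist_pi_le_iff hB).2 fun y =>
      (dist_pi_le_iff hB).2 fun a => (dist_pi_le_iff hB).2 fun b => ?_
    rw [Real.dist_eq]
    have e1 := hentry x y a b
    have e2 := h3 x y a b
    rw [abs_sub_comm] at e2
    exact (abs_sub_le _ (p₁ x y a b) _).trans (add_le_add e1 e2)
  · intro p hp
    refine ⟨closure_mono (fun q hq => hq.1) hp, ?_⟩
    have hcl : IsClosed {p : Fin n → Fin n → Fin m → Fin m → ℝ | Synchronous p} := by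
      have : {p : Fin n → Fin n → Fin m → Fin m → ℝ | Synchronous p}
          = ⋂ x, ⋂ a, ⋂ b, ⋂ (_ : a ≠ b), {p | p x x a b = 0} := by
        ext p; simp [Synchronous]
      rw [this]
      refine isClosed_iInter fun x => isClosed_iInter fun a => isClosed_iInter fun b =>
        isClosed_iInter fun _ => isClosed_eq ?_ continuous_const
      fun_prop
    exact closure_minimal (fun q hq => hq.2) hcl hp
end
end

section
/- There exist integers m ≥ 1 and n ≥ 1 such that the set C_q^s(m, 2^n) of synchronous quantum correlations is not a closed subset of ℝ^{m²(2^n)²}. -/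
open Matrix

noncomputable section

lemma pair_proj {J : Type} [Fintype J] [DecidableEq J] (σ : J → J) (hσ : ∀ i, σ (σ i) = i)
    (hne : ∀ i, σ i ≠ i) (x : J → ℝ) (hx : ∀ i, 0 ≤ x i) (hs : ∀ i, x i + x (σ i) = 2) :
    ∃ P Q : Matrix J J ℂ, P.IsHermitian ∧ P * P = P ∧ Q.IsHermitian ∧ Q * Q = Q ∧
      P + Q = Matrix.diagonal (fun i => (x i : ℂ)) := by
  -- the off-diagonal part
  let S : Matrix J J ℂ := Matrix.of fun i j =>
    if j = σ i then ((√(x i * x j) / 2 : ℝ) : ℂ) else 0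
  let D : Matrix J J ℂ := Matrix.diagonal (fun i => ((x i / 2 : ℝ) : ℂ))
  have hiff : ∀ i j, i = σ j ↔ j = σ i := by
    intro i j
    constructor
    · rintro rfl; exact (hσ j).symm
    · rintro rfl; exact (hσ i).symm
  have hS : S.IsHermitian := by
    ext i j
    simp only [S, Matrix.conjTranspose_apply, Matrix.of_apply, hiff i j, mul_comm (x j)]
    split_ifs <;> simp
  have hD : D.IsHermitian := by
    apply Matrix.isHermitian_diagonal_of_self_adjoint
    ext i
    simp
  have hSS : S * S = Matrix.diagonal (fun i => ((x i * x (σ i) / 4 : ℝ) : ℂ)) := by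
    ext i j
    rw [Matrix.mul_apply, Finset.sum_eq_single (σ i)]
    · simp only [S, Matrix.of_apply, if_true, hσ, Matrix.diagonal_apply]
      by_cases h : i = j
      · subst h
        simp only [if_true]
        rw [← Complex.ofReal_mul]
        congr 1
        rw [mul_comm (x (σ i)), div_mul_div_comm,
          Real.mul_self_sqrt (mul_nonneg (hx _) (hx _))]
        norm_num
      · simp [h, Ne.symm h]
    · intro k _ hk
      simp [S, hk]
    · simp
  have hDD : D * D = Matrix.diagonal (fun i => ((x i * x i / 4 : ℝ) : ℂ)) := by
    simp only [D, Matrix.diagonal_mul_diagonal]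
    congr 1
    ext i
    rw [← Complex.ofReal_mul]
    congr 1
    ring
  have hsum : D * D + S * S = D := by
    rw [hDD, hSS, Matrix.diagonal_add]
    simp only [D]
    congr 1
    ext i
    rw [← Complex.ofReal_add]
    congr 1
    have := hs i
    have h2 : x (σ i) = 2 - x i := by linarith
    rw [h2]; ring
  have hDS : D * S + S * D = S := by
    ext i j
    simp only [D, Matrix.add_apply, Matrix.diagonal_mul, Matrix.mul_diagonal, S, Matrix.of_apply]
    split_ifs with h
    · subst h
      rw [mul_comm, ← mul_add, ← Complex.ofReal_add]
      have : x i / 2 + x (σ i) / 2 = 1 := by linarith [hs i]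
      rw [this]; simp
    · simp
  refine ⟨D + S, D - S, hD.add hS, ?_, hD.sub hS, ?_, ?_⟩
  · calc (D + S) * (D + S) = (D * D + S * S) + (D * S + S * D) := by noncomm_ring
      _ = D + S := by rw [hsum, hDS]
  · calc (D - S) * (D - S) = (D * D + S * S) - (D * S + S * D) := by noncomm_ring
      _ = D - S := by rw [hsum, hDS]
  · simp only [add_add_sub_cancel]
    simp only [D, Matrix.diagonal_add]
    congr 1
    ext i
    rw [← Complex.ofReal_add]
    congr 1
    ring

lemma five_proj (L p : ℕ) [NeZero L] (hp : p ≤ L) :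
    ∃ P : Fin 5 → Matrix (ZMod L × Bool) (ZMod L × Bool) ℂ,
      (∀ k, (P k).IsHermitian ∧ P k * P k = P k) ∧
      ∑ k, P k = (((2 + (p / L : ℝ) / 2 : ℝ)) : ℂ) • 1 := by
  have hL : (0 : ℝ) < L := by exact_mod_cast Nat.pos_of_ne_zero (NeZero.ne L)
  set θ : ℝ := (p / L : ℝ) / 2 with hθ
  have hpL : (p / L : ℝ) ≤ 1 := by
    rw [div_le_one hL]; exact_mod_cast hp
  have hpL0 : (0 : ℝ) ≤ p / L := by positivity
  let t : ZMod L → ℝ := fun i => ((i * (p : ZMod L)).val : ℝ) / L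
  have ht0 : ∀ i, 0 ≤ t i := fun i => by positivity
  have ht1 : ∀ i, t i ≤ 1 := fun i => by
    simp only [t]
    rw [div_le_one hL]
    exact_mod_cast (ZMod.val_lt _).le
  -- the wrap-around indicator
  have hw : ∀ i, t (i - 1) + 2 * θ - t i = 0 ∨ t (i - 1) + 2 * θ - t i = 1 := by
    intro i
    have h1 : i * (p : ZMod L) = (i - 1) * p + p := by ring
    set a := (i - 1) * (p : ZMod L) with ha
    have h2 : ∃ q : ℕ, a.val + p = (i * (p : ZMod L)).val + L * q ∧ q ≤ 1 := by
      refine ⟨(a.val + p) / L, ?_, ?_⟩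
      · have : (i * (p : ZMod L)).val = (a.val + p) % L := by
          rw [h1, ← ZMod.val_natCast]
          congr 1
          simp
        rw [this]
        exact (Nat.mod_add_div _ _).symm
      · have := ZMod.val_lt a
        apply Nat.lt_succ_iff.mp
        apply Nat.div_lt_of_lt_mul
        omega
    obtain ⟨q, hq, hq1⟩ := h2
    have hq' : (a.val : ℝ) + p = (i * (p : ZMod L)).val + L * q := by exact_mod_cast hq
    have h3 : t (i - 1) + 2 * θ - t i = q := by
      simp only [t, hθ, ← ha]
      field_simp
      linarith
    rw [h3]
    interval_cases q <;> simp
  obtain ⟨P0, P1, a1, a2, a3, a4, a5⟩ := pair_proj (J := ZMod L × Bool)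
    (fun i => (i.1, !i.2)) (by simp) (by rintro ⟨i, b⟩; cases b <;> simp)
    (fun i => if i.2 then 2 - t i.1 else t i.1)
    (by
      rintro ⟨i, b⟩
      have := ht0 i
      have := ht1 i
      cases b <;> simp <;> linarith)
    (by
      rintro ⟨i, b⟩
      cases b <;> simp)
  obtain ⟨P2, P3, b1, b2, b3, b4, b5⟩ := pair_proj (J := ZMod L × Bool)
    (fun i => if i.2 then (i.1 + 1, false) else (i.1 - 1, true))
    (by rintro ⟨i, b⟩; cases b <;> simp) (by rintro ⟨i, b⟩; cases b <;> simp)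
    (fun i => if i.2 then θ + t i.1 else 2 - θ - t (i.1 - 1))
    (by
      rintro ⟨i, b⟩
      have := ht0 i
      have := ht1 (i - 1)
      cases b <;> simp <;> linarith)
    (by
      rintro ⟨i, b⟩
      cases b <;> simp)
  let z : ZMod L × Bool → ℝ := fun i => if i.2 then 0 else t (i.1 - 1) + 2 * θ - t i.1
  have hz : ∀ i, z i * z i = z i := by
    rintro ⟨i, b⟩
    cases b
    · simp only [z]
      rcases hw i with h | h <;> simp [h]
    · simp [z]
  let P4 : Matrix (ZMod L × Bool) (ZMod L × Bool) ℂ := Matrix.diagonal (fun i => (z i : ℂ))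
  have c1 : P4.IsHermitian := by
    apply Matrix.isHermitian_diagonal_of_self_adjoint
    ext i
    simp
  have c2 : P4 * P4 = P4 := by
    simp only [P4, Matrix.diagonal_mul_diagonal, ← Complex.ofReal_mul, hz]
  refine ⟨![P0, P1, P2, P3, P4], ?_, ?_⟩
  · intro k
    fin_cases k
    · exact ⟨a1, a2⟩
    · exact ⟨a3, a4⟩
    · exact ⟨b1, b2⟩
    · exact ⟨b3, b4⟩
    · exact ⟨c1, c2⟩
  · have : ∑ k, ![P0, P1, P2, P3, P4] k = (P0 + P1) + (P2 + P3) + P4 := by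
      simp [Fin.sum_univ_five]
      abel
    rw [this, a5, b5]
    simp only [P4, Matrix.diagonal_add, ← Complex.ofReal_add]
    rw [Matrix.smul_one_eq_diagonal]
    congr 1
    ext ⟨i, b⟩
    congr 1
    cases b <;> simp [z] <;> ring

lemma corr_eq {a b : ℕ} (A : Matrix (Fin a) (Fin a) ℂ) (B : Matrix (Fin b) (Fin b) ℂ)
    (X : Matrix (Fin b) (Fin a) ℂ) :
    star X.vec ⬝ᵥ (Matrix.kroneckerMap (· * ·) A B).mulVec X.vec
      = (Xᴴ * (B * X * Aᵀ)).trace := by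
  rw [← Matrix.star_vec_dotProduct_vec]
  congr 1
  exact Matrix.kronecker_mulVec_vec B X A

lemma trace_sq {a b : ℕ} (F : Matrix (Fin b) (Fin b) ℂ) (G : Matrix (Fin a) (Fin a) ℂ)
    (X : Matrix (Fin b) (Fin a) ℂ) (hF : F.IsHermitian) (hF2 : F * F = F)
    (hG : G.IsHermitian) (hG2 : G * G = G) :
    (Xᴴ * (F * X * G)).trace = ((F * X * G)ᴴ * (F * X * G)).trace := by
  have h1 : (F * X * G)ᴴ * (F * X * G) = G * (Xᴴ * ((F * F) * X * G)) := by
    simp only [Matrix.conjTranspose_mul, hF.eq, hG.eq, Matrix.mul_assoc]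
  rw [h1, hF2, Matrix.trace_mul_comm G]
  simp only [Matrix.mul_assoc, hG2]

lemma transpose_proj {a : ℕ} {E : Matrix (Fin a) (Fin a) ℂ}
    (h : E.IsHermitian ∧ E * E = E) : Eᵀ.IsHermitian ∧ Eᵀ * Eᵀ = Eᵀ :=
  ⟨h.1.transpose, by rw [← Matrix.transpose_mul, h.2]⟩

open ComplexOrder in
lemma qcorr_bounds {I O : Type} [Fintype I] [Fintype O] {p : I → I → O → O → ℝ}
    (hp : p ∈ QCorr I O) (x y : I) (a b : O) : p x y a b ∈ Set.Icc (0 : ℝ) 1 := by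
  obtain ⟨dA, dB, -, -, E, F, ψ, hE, hE1, hF, hF1, hψ, hpp⟩ := hp
  obtain ⟨X, rfl⟩ := Matrix.vec_bijective.surjective ψ
  have h0 : ∀ a b, 0 ≤ p x y a b := by
    intro a b
    have h := hpp x y a b
    rw [corr_eq, trace_sq _ _ _ (hF y b).1 (hF y b).2 (transpose_proj (hE x a)).1
      (transpose_proj (hE x a)).2] at h
    have h2 := (Matrix.posSemidef_conjTranspose_mul_self (F y b * X * (E x a)ᵀ)).trace_nonneg
    rw [← h] at h2
    exact Complex.zero_le_real.mp h2
  refine ⟨h0 a b, ?_⟩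
  have hs : ∑ a, ∑ b, p x y a b = 1 := by
    have : ((∑ a, ∑ b, p x y a b : ℝ) : ℂ) = 1 := by
      push_cast
      simp only [hpp, corr_eq, ← Matrix.trace_sum, ← Matrix.mul_sum, ← Matrix.sum_mul, hF1,
        ← Matrix.transpose_sum, hE1]
      rw [Matrix.star_vec_dotProduct_vec] at hψ
      simpa using hψ
    exact_mod_cast this
  rw [← hs]
  calc p x y a b ≤ ∑ b, p x y a b :=
        Finset.single_le_sum (f := fun b => p x y a b) (fun b _ => h0 a b) (Finset.mem_univ b)
    _ ≤ _ := Finset.single_le_sum (f := fun a => ∑ b, p x y a b)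
        (fun a _ => Finset.sum_nonneg fun b _ => h0 a b) (Finset.mem_univ a)

/-- The tracial synchronous correlation of a family of projections summing to a scalar. -/
lemma exists_corr {J : Type} [Fintype J] [DecidableEq J] [Nonempty J] (l : ℝ)
    (P : Fin 5 → Matrix J J ℂ) (hP : ∀ k, (P k).IsHermitian ∧ P k * P k = P k)
    (hsum : ∑ k, P k = (l : ℂ) • 1) :
    ∃ p ∈ QCorr (Fin 5) (Fin 2), Synchronous p ∧ ∑ x, ∑ y, p x y 0 0 = l ^ 2 ∧
      ∑ x, p x x 0 0 = l := by
  obtain ⟨d, ⟨e⟩⟩ : ∃ d, Nonempty (Fin d ≃ J) := ⟨_, ⟨(Fintype.equivFin J).symm⟩⟩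
  have hd : 0 < d := by
    obtain ⟨j⟩ := (inferInstance : Nonempty J)
    exact (e.symm j).pos
  have hd' : (0 : ℝ) < d := by exact_mod_cast hd
  let Q : Fin 5 → Matrix (Fin d) (Fin d) ℂ := fun k => (P k).submatrix e e
  have hQ : ∀ k, (Q k).IsHermitian ∧ Q k * Q k = Q k := fun k =>
    ⟨(hP k).1.submatrix e, by simp only [Q, Matrix.submatrix_mul_equiv, (hP k).2]⟩
  have hQs : ∑ k, Q k = (l : ℂ) • 1 := by
    have : ∑ k, Q k = (∑ k, P k).submatrix e e := by
      ext i j; simp [Q, Matrix.sum_apply]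
    rw [this, hsum]
    ext i j
    simp [Matrix.one_apply]
  let E : Fin 5 → Fin 2 → Matrix (Fin d) (Fin d) ℂ := fun k => ![Q k, 1 - Q k]
  have hE : ∀ x a, (E x a).IsHermitian ∧ E x a * E x a = E x a := by
    intro x a
    fin_cases a
    · exact hQ x
    · refine ⟨Matrix.isHermitian_one.sub (hQ x).1, ?_⟩
      change (1 - Q x) * (1 - Q x) = 1 - Q x
      have : (1 - Q x) * (1 - Q x) = 1 - Q x - Q x + Q x * Q x := by noncomm_ring
      rw [this, (hQ x).2]
      abel
  have hE1 : ∀ x, ∑ a, E x a = 1 := by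
    intro x; simp [E]
  let c : ℂ := ((√(d : ℝ))⁻¹ : ℝ)
  have hc : star c * c * d = 1 := by
    simp only [c, Complex.star_def, Complex.conj_ofReal]
    rw [← Complex.ofReal_mul, ← mul_inv, Real.mul_self_sqrt hd'.le, ← Complex.ofReal_natCast,
      ← Complex.ofReal_mul, inv_mul_cancel₀ hd'.ne']
    simp
  let X : Matrix (Fin d) (Fin d) ℂ := c • 1
  have hval : ∀ x y a b, star X.vec ⬝ᵥ
      (Matrix.kroneckerMap (· * ·) (E x a) (E y b)ᵀ).mulVec X.vec
      = star c * c * (E x a * E y b).trace := by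
    intro x y a b
    rw [corr_eq]
    simp only [X, Matrix.conjTranspose_smul, Matrix.conjTranspose_one, Matrix.smul_mul,
      Matrix.mul_smul, Matrix.one_mul, Matrix.mul_one, Matrix.trace_smul,
      ← Matrix.transpose_mul, Matrix.trace_transpose, smul_eq_mul]
    ring
  have hreal : ∀ x y a b, ∃ r : ℝ, (r : ℂ) = star c * c * (E x a * E y b).trace := by
    intro x y a b
    have : star (star c * c * (E x a * E y b).trace) = star c * c * (E x a * E y b).trace := by
      rw [star_mul', star_mul', star_star, ← Matrix.trace_conjTranspose,
        Matrix.conjTranspose_mul, (hE x a).1.eq, (hE y b).1.eq, Matrix.trace_mul_comm]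
      ring
    exact ⟨_, Complex.conj_eq_iff_re.mp this⟩
  choose p hp using hreal
  refine ⟨p, ⟨d, d, hd, hd, E, fun y b => (E y b)ᵀ, X.vec, hE, hE1,
    fun y b => transpose_proj (hE y b), fun y => ?_, ?_, ?_⟩, ?_, ?_, ?_⟩
  · rw [← Matrix.transpose_sum, hE1, Matrix.transpose_one]
  · rw [Matrix.star_vec_dotProduct_vec]
    simp only [X, Matrix.conjTranspose_smul, Matrix.conjTranspose_one, Matrix.smul_mul,
      Matrix.mul_smul, Matrix.one_mul, Matrix.trace_smul, smul_eq_mul, Matrix.trace_one,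
      Fintype.card_fin]
    rw [← hc]; ring
  · intro x y a b
    rw [hp, hval]
  · intro x a b hab
    have h0 : E x a * E x b = 0 := by
      have h01 : Q x * (1 - Q x) = 0 := by rw [mul_sub, (hQ x).2, mul_one, sub_self]
      have h10 : (1 - Q x) * Q x = 0 := by rw [sub_mul, (hQ x).2, one_mul, sub_self]
      fin_cases a <;> fin_cases b
      · exact absurd rfl hab
      · exact h01
      · exact h10
      · exact absurd rfl hab
    have := hp x x a b
    rw [h0] at this
    simpa using this
  · have : ((∑ x, ∑ y, p x y 0 0 : ℝ) : ℂ) = ((l ^ 2 : ℝ) : ℂ) := by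
      push_cast
      simp only [hp]
      change ∑ x, ∑ y, star c * c * (Q x * Q y).trace = _
      simp only [← Finset.mul_sum, ← Matrix.trace_sum, ← Matrix.sum_mul, hQs]
      simp only [Matrix.smul_mul, Matrix.mul_smul, Matrix.one_mul, Matrix.trace_smul,
        smul_eq_mul, Matrix.trace_one, Fintype.card_fin]
      linear_combination (l : ℂ) ^ 2 * hc
    exact_mod_cast this
  · have : ((∑ x, p x x 0 0 : ℝ) : ℂ) = (l : ℂ) := by
      push_cast
      simp only [hp]
      change ∑ x, star c * c * (Q x * Q x).trace = _
      simp only [(hQ _).2, ← Finset.mul_sum, ← Matrix.trace_sum, hQs]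
      simp only [Matrix.trace_smul, smul_eq_mul, Matrix.trace_one, Fintype.card_fin]
      linear_combination (l : ℂ) * hc
    exact_mod_cast this

lemma trace_idem {V : Type*} [AddCommGroup V] [Module ℂ V] [FiniteDimensional ℂ V]
    (f : V →ₗ[ℂ] V) (hf : IsIdempotentElem f) :
    LinearMap.trace ℂ V f = (Module.finrank ℂ (LinearMap.range f) : ℂ) :=
  (LinearMap.IsIdempotentElem.isProj_range f hf).trace

lemma rational_of_corr (l : ℝ) (p : Fin 5 → Fin 5 → Fin 2 → Fin 2 → ℝ)
    (hp : p ∈ QCorr (Fin 5) (Fin 2)) (hs : Synchronous p)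
    (h2 : ∑ x, ∑ y, p x y 0 0 = l ^ 2) (h1 : ∑ x, p x x 0 0 = l) : ¬ Irrational l := by
  obtain ⟨dA, dB, -, -, E, F, ψ, hE, hE1, hF, hF1, hψ, hpp⟩ := hp
  obtain ⟨X, rfl⟩ := Matrix.vec_bijective.surjective ψ
  rw [Matrix.star_vec_dotProduct_vec] at hψ
  have hzero : ∀ x a b, a ≠ b → F x b * X * (E x a)ᵀ = 0 := by
    intro x a b hab
    have h := hpp x x a b
    rw [corr_eq, trace_sq _ _ _ (hF x b).1 (hF x b).2 (transpose_proj (hE x a)).1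
      (transpose_proj (hE x a)).2, hs x a b hab] at h
    open ComplexOrder in
    exact Matrix.trace_conjTranspose_mul_self_eq_zero_iff.mp (by rw [← h]; simp)
  have hcomm : ∀ x, F x 0 * X = X * (E x 0)ᵀ := by
    intro x
    have e1 : (E x 0)ᵀ + (E x 1)ᵀ = 1 := by
      rw [← Matrix.transpose_add, ← Fin.sum_univ_two, hE1, Matrix.transpose_one]
    have f1 : F x 0 + F x 1 = 1 := by rw [← Fin.sum_univ_two, hF1]
    calc F x 0 * X = F x 0 * X * ((E x 0)ᵀ + (E x 1)ᵀ) := by rw [e1, Matrix.mul_one]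
      _ = F x 0 * X * (E x 0)ᵀ + F x 1 * X * (E x 0)ᵀ := by
        rw [Matrix.mul_add, hzero x 1 0 (by simp), hzero x 0 1 (by simp)]
      _ = (F x 0 + F x 1) * X * (E x 0)ᵀ := by rw [Matrix.add_mul, Matrix.add_mul]
      _ = _ := by rw [f1, Matrix.one_mul]
  have hval : ∀ x y, (p x y 0 0 : ℂ) = (Xᴴ * (F y 0 * F x 0 * X)).trace := by
    intro x y
    rw [hpp, corr_eq, Matrix.mul_assoc, ← hcomm, Matrix.mul_assoc]
  set B := ∑ x, F x 0 with hB
  have hBh : Bᴴ = B := by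
    rw [hB, Matrix.conjTranspose_sum]
    exact Finset.sum_congr rfl fun x _ => (hF x 0).1.eq
  have hB2 : (Xᴴ * (B * B * X)).trace = (l : ℂ) ^ 2 := by
    rw [← Complex.ofReal_pow, ← h2]
    push_cast
    simp only [hval, ← Matrix.trace_sum, ← Matrix.mul_sum, ← Matrix.sum_mul, ← hB]
  have hB1 : (Xᴴ * (B * X)).trace = (l : ℂ) := by
    rw [← h1]
    push_cast
    simp only [hval, (hF _ 0).2, ← Matrix.trace_sum, ← Matrix.mul_sum, ← Matrix.sum_mul, ← hB]
  have hBX : B * X = (l : ℂ) • X := by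
    rw [← sub_eq_zero]
    open ComplexOrder in
    apply Matrix.trace_conjTranspose_mul_self_eq_zero_iff.mp
    have : (B * X - (l : ℂ) • X)ᴴ * (B * X - (l : ℂ) • X) =
        Xᴴ * (B * B * X) - (2 * (l : ℂ)) • (Xᴴ * (B * X)) + ((l : ℂ) ^ 2) • (Xᴴ * X) := by
      simp only [Matrix.conjTranspose_sub, Matrix.conjTranspose_mul, Matrix.conjTranspose_smul,
        hBh, Matrix.sub_mul, Matrix.mul_sub, Matrix.smul_mul, Matrix.mul_smul,
        Matrix.mul_assoc, Complex.star_def, Complex.conj_ofReal]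
      module
    rw [this, Matrix.trace_add, Matrix.trace_sub, Matrix.trace_smul, Matrix.trace_smul, hB2, hB1,
      hψ]
    simp only [smul_eq_mul]
    ring
  -- restrict to the column space of `X`
  let V := LinearMap.range X.mulVecLin
  have hV : ∀ x, ∀ v ∈ V, (F x 0).mulVecLin v ∈ V := by
    rintro x _ ⟨w, rfl⟩
    refine ⟨(E x 0)ᵀ.mulVec w, ?_⟩
    simp only [Matrix.mulVecLin_apply, Matrix.mulVec_mulVec, hcomm]
  let f : Fin 5 → (V →ₗ[ℂ] V) := fun x => (F x 0).mulVecLin.restrict (hV x)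
  have hf : ∀ x, IsIdempotentElem (f x) := by
    intro x
    ext1 v
    apply Subtype.ext
    simp [f, (hF x 0).2, Matrix.mulVec_mulVec]
  have hfs : ∑ x, f x = (l : ℂ) • LinearMap.id := by
    ext1 ⟨v, w, hw⟩
    apply Subtype.ext
    subst hw
    simp only [f, LinearMap.sum_apply, AddSubmonoidClass.coe_finsetSum,
      LinearMap.coe_restrict_apply,
      Matrix.mulVecLin_apply, ← Matrix.sum_mulVec, LinearMap.smul_apply, LinearMap.id_apply,
      Submodule.coe_smul]
    rw [← hB, Matrix.mulVec_mulVec, hBX, Matrix.smul_mulVec]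
  have htr := congrArg (LinearMap.trace ℂ V) hfs
  rw [map_sum, map_smul, LinearMap.trace_id] at htr
  have htf : ∀ x, LinearMap.trace ℂ V (f x) = (Module.finrank ℂ (LinearMap.range (f x)) : ℂ) :=
    fun x => trace_idem (f x) (hf x)
  simp only [htf] at htr
  have hVne : Module.finrank ℂ V ≠ 0 := by
    intro h0
    have : V = ⊥ := Submodule.finrank_eq_zero.mp h0
    have hX : X = 0 := by
      have := LinearMap.range_eq_bot.mp this
      ext i j
      have := congrFun (LinearMap.congr_fun this (Pi.single j 1)) i
      simpa using this
    rw [hX] at hψ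
    simp at hψ
  have hl : l = ((∑ x, Module.finrank ℂ (LinearMap.range (f x)) : ℕ) : ℝ) /
      (Module.finrank ℂ V : ℝ) := by
    rw [eq_div_iff (by exact_mod_cast hVne)]
    rw [smul_eq_mul] at htr
    have : ((l * (Module.finrank ℂ V : ℝ) : ℝ) : ℂ) =
      (((∑ x, Module.finrank ℂ (LinearMap.range (f x)) : ℕ) : ℝ) : ℂ) := by
      push_cast
      exact htr.symm
    exact_mod_cast this
  rw [hl]
  intro hirr
  apply hirr
  exact ⟨((∑ x, Module.finrank ℂ (LinearMap.range (f x)) : ℕ) : ℚ) /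
      (Module.finrank ℂ V : ℚ), by push_cast; rfl⟩

/-- There exist `m, n ≥ 1` such that the set of synchronous quantum correlations
`C_q^s(m, 2^n)` is not closed. -/
theorem exists_syncQCorr_not_closed :
    ∃ m n : ℕ, 1 ≤ m ∧ 1 ≤ n ∧
      ¬ IsClosed {p ∈ QCorr (Fin m) (Fin (2 ^ n)) | Synchronous p} := by
  refine ⟨5, 1, by norm_num, le_rfl, ?_⟩
  change ¬ IsClosed {p ∈ QCorr (Fin 5) (Fin 2) | Synchronous p}
  intro hcl
  have hirr : Irrational (√2 / 2) := by
    exact_mod_cast irrational_sqrt_two.div_natCast (m := 2) (by norm_num)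
  set α : ℝ := √2 / 2 with hα
  have hα0 : 0 ≤ α := by positivity
  have hα1 : α ≤ 1 := by
    have : √2 ≤ 2 := by rw [Real.sqrt_le_left (by norm_num)]; norm_num
    linarith
  let s : ℕ → ℝ := fun k => ((⌊α * ((k + 1 : ℕ) : ℝ)⌋₊ : ℕ) : ℝ) / ((k + 1 : ℕ) : ℝ)
  have hs : Filter.Tendsto s Filter.atTop (nhds α) := by
    have := (tendsto_nat_floor_mul_div_atTop hα0).comp
      (tendsto_natCast_atTop_atTop.comp (Filter.tendsto_add_atTop_nat 1))
    exact this
  have hex : ∀ k : ℕ, ∃ p ∈ QCorr (Fin 5) (Fin 2), Synchronous p ∧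
      ∑ x, ∑ y, p x y 0 0 = (2 + s k / 2) ^ 2 ∧ ∑ x, p x x 0 0 = 2 + s k / 2 := by
    intro k
    have hle : ⌊α * ((k + 1 : ℕ) : ℝ)⌋₊ ≤ k + 1 := by
      apply Nat.floor_le_of_le
      exact mul_le_of_le_one_left (by positivity) hα1
    obtain ⟨P, hP, hPs⟩ := five_proj (k + 1) _ hle
    exact exists_corr _ P hP hPs
  choose p hpq hps hp2 hp1 using hex
  let K : Set (Fin 5 → Fin 5 → Fin 2 → Fin 2 → ℝ) :=
    Set.pi Set.univ fun _ => Set.pi Set.univ fun _ => Set.pi Set.univ fun _ =>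
      Set.pi Set.univ fun _ => Set.Icc (0 : ℝ) 1
  have hK : IsCompact K :=
    isCompact_univ_pi fun _ => isCompact_univ_pi fun _ => isCompact_univ_pi fun _ =>
      isCompact_univ_pi fun _ => isCompact_Icc
  have hpK : ∀ k, p k ∈ K := fun k x _ y _ a _ b _ => qcorr_bounds (hpq k) x y a b
  obtain ⟨q, -, φ, hφ, hlim⟩ := hK.tendsto_subseq hpK
  have hq := hcl.mem_of_tendsto hlim (Filter.Eventually.of_forall fun k => ⟨hpq _, hps _⟩)
  have hsφ : Filter.Tendsto (fun k => s (φ k)) Filter.atTop (nhds α) :=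
    hs.comp hφ.tendsto_atTop
  have hcoord : ∀ x y, Filter.Tendsto (fun k => p (φ k) x y 0 0) Filter.atTop
      (nhds (q x y 0 0)) := by
    intro x y
    have hc : Continuous fun r : Fin 5 → Fin 5 → Fin 2 → Fin 2 → ℝ => r x y 0 0 := by fun_prop
    exact (hc.tendsto q).comp hlim
  have hl : Filter.Tendsto (fun k => 2 + s (φ k) / 2) Filter.atTop (nhds (2 + α / 2)) :=
    tendsto_const_nhds.add (hsφ.div_const 2)
  have e2 : ∑ x, ∑ y, q x y 0 0 = (2 + α / 2) ^ 2 := by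
    refine tendsto_nhds_unique (tendsto_finsetSum _ fun x _ => tendsto_finsetSum _
      fun y _ => hcoord x y) ?_
    simp only [hp2]
    exact hl.pow 2
  have e1 : ∑ x, q x x 0 0 = 2 + α / 2 := by
    refine tendsto_nhds_unique (tendsto_finsetSum _ fun x _ => hcoord x x) ?_
    simp only [hp1]
    exact hl
  refine rational_of_corr _ q hq.1 hq.2 e2 e1 ?_
  have h := (hirr.div_natCast (m := 2) (by norm_num)).natCast_add 2
  exact_mod_cast h
end
end

section
/- There exist integers n, m ≥ 1 and a synchronous game with n inputs and m outputs which has a perfect qa-strategy but no perfect q-strategy; that is, there is a correlation in C_qa(n,m) vanishing on all losing tuples of the game, but no correlation in C_q(n,m) vanishing on all losing tuples. -/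
open Matrix

noncomputable section

/-! ### The game -/

/-- The binary variables of the constraint system. -/
inductive GVar
  | u | s | y | S | uy | Ss | uS | ys | yy
  | a | d | x | ax | Sd | aS | xd | zz
  | V0 | V1 | v | D | E | Eh | W0 | W1 | W2 | W3
  deriving DecidableEq

instance : Fintype GVar :=
  ⟨{.u, .s, .y, .S, .uy, .Ss, .uS, .ys, .yy, .a, .d, .x, .ax, .Sd, .aS, .xd, .zz,
    .V0, .V1, .v, .D, .E, .Eh, .W0, .W1, .W2, .W3}, by intro i; cases i <;> decide⟩

/-- The kinds of constraints. -/
inductive GKind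
  | prodp | prodm | selp | selm | free
  deriving DecidableEq

/-- The proper contexts. -/
def gctx : Fin 28 → GKind × GVar × GVar × GVar :=
  ![(.prodp, .u, .y, .uy), (.prodp, .S, .s, .Ss), (.prodp, .uS, .ys, .yy),
    (.prodp, .u, .S, .uS), (.prodp, .y, .s, .ys), (.prodm, .uy, .Ss, .yy),
    (.prodp, .a, .x, .ax), (.prodp, .S, .d, .Sd), (.prodp, .aS, .xd, .zz),
    (.prodp, .a, .S, .aS), (.prodp, .x, .d, .xd), (.prodm, .ax, .Sd, .zz),
    (.selp, .s, .V0, .W0), (.selm, .s, .V1, .W1),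
    (.selp, .S, .v, .W2), (.selm, .S, .V1, .W3),
    (.selp, .S, .u, .D), (.selm, .S, .V0, .D),
    (.free, .V0, .u, .u), (.free, .V1, .u, .u), (.free, .V0, .y, .y), (.free, .V1, .y, .y),
    (.free, .x, .D, .D), (.free, .x, .Eh, .Eh),
    (.selp, .s, .v, .W0), (.selm, .s, .v, .W1), (.selp, .S, .E, .W2), (.selm, .S, .E, .W3)]

/-- Questions: single variables and contexts. -/
abbrev GQ := GVar ⊕ Fin 28

/-- Answers: three bits. -/
abbrev GA := Bool × Bool × Bool

def gdata : GQ → GKind × GVar × GVar × GVar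
  | .inl i => (.free, i, i, i)
  | .inr c => gctx c

def gslot (c : GQ) : Fin 3 → GVar := ![(gdata c).2.1, (gdata c).2.2.1, (gdata c).2.2.2]

def gbit (a : GA) : Fin 3 → Bool := ![a.1, a.2.1, a.2.2]

def gok : GKind → GA → Prop
  | .prodp, a => xor (xor a.1 a.2.1) a.2.2 = false
  | .prodm, a => xor (xor a.1 a.2.1) a.2.2 = true
  | .selp, a => a.1 = false → a.2.2 = a.2.1
  | .selm, a => a.1 = true → a.2.2 = a.2.1
  | .free, _ => True

def glose (c c' : GQ) (a b : GA) : Prop :=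
  (c = c' ∧ (a ≠ b ∨ ¬ gok (gdata c).1 a)) ∨
  (∃ k l, gslot c k = gslot c' l ∧ gbit a k ≠ gbit b l) ∨
  (c = .inl .E ∧ c' = .inl .Eh ∧ a.1 ≠ b.1)

/-- The operator relations for a context of a given kind. -/
def GRel {R : Type*} [Ring R] (k : GKind) (A B C : R) : Prop :=
  A * B = B * A ∧ A * C = C * A ∧ B * C = C * B ∧
  match k with
  | .prodp => A * B * C = 1
  | .prodm => A * B * C = -1
  | .selp => C + A * C = B + A * B
  | .selm => C - A * C = B - A * B
  | .free => True

/-! ### No finite-dimensional representation -/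

lemma magic_square {R : Type*} [Ring R] {u s y S uy Ss uS ys yy : R}
    (hu : u * u = 1) (hs : s * s = 1)
    (hy : y * y = 1) (hS : S * S = 1)
    (huy : uy * uy = 1) (hSs : Ss * Ss = 1) (huS : uS * uS = 1) (hys : ys * ys = 1)
    (hyy : yy * yy = 1)
    (h1 : GRel .prodp u y uy) (h2 : GRel .prodp S s Ss) (h3 : GRel .prodp uS ys yy)
    (h4 : GRel .prodp u S uS) (h5 : GRel .prodp y s ys) (h6 : GRel .prodm uy Ss yy) :
    y * S = - (S * y) ∧ u * s = -(s * u) := by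
  have key : ∀ {A B C : R}, C * C = 1 → A * B * C = 1 → A * B = C := by
    intro A B C hC h
    calc A * B = A * B * C * C := by rw [mul_assoc, hC, mul_one]
      _ = C := by rw [h, one_mul]
  obtain ⟨c1, -, -, h1⟩ := h1
  obtain ⟨c2, -, -, h2⟩ := h2
  obtain ⟨c3, -, -, h3⟩ := h3
  obtain ⟨c4, -, -, h4⟩ := h4
  obtain ⟨c5, -, -, h5⟩ := h5
  obtain ⟨c6, -, -, h6⟩ := h6
  simp only at h1 h2 h3 h4 h5 h6
  have k1 := key huy h1
  have k2 := key hSs h2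
  have k3 := key hyy h3
  have k4 := key huS h4
  have k5 := key hys h5
  have k6 : uy * Ss = - yy := by
    calc uy * Ss = uy * Ss * yy * yy := by rw [mul_assoc _ yy, hyy, mul_one]
      _ = -yy := by rw [h6, neg_one_mul]
  have e1 : (u * y) * (S * s) = -((u * S) * (y * s)) := by
    rw [k1, k2, k4, k5, k6, k3]
  have e2 : (y * u) * (s * S) = -((y * s) * (u * S)) := by
    rw [← c1, ← c2, k1, k2, k4, k5, k6, ← c3, k3]
  have canc : ∀ {p q A B : R}, p * p = 1 → q * q = 1 → p * A * q = p * B * q → A = B := by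
    intro p q A B hp hq h
    have : p * (p * A * q) * q = p * (p * B * q) * q := by rw [h]
    simpa only [← mul_assoc, hp, one_mul, mul_assoc _ q q, hq, mul_one] using this
  refine ⟨canc hu hs ?_, canc hy hS ?_⟩
  · simpa only [mul_assoc, mul_neg, neg_mul] using e1
  · simpa only [mul_assoc, mul_neg, neg_mul] using e2

lemma no_sqrt_closed (T : Set ℂ) (hfin : T.Finite) (hne : T.Nonempty) (h0 : (0 : ℂ) ∉ T)
    (hneg : ∀ z ∈ T, -z ∈ T) (hsq : ∀ z ∈ T, ∃ r ∈ T, r * r = z) : False := by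
  choose! f hf hff using hsq
  have hinj : Set.InjOn f T := by
    intro z hz w hw h
    rw [← hff z hz, ← hff w hw, h]
  have hsurj : f '' T = T := Set.eq_of_subset_of_ncard_le (Set.image_subset_iff.mpr hf)
    (Set.InjOn.ncard_image hinj).ge hfin
  obtain ⟨z, hz⟩ := hne
  obtain ⟨w, hw, hwz⟩ := hsurj.ge (hneg _ (hf z hz))
  have h1 := hff w hw
  rw [hwz, neg_mul_neg, hff z hz] at h1
  subst h1
  have : f z = 0 := self_eq_neg.mp hwz
  have h2 := hf z hz
  rw [this] at h2
  exact h0 h2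

/-- Positive selection, without commutation of the selected operators. -/
def SelP {R : Type*} [Ring R] (A B C : R) : Prop :=
  A * B = B * A ∧ A * C = C * A ∧ True ∧ C + A * C = B + A * B

/-- Negative selection, without commutation of the selected operators. -/
def SelM {R : Type*} [Ring R] (A B C : R) : Prop :=
  A * B = B * A ∧ A * C = C * A ∧ True ∧ C - A * C = B - A * B

lemma selP_of {R : Type*} [Ring R] {A B C W : R} (h : GRel .selp A B W) (h' : GRel .selp A C W) :
    SelP A B C := ⟨h.1, h'.1, trivial, h'.2.2.2.symm.trans h.2.2.2⟩

lemma selM_of {R : Type*} [Ring R] {A B C W : R} (h : GRel .selm A B W) (h' : GRel .selm A C W) :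
    SelM A B C := ⟨h.1, h'.1, trivial, h'.2.2.2.symm.trans h.2.2.2⟩

theorem no_rep {V : Type*} [AddCommGroup V] [Module ℂ V] [FiniteDimensional ℂ V] [Nontrivial V]
    (X : GVar → Module.End ℂ V) (hX : ∀ i, X i * X i = 1)
    (hrel : ∀ c, GRel (gctx c).1 (X (gctx c).2.1) (X (gctx c).2.2.1) (X (gctx c).2.2.2))
    (hE : X .E = X .Eh) : False := by
  obtain ⟨yS, us⟩ := magic_square (hX .u) (hX .s) (hX .y) (hX .S) (hX .uy) (hX .Ss) (hX .uS)
    (hX .ys) (hX .yy) (hrel 0) (hrel 1) (hrel 2) (hrel 3) (hrel 4) (hrel 5)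
  obtain ⟨xS, -⟩ := magic_square (hX .a) (hX .d) (hX .x) (hX .S) (hX .ax) (hX .Sd) (hX .aS)
    (hX .xd) (hX .zz) (hrel 6) (hrel 7) (hrel 8) (hrel 9) (hrel 10) (hrel 11)
  have r12 : SelP (X .s) (X .V0) (X .v) := selP_of (hrel 12) (hrel 24)
  have r13 : SelM (X .s) (X .V1) (X .v) := selM_of (hrel 13) (hrel 25)
  have r14 : SelP (X .S) (X .v) (X .E) := selP_of (hrel 14) (hrel 26)
  have r15 : SelM (X .S) (X .V1) (X .E) := selM_of (hrel 15) (hrel 27)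
  have r16 : SelP (X .S) (X .u) (X .D) := ⟨(hrel 16).1, (hrel 16).2.1, trivial, (hrel 16).2.2.2⟩
  have r17 : SelM (X .S) (X .V0) (X .D) := ⟨(hrel 17).1, (hrel 17).2.1, trivial, (hrel 17).2.2.2⟩
  have V0u : X .V0 * X .u = X .u * X .V0 := (hrel 18).1
  have V1u : X .V1 * X .u = X .u * X .V1 := (hrel 19).1
  have V0y : X .V0 * X .y = X .y * X .V0 := (hrel 20).1
  have V1y : X .V1 * X .y = X .y * X .V1 := (hrel 21).1
  have xD : X .x * X .D = X .D * X .x := (hrel 22).1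
  have xE : X .x * X .E = X .E * X .x := by rw [hE]; exact (hrel 23).1
  have uy : X .u * X .y = X .y * X .u := (hrel 0).1
  have ys : X .y * X .s = X .s * X .y := (hrel 4).1
  have pos : ∀ {A B C : Module.End ℂ V} {ξ : V}, SelP A B C → A ξ = ξ → C ξ = B ξ := by
    intro A B C ξ h hξ
    obtain ⟨ab, ac, -, h⟩ := h
    have h1 := LinearMap.congr_fun (ac ▸ ab ▸ h) ξ
    simp only [LinearMap.add_apply, Module.End.mul_apply, hξ] at h1
    rw [← two_smul ℂ, ← two_smul ℂ] at h1
    exact smul_right_injective V (two_ne_zero (α := ℂ)) h1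
  have neg : ∀ {A B C : Module.End ℂ V} {ξ : V}, SelM A B C → A ξ = -ξ → C ξ = B ξ := by
    intro A B C ξ h hξ
    obtain ⟨ab, ac, -, h⟩ := h
    have h1 := LinearMap.congr_fun (ac ▸ ab ▸ h) ξ
    simp only [LinearMap.sub_apply, Module.End.mul_apply, hξ, map_neg, sub_neg_eq_add] at h1
    rw [← two_smul ℂ, ← two_smul ℂ] at h1
    exact smul_right_injective V (two_ne_zero (α := ℂ)) h1
  have app : ∀ {A B : Module.End ℂ V}, A * B = B * A → ∀ ξ, A (B ξ) = B (A ξ) :=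
    fun h ξ => LinearMap.congr_fun h ξ
  have appn : ∀ {A B : Module.End ℂ V}, A * B = -(B * A) → ∀ ξ, A (B ξ) = -B (A ξ) :=
    fun h ξ => LinearMap.congr_fun h ξ
  have inv : ∀ i ξ, X i (X i ξ) = ξ := fun i ξ => LinearMap.congr_fun (hX i) ξ
  have nz : ∀ i {ξ : V}, ξ ≠ 0 → X i ξ ≠ 0 := by
    intro i ξ h h'
    apply h
    rw [← inv i ξ, h', map_zero]
  -- `y` commutes with `v`
  have vy : X .v * X .y = X .y * X .v := by
    have h1 : X .v + X .s * X .v = X .V0 + X .s * X .V0 := r12.2.2.2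
    have h2 : X .v - X .s * X .v = X .V1 - X .s * X .V1 := r13.2.2.2
    have h3 : (2 : ℂ) • X .v = X .V0 + X .s * X .V0 + (X .V1 - X .s * X .V1) := by
      rw [← h1, ← h2, two_smul]; abel
    have h4 : (2 : ℂ) • (X .v * X .y) = (2 : ℂ) • (X .y * X .v) := by
      rw [← smul_mul_assoc, ← mul_smul_comm, h3]
      have q0 : X .s * X .V0 * X .y = X .y * (X .s * X .V0) := by
        rw [mul_assoc, V0y, ← mul_assoc, ← ys, mul_assoc]
      have q1 : X .s * X .V1 * X .y = X .y * (X .s * X .V1) := by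
        rw [mul_assoc, V1y, ← mul_assoc, ← ys, mul_assoc]
      rw [add_mul, add_mul, sub_mul, q0, q1, V0y, V1y]
      noncomm_ring
    exact smul_right_injective _ (two_ne_zero (α := ℂ)) h4
  let T : Set ℂ := {z | ∃ ξ : V, ξ ≠ 0 ∧ X .u (X .v ξ) = z • ξ}
  have hT : T = {z | Module.End.HasEigenvalue (X .u * X .v) z} := by
    ext z
    constructor
    · rintro ⟨ξ, h0, h⟩
      exact Module.End.hasEigenvalue_of_hasEigenvector
        (x := ξ) ⟨Module.End.mem_eigenspace_iff.mpr h, h0⟩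
    · intro h
      obtain ⟨ξ, h⟩ := h.exists_hasEigenvector
      exact ⟨ξ, h.2, Module.End.mem_eigenspace_iff.mp h.1⟩
  have hneg : ∀ z ∈ T, -z ∈ T := by
    rintro z ⟨ξ, h0, h⟩
    refine ⟨X .s ξ, nz _ h0, ?_⟩
    rw [← app r12.2.1, appn us, h, map_smul, neg_smul]
  refine no_sqrt_closed T ?_ ?_ ?_ hneg ?_
  · rw [hT]; exact Module.End.finite_hasEigenvalue _
  · rw [hT]; exact Module.End.exists_eigenvalue _
  · rintro ⟨ξ, h0, h⟩
    rw [zero_smul] at h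
    exact nz _ (nz _ h0) h
  · rintro z ⟨ξ, h0, h⟩
    -- move to the positive part of `S`
    obtain ⟨ξ', h0', h', hS'⟩ : ∃ ξ' : V, ξ' ≠ 0 ∧ X .u (X .v ξ') = z • ξ' ∧ X .S ξ' = ξ' := by
      by_cases hp : ξ + X .S ξ = 0
      · have hp' : X .S ξ = - ξ := by rw [eq_neg_iff_add_eq_zero, add_comm]; exact hp
        refine ⟨X .y ξ, nz _ h0, ?_, ?_⟩
        · rw [app vy, app uy, h, map_smul]
        · have := appn yS ξ
          rw [hp', map_neg, neg_inj] at this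
          exact this.symm
      · refine ⟨ξ + X .S ξ, hp, ?_, ?_⟩
        · rw [map_add, map_add, ← app r14.1, ← app r16.1, h, map_smul, smul_add]
        · rw [map_add, inv, add_comm]
    -- move by `x`
    have e1 : X .E ξ' = X .v ξ' := pos r14 hS'
    have hS'' : X .S (X .v ξ') = X .v ξ' := by rw [app r14.1, hS']
    have e2 : X .D (X .v ξ') = z • ξ' := by rw [pos r16 hS'', h']
    obtain ⟨η, hη0, hη⟩ : ∃ η : V, η ≠ 0 ∧ X .V0 (X .V1 η) = z • η := by
      refine ⟨X .x ξ', nz _ h0', ?_⟩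
      have hSx : X .S (X .x ξ') = - X .x ξ' := by
        have := appn xS ξ'
        rw [hS'] at this
        exact (neg_eq_iff_eq_neg.mpr this).symm
      have hSx' : X .S (X .V1 (X .x ξ')) = - X .V1 (X .x ξ') := by
        rw [app r15.1, hSx, map_neg]
      rw [← neg r17 hSx', ← neg r15 hSx, ← app xE, ← app xD, e1, e2, map_smul]
    -- move to the negative part of `s`
    obtain ⟨ζ, hζ0, hζ, hsζ⟩ : ∃ ζ : V, ζ ≠ 0 ∧ X .V0 (X .V1 ζ) = z • ζ ∧ X .s ζ = -ζ := by
      by_cases hp : η - X .s η = 0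
      · have hp' : X .s η = η := (sub_eq_zero.mp hp).symm
        refine ⟨X .u η, nz _ hη0, ?_, ?_⟩
        · rw [app V1u, app V0u, hη, map_smul]
        · have := appn us η
          rw [hp'] at this
          exact (neg_eq_iff_eq_neg.mpr this).symm
      · refine ⟨η - X .s η, hp, ?_, ?_⟩
        · rw [map_sub, map_sub, ← app r13.1, ← app r12.1, hη, map_smul, smul_sub]
        · rw [map_sub, inv, neg_sub]
    have f1 : X .v ζ = X .V1 ζ := neg r13 hsζ
    have f2 : X .s (X .u (X .V1 ζ)) = X .u (X .V1 ζ) := by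
      have := appn us (X .V1 ζ)
      rw [app r13.1, hsζ, map_neg, map_neg, neg_inj] at this
      exact this.symm
    have f3 : X .u (X .v (X .u (X .v ζ))) = z • ζ := by
      rw [f1, pos r12 f2, app V0u, inv, hζ]
    obtain ⟨r, hr⟩ := IsAlgClosed.exists_pow_nat_eq z (n := 2) (by norm_num)
    have hr' : r * r = z := by rw [← hr, sq]
    by_cases hp : X .u (X .v ζ) + r • ζ = 0
    · refine ⟨-r, ⟨ζ, hζ0, ?_⟩, by rw [neg_mul_neg, hr']⟩
      rw [neg_smul]; exact eq_neg_of_add_eq_zero_left hp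
    · refine ⟨r, ⟨_, hp, ?_⟩, hr'⟩
      simp only [map_add, map_smul, f3, smul_add, smul_smul, hr']
      rw [add_comm]

/-! ### From a perfect q-strategy to a representation -/

open scoped ComplexOrder in
theorem rep_of_strategy {I O : Type} [Fintype I] [Fintype O] (lose : I → I → O → O → Prop)
    (hsync : ∀ x a b, a ≠ b → lose x x a b) (p : I → I → O → O → ℝ) (hp : p ∈ QCorr I O)
    (hperf : ∀ x y a b, lose x y a b → p x y a b = 0) :
    ∃ (n : ℕ) (V : Submodule ℂ (Fin n → ℂ)) (e : I → O → Module.End ℂ V),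
      Nontrivial V ∧ (∀ x, ∑ a, e x a = 1) ∧
      (∀ x y a b, lose x y a b → e x a * e y b = 0) := by
  classical
  obtain ⟨dA, dB, -, -, E, F, ψ, hE, hE1, hF, hF1, hψ, hpp⟩ := hp
  let K : Matrix (Fin dA) (Fin dB) ℂ := Matrix.of fun i j => ψ (i, j)
  have hK : ∀ (A : Matrix (Fin dA) (Fin dA) ℂ) (B : Matrix (Fin dB) (Fin dB) ℂ) i j,
      (Matrix.kroneckerMap (· * ·) A B).mulVec ψ (i, j) = (A * K * Bᵀ) i j := by
    intro A B i j
    simp only [Matrix.mulVec, dotProduct, Matrix.kroneckerMap_apply, Fintype.sum_prod_type,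
      Matrix.mul_apply, Matrix.transpose_apply, K, Matrix.of_apply, Finset.sum_mul]
    rw [Finset.sum_comm]
    refine Finset.sum_congr rfl fun k _ => Finset.sum_congr rfl fun l _ => ?_
    ring
  have h0 : ∀ x y a b, lose x y a b → E x a * K * (F y b)ᵀ = 0 := by
    intro x y a b h
    have h1 := hpp x y a b
    rw [hperf x y a b h] at h1
    set P := Matrix.kroneckerMap (· * ·) (E x a) (F y b) with hP
    have hP1 : Pᴴ = P := by
      have := Matrix.conjTranspose_kronecker (E x a) (F y b)
      rw [(hE x a).1, (hF y b).1] at this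
      exact this
    have hP2 : P * P = P := by
      have := Matrix.mul_kronecker_mul (E x a) (E x a) (F y b) (F y b)
      rw [(hE x a).2, (hF y b).2] at this
      exact this.symm
    have h2 : star (P.mulVec ψ) ⬝ᵥ (P.mulVec ψ) = 0 := by
      rw [Matrix.star_mulVec, hP1, ← Matrix.dotProduct_mulVec, Matrix.mulVec_mulVec, hP2, ← h1]
      simp
    have h3 : P.mulVec ψ = 0 := dotProduct_star_self_eq_zero.mp h2
    ext i j
    rw [← hK, ← hP, h3]
    rfl
  have hEK : ∀ x a, E x a * K = K * (F x a)ᵀ := by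
    intro x a
    have e1 : E x a * K = E x a * K * (F x a)ᵀ := by
      have : E x a * K * (∑ b, F x b)ᵀ = E x a * K * (F x a)ᵀ := by
        rw [Matrix.transpose_sum, Matrix.mul_sum]
        refine Finset.sum_eq_single a (fun b _ hb => h0 _ _ _ _ (hsync x a b hb.symm)) ?_
        simp
      rw [hF1, Matrix.transpose_one, Matrix.mul_one] at this
      exact this
    have e2 : K * (F x a)ᵀ = E x a * K * (F x a)ᵀ := by
      have : (∑ b, E x b) * K * (F x a)ᵀ = E x a * K * (F x a)ᵀ := by
        rw [Matrix.sum_mul, Matrix.sum_mul]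
        refine Finset.sum_eq_single a (fun b _ hb => h0 _ _ _ _ (hsync x b a hb)) ?_
        simp
      rw [hE1, Matrix.one_mul] at this
      exact this
    rw [e1, ← e2]
  have hEEK : ∀ x y a b, lose x y a b → E x a * E y b * K = 0 := by
    intro x y a b h
    rw [Matrix.mul_assoc, hEK, ← Matrix.mul_assoc, h0 x y a b h]
  let V : Submodule ℂ (Fin dA → ℂ) := LinearMap.range K.mulVecLin
  have hV : ∀ x a, ∀ w ∈ V, (E x a).mulVecLin w ∈ V := by
    rintro x a _ ⟨w, rfl⟩
    refine ⟨(F x a)ᵀ.mulVec w, ?_⟩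
    simp only [Matrix.mulVecLin_apply, Matrix.mulVec_mulVec, hEK]
  refine ⟨dA, V, fun x a => (E x a).mulVecLin.restrict (hV x a), ?_, ?_, ?_⟩
  · by_contra hn
    rw [not_nontrivial_iff_subsingleton, Submodule.subsingleton_iff_eq_bot] at hn
    have hz : ∀ w, K.mulVec w = 0 := by
      intro w
      have : K.mulVecLin w ∈ V := ⟨w, rfl⟩
      rw [hn] at this
      exact (Submodule.mem_bot ℂ).mp this
    have hψ0 : ψ = 0 := by
      ext ⟨i, j⟩
      have := congrFun (hz (Pi.single j 1)) i
      simpa [K] using this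
    rw [hψ0] at hψ
    simp at hψ
  · intro x
    ext ⟨w, hw⟩ i
    have : (∑ a, (E x a).mulVec w) = w := by
      rw [← Matrix.sum_mulVec, hE1, Matrix.one_mulVec]
    have h2 := congrFun this i
    simp only [LinearMap.sum_apply, Submodule.coe_sum, Finset.sum_apply] at h2 ⊢
    exact h2
  · intro x y a b h
    ext ⟨w, hw⟩ i
    obtain ⟨w, rfl⟩ := hw
    have : (E x a).mulVec ((E y b).mulVec (K.mulVec w)) = 0 := by
      rw [Matrix.mulVec_mulVec, Matrix.mulVec_mulVec, hEEK x y a b h, Matrix.zero_mulVec]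
    exact congrFun this i

/-- Sign of a bit. -/
def bsg (b : Bool) : ℂ := if b then -1 else 1

theorem no_alg_rep {V : Type*} [AddCommGroup V] [Module ℂ V] [FiniteDimensional ℂ V]
    [Nontrivial V] (e : GQ → GA → Module.End ℂ V) (he1 : ∀ x, ∑ a, e x a = 1)
    (he : ∀ x y a b, glose x y a b → e x a * e y b = 0) : False := by
  have hidem : ∀ c a, e c a * e c a = e c a := by
    intro c a
    have : e c a * ∑ b, e c b = e c a * e c a := by
      rw [Finset.mul_sum]
      refine Finset.sum_eq_single a (fun b _ hb => he _ _ _ _ (Or.inl ⟨rfl, Or.inl hb.symm⟩)) ?_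
      simp
    rw [he1, mul_one] at this
    exact this.symm
  let Fc : GQ → (GA → ℂ) → Module.End ℂ V := fun c f => ∑ b, f b • e c b
  have Fmul : ∀ c f g, Fc c f * Fc c g = Fc c (fun b => f b * g b) := by
    intro c f g
    simp only [Fc]
    rw [Finset.sum_mul]
    refine Finset.sum_congr rfl fun a _ => ?_
    rw [Finset.mul_sum, Finset.sum_eq_single a]
    · rw [smul_mul_smul_comm, hidem]
    · intro b _ hb
      rw [smul_mul_smul_comm, he _ _ _ _ (Or.inl ⟨rfl, Or.inl hb.symm⟩), smul_zero]
    · simp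
  have Fadd : ∀ c f g, Fc c f + Fc c g = Fc c (fun b => f b + g b) := by
    intro c f g
    simp only [Fc, add_smul, Finset.sum_add_distrib]
  have Fsub : ∀ c f g, Fc c f - Fc c g = Fc c (fun b => f b - g b) := by
    intro c f g
    simp only [Fc, sub_smul, Finset.sum_sub_distrib]
  have Fcongr : ∀ c f g, (∀ b, gok (gdata c).1 b → f b = g b) → Fc c f = Fc c g := by
    intro c f g h
    refine Finset.sum_congr rfl fun b _ => ?_
    by_cases hb : gok (gdata c).1 b
    · rw [h b hb]
    · have : e c b = 0 := by
        rw [← hidem]; exact he _ _ _ _ (Or.inl ⟨rfl, Or.inr hb⟩)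
      rw [this, smul_zero, smul_zero]
  have F1 : ∀ c, Fc c (fun _ => 1) = 1 := by
    intro c; simp only [Fc, one_smul, he1]
  have Fm1 : ∀ c, Fc c (fun _ => -1) = -1 := by
    intro c; simp only [Fc, neg_smul, one_smul, Finset.sum_neg_distrib, he1]
  have Feq : ∀ c c' f g, (∀ a b, ¬ glose c c' a b → f a = g b) → Fc c f = Fc c' g := by
    intro c c' f g h
    calc Fc c f = (∑ a, f a • e c a) * ∑ b, e c' b := by rw [he1, mul_one]
      _ = (∑ a, e c a) * ∑ b, g b • e c' b := by
        rw [Finset.sum_mul_sum, Finset.sum_mul_sum]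
        refine Finset.sum_congr rfl fun a _ => Finset.sum_congr rfl fun b _ => ?_
        rw [smul_mul_assoc, mul_smul_comm]
        by_cases hl : glose c c' a b
        · rw [he _ _ _ _ hl, smul_zero, smul_zero]
        · rw [h a b hl]
      _ = Fc c' g := by rw [he1, one_mul]
  let X : GVar → Module.End ℂ V := fun i => Fc (.inl i) (fun a => bsg a.1)
  have hXF : ∀ c k, X (gslot c k) = Fc c (fun b => bsg (gbit b k)) := by
    intro c k
    refine Feq _ _ _ _ fun a b h => ?_
    congr 1
    by_contra hne
    exact h (Or.inr (Or.inl ⟨0, k, rfl, hne⟩))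
  have bsq : ∀ b, bsg b * bsg b = 1 := by intro b; cases b <;> simp [bsg]
  refine no_rep X ?_ ?_ ?_
  · intro i
    simp only [X, Fmul, bsq, F1]
  · intro c
    have x0 : X (gctx c).2.1 = _ := hXF (.inr c) 0
    have x1 : X (gctx c).2.2.1 = _ := hXF (.inr c) 1
    have x2 : X (gctx c).2.2.2 = _ := hXF (.inr c) 2
    rw [x0, x1, x2]
    refine ⟨?_, ?_, ?_, ?_⟩
    · simp only [Fmul, mul_comm]
    · simp only [Fmul, mul_comm]
    · simp only [Fmul, mul_comm]
    · have hk : (gdata (.inr c)).1 = (gctx c).1 := rfl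
      have fc := Fcongr (.inr c)
      rw [hk] at fc
      rw [← Fm1 (.inr c), ← F1 (.inr c)]
      cases hkk : (gctx c).1 <;> rw [hkk] at fc <;>
        simp only [Fmul, Fadd, Fsub] <;> try (apply fc)
      all_goals
        rintro ⟨b0, b1, b2⟩
        cases b0 <;> cases b1 <;> cases b2 <;> simp [gok, gbit, bsg]
  · refine Feq _ _ _ _ fun a b h => ?_
    congr 1
    by_contra hne
    exact h (Or.inr (Or.inr ⟨rfl, rfl, hne⟩))

theorem no_perfect_q (p : GQ → GQ → GA → GA → ℝ) (hp : p ∈ QCorr GQ GA)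
    (hperf : ∀ x y a b, glose x y a b → p x y a b = 0) : False := by
  obtain ⟨n, V, e, hV, he1, he⟩ := rep_of_strategy glose
    (fun x a b h => Or.inl ⟨rfl, Or.inl h⟩) p hp hperf
  exact no_alg_rep e he1 he

/-! ### Strategies from tracial models -/

lemma trace_strategy {I O B : Type} [Fintype I] [Fintype O] [Fintype B] [DecidableEq B]
    [Nonempty B] (P : I → O → Matrix B B ℂ)
    (hP : ∀ x a, (P x a).IsHermitian ∧ P x a * P x a = P x a) (hP1 : ∀ x, ∑ a, P x a = 1) :
    (fun x y a b => (Matrix.trace (P x a * P y b)).re / Fintype.card B) ∈ QCorr I O := by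
  classical
  set d := Fintype.card B with hd
  have hd0 : 0 < d := Fintype.card_pos
  let e : Fin d ≃ B := (Fintype.equivFin B).symm
  let Q : I → O → Matrix (Fin d) (Fin d) ℂ := fun x a => (P x a).submatrix e e
  have hQ : ∀ x a, (Q x a).IsHermitian ∧ Q x a * Q x a = Q x a := by
    intro x a
    refine ⟨(hP x a).1.submatrix e, ?_⟩
    simp only [Q]
    rw [Matrix.submatrix_mul_equiv, (hP x a).2]
  have hQ1 : ∀ x, ∑ a, Q x a = 1 := by
    intro x
    have : ∑ a, Q x a = (∑ a, P x a).submatrix e e := by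
      ext i j
      simp [Q, Matrix.sum_apply]
    rw [this, hP1, Matrix.submatrix_one_equiv]
  have hds : ((Real.sqrt d : ℝ) : ℂ) * (Real.sqrt d : ℝ) = d := by
    rw [← Complex.ofReal_mul, Real.mul_self_sqrt (by positivity)]; simp
  have hdc : (d : ℂ) ≠ 0 := by exact_mod_cast hd0.ne'
  let c : ℂ := ((Real.sqrt d : ℝ) : ℂ)⁻¹
  have hcc : c * c = (d : ℂ)⁻¹ := by simp only [c]; rw [← mul_inv, hds]
  have hcs : star c = c := by simp [c]
  let ψ : Fin d × Fin d → ℂ := fun ij => if ij.1 = ij.2 then c else 0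
  have hstar : ∀ ij, star ψ ij = ψ ij := by
    intro ij
    simp only [Pi.star_apply, ψ]
    split_ifs
    · exact hcs
    · simp
  refine ⟨d, d, hd0, hd0, Q, fun y b => (Q y b)ᵀ, ψ, hQ, hQ1, ?_, ?_, ?_, ?_⟩
  · intro y b
    refine ⟨(hQ y b).1.transpose, ?_⟩
    rw [← Matrix.transpose_mul, (hQ y b).2]
  · intro y
    rw [← Matrix.transpose_sum, hQ1, Matrix.transpose_one]
  · simp only [dotProduct, hstar, Fintype.sum_prod_type]
    simp [ψ, hcc, hdc]
  · intro x y a b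
    have hre : ((Matrix.trace (P x a * P y b)).re : ℂ) = Matrix.trace (P x a * P y b) := by
      rw [← Complex.conj_eq_iff_re]
      change star _ = _
      rw [← Matrix.trace_conjTranspose, Matrix.conjTranspose_mul, (hP x a).1, (hP y b).1,
        Matrix.trace_mul_comm]
    have htr : Matrix.trace (P x a * P y b) = Matrix.trace (Q x a * Q y b) := by
      simp only [Q]
      rw [Matrix.submatrix_mul_equiv]
      simp only [Matrix.trace, Matrix.diag_apply, Matrix.submatrix_apply]
      exact (Equiv.sum_comp e _).symm
    push_cast
    rw [hre, htr]
    simp only [dotProduct, hstar, Fintype.sum_prod_type, Matrix.mulVec,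
      Matrix.kroneckerMap_apply, Matrix.transpose_apply]
    simp only [ψ, ite_mul, zero_mul, mul_ite, mul_zero, Finset.sum_ite_eq, Finset.mem_univ,
      if_true, Matrix.trace, Matrix.diag_apply, Matrix.mul_apply]
    rw [div_eq_mul_inv, ← hcc, Finset.sum_mul]
    refine Finset.sum_congr rfl fun i _ => ?_
    rw [Finset.sum_mul, Finset.mul_sum]
    refine Finset.sum_congr rfl fun j _ => ?_
    ring

lemma trace_proj_nonneg {B : Type} [Fintype B] {P Q : Matrix B B ℂ}
    (hP : P.IsHermitian ∧ P * P = P) (hQ : Q.IsHermitian ∧ Q * Q = Q) :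
    0 ≤ (Matrix.trace (P * Q)).re := by
  have h : Matrix.trace (P * Q) = Matrix.trace ((Q * P)ᴴ * (Q * P)) := by
    rw [Matrix.conjTranspose_mul, hP.1, hQ.1]
    calc Matrix.trace (P * Q) = Matrix.trace (P * P * (Q * Q)) := by rw [hP.2, hQ.2]
      _ = Matrix.trace (P * (P * Q * Q)) := by simp only [Matrix.mul_assoc]
      _ = Matrix.trace (P * Q * Q * P) := by rw [Matrix.trace_mul_comm]
      _ = _ := by simp only [Matrix.mul_assoc]
  rw [h]
  simp only [Matrix.trace, Matrix.diag_apply, Matrix.mul_apply, Matrix.conjTranspose_apply,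
    Complex.re_sum]
  refine Finset.sum_nonneg fun i _ => Finset.sum_nonneg fun j _ => ?_
  simp only [RCLike.star_def, ← Complex.normSq_eq_conj_mul_self, Complex.ofReal_re]
  exact Complex.normSq_nonneg _

/-- Spectral projection of an involution. -/
def bpr {B : Type} [DecidableEq B] (X : Matrix B B ℂ) (b : Bool) : Matrix B B ℂ :=
  (2⁻¹ : ℂ) • (1 + bsg b • X)

section bpr
variable {B : Type} [DecidableEq B] [Fintype B] {X Y : Matrix B B ℂ}

lemma bpr_herm (hX : X.IsHermitian) (b : Bool) : (bpr X b).IsHermitian := by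
  unfold Matrix.IsHermitian bpr
  rw [Matrix.conjTranspose_smul, Matrix.conjTranspose_add, Matrix.conjTranspose_smul, hX]
  cases b <;> simp [bsg]

lemma bpr_mul_self (hX : X * X = 1) (b : Bool) : bpr X b * bpr X b = bpr X b := by
  unfold bpr
  cases b <;> simp [bsg, mul_add, add_mul, hX] <;> module

lemma bpr_mul_ne (hX : X * X = 1) {b c : Bool} (h : b ≠ c) : bpr X b * bpr X c = 0 := by
  unfold bpr
  cases b <;> cases c <;> simp [bsg, mul_add, add_mul, hX] at h ⊢ <;> abel

lemma bpr_sum (X : Matrix B B ℂ) : bpr X true + bpr X false = 1 := by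
  unfold bpr
  simp [bsg]
  module

lemma bpr_comm (h : X * Y = Y * X) (b c : Bool) : bpr X b * bpr Y c = bpr Y c * bpr X b := by
  unfold bpr
  simp only [mul_add, add_mul, smul_mul_assoc, mul_smul_comm, h, one_mul, mul_one]
  module

lemma mul_bpr (hX : X * X = 1) (b : Bool) : X * bpr X b = bsg b • bpr X b := by
  unfold bpr
  cases b <;> simp [bsg, mul_add, hX]
  · module
  · module

end bpr

/-- Product of three spectral projections. -/
def tpr {B : Type} [DecidableEq B] [Fintype B] (X Y Z : Matrix B B ℂ) (a : GA) : Matrix B B ℂ :=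
  bpr X a.1 * bpr Y a.2.1 * bpr Z a.2.2

section tpr
variable {B : Type} [DecidableEq B] [Fintype B] {X Y Z : Matrix B B ℂ}

lemma tpr_herm (hX : X.IsHermitian) (hY : Y.IsHermitian) (hZ : Z.IsHermitian)
    (xy : X * Y = Y * X) (xz : X * Z = Z * X) (yz : Y * Z = Z * Y) (a : GA) :
    (tpr X Y Z a).IsHermitian := by
  unfold Matrix.IsHermitian tpr
  rw [Matrix.conjTranspose_mul, Matrix.conjTranspose_mul, bpr_herm hX, bpr_herm hY, bpr_herm hZ,
    bpr_comm xy.symm, ← Matrix.mul_assoc, bpr_comm xz.symm, Matrix.mul_assoc, bpr_comm yz.symm,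
    ← Matrix.mul_assoc]

lemma tpr_left (hX : X * X = 1) (hY : Y * Y = 1) (hZ : Z * Z = 1)
    (xy : X * Y = Y * X) (xz : X * Z = Z * X) (yz : Y * Z = Z * Y) (a : GA) :
    bpr X a.1 * tpr X Y Z a = tpr X Y Z a ∧ bpr Y a.2.1 * tpr X Y Z a = tpr X Y Z a ∧
      bpr Z a.2.2 * tpr X Y Z a = tpr X Y Z a := by
  unfold tpr
  refine ⟨?_, ?_, ?_⟩
  · rw [← Matrix.mul_assoc, ← Matrix.mul_assoc, bpr_mul_self hX]
  · rw [bpr_comm xy, ← Matrix.mul_assoc, ← Matrix.mul_assoc, bpr_mul_self hY]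
  · have e1 := bpr_comm xz a.1 a.2.2
    have e2 := bpr_comm yz a.2.1 a.2.2
    have e3 := bpr_mul_self hZ a.2.2
    generalize bpr X a.1 = P at *
    generalize bpr Y a.2.1 = Q at *
    generalize bpr Z a.2.2 = R at *
    calc R * (P * Q * R) = R * P * (Q * R) := by simp only [Matrix.mul_assoc]
      _ = P * R * (R * Q) := by rw [← e1, e2]
      _ = P * (R * R * Q) := by simp only [Matrix.mul_assoc]
      _ = P * Q * R := by rw [e3, ← e2, Matrix.mul_assoc]

lemma tpr_right (hX : X * X = 1) (hY : Y * Y = 1) (hZ : Z * Z = 1)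
    (xy : X * Y = Y * X) (xz : X * Z = Z * X) (yz : Y * Z = Z * Y) (a : GA) :
    tpr X Y Z a * bpr X a.1 = tpr X Y Z a ∧ tpr X Y Z a * bpr Y a.2.1 = tpr X Y Z a ∧
      tpr X Y Z a * bpr Z a.2.2 = tpr X Y Z a := by
  unfold tpr
  refine ⟨?_, ?_, ?_⟩
  · rw [bpr_comm xy, Matrix.mul_assoc, Matrix.mul_assoc, bpr_comm xz.symm,
      ← Matrix.mul_assoc (bpr X _), bpr_mul_self hX, Matrix.mul_assoc]
  · rw [Matrix.mul_assoc, bpr_comm yz.symm, ← Matrix.mul_assoc, Matrix.mul_assoc (bpr X _),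
      bpr_mul_self hY]
  · rw [Matrix.mul_assoc, bpr_mul_self hZ]

lemma tpr_sum (X Y Z : Matrix B B ℂ) : ∑ a, tpr X Y Z a = 1 := by
  simp only [tpr, Fintype.sum_prod_type, ← Finset.mul_sum, Fintype.sum_bool, bpr_sum,
    mul_one]

lemma tpr_idem (hX : X * X = 1) (hY : Y * Y = 1) (hZ : Z * Z = 1)
    (xy : X * Y = Y * X) (xz : X * Z = Z * X) (yz : Y * Z = Z * Y) (a : GA) :
    tpr X Y Z a * tpr X Y Z a = tpr X Y Z a := by
  obtain ⟨h1, h2, h3⟩ := tpr_left hX hY hZ xy xz yz a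
  nth_rewrite 1 [tpr]
  rw [Matrix.mul_assoc, h3, Matrix.mul_assoc, h2, h1]

lemma tpr_same (hX : X * X = 1) (a : GA) :
    tpr X X X a = if a.1 = a.2.1 ∧ a.2.1 = a.2.2 then bpr X a.1 else 0 := by
  obtain ⟨a0, a1, a2⟩ := a
  unfold tpr
  split_ifs with h
  · obtain ⟨h1, h2⟩ := h
    simp only at h1 h2
    subst h1 h2
    simp only [bpr_mul_self hX]
  · by_cases h1 : a0 = a1
    · have h2 : a1 ≠ a2 := fun h2 => h ⟨h1, h2⟩
      simp only [Matrix.mul_assoc, bpr_mul_ne hX h2, mul_zero]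
    · simp only [bpr_mul_ne hX h1, zero_mul]

lemma tpr_not_ok (hX : X * X = 1) (hY : Y * Y = 1) (hZ : Z * Z = 1) {k : GKind}
    (h : GRel k X Y Z) {a : GA} (ha : ¬ gok k a) : tpr X Y Z a = 0 := by
  obtain ⟨xy, xz, yz, h⟩ := h
  obtain ⟨t1, t2, t3⟩ := tpr_left hX hY hZ xy xz yz a
  have eX : X * tpr X Y Z a = bsg a.1 • tpr X Y Z a := by
    rw [← t1, ← Matrix.mul_assoc, mul_bpr hX, smul_mul_assoc]
  have eY : Y * tpr X Y Z a = bsg a.2.1 • tpr X Y Z a := by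
    rw [← t2, ← Matrix.mul_assoc, mul_bpr hY, smul_mul_assoc]
  have eZ : Z * tpr X Y Z a = bsg a.2.2 • tpr X Y Z a := by
    rw [← t3, ← Matrix.mul_assoc, mul_bpr hZ, smul_mul_assoc]
  set M := tpr X Y Z a with hM
  clear_value M
  obtain ⟨a0, a1, a2⟩ := a
  have key : ∀ z : ℂ, z ≠ 0 → z • M = 0 → M = 0 := by
    intro z hz h
    exact (smul_eq_zero.mp h).resolve_left hz
  cases k
  case free => exact absurd trivial ha
  all_goals
    have h' := congrArg (fun W => W * M) h
    simp only [Matrix.mul_assoc, add_mul, sub_mul, eX, eY, eZ, mul_smul_comm, smul_smul,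
      one_mul, neg_mul] at h'
    rw [← sub_eq_zero] at h'
    cases a0 <;> cases a1 <;> cases a2 <;> simp [gok] at ha
    all_goals
      simp only [bsg] at h'
      norm_num at h'
      try exact h'
      first
        | (refine key 2 (by norm_num) (Eq.trans ?_ h'); module)
        | (refine key (-2) (by norm_num) (Eq.trans ?_ h'); module)
        | (refine key 4 (by norm_num) (Eq.trans ?_ h'); module)
        | (refine key (-4) (by norm_num) (Eq.trans ?_ h'); module)

end tpr

theorem strategy_of_model {B : Type} [DecidableEq B] [Fintype B] [Nonempty B]
    (X : GVar → Matrix B B ℂ) (hH : ∀ i, (X i).IsHermitian) (hX : ∀ i, X i * X i = 1)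
    (hrel : ∀ c, GRel (gctx c).1 (X (gctx c).2.1) (X (gctx c).2.2.1) (X (gctx c).2.2.2))
    (ε : ℝ) (hε : 0 ≤ ε)
    (htr : ∀ b c, b ≠ c → (Matrix.trace (bpr (X .E) b * bpr (X .Eh) c)).re ≤
      ε * Fintype.card B) :
    ∃ p ∈ QCorr GQ GA, (∀ x y a b, 0 ≤ p x y a b ∧ p x y a b ≤ 1) ∧
      ∀ x y a b, glose x y a b → p x y a b ≤ ε := by
  have hrel' : ∀ c, GRel (gdata c).1 (X (gdata c).2.1) (X (gdata c).2.2.1) (X (gdata c).2.2.2) := by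
    rintro (i | c)
    · exact ⟨rfl, rfl, rfl, trivial⟩
    · exact hrel c
  let P : GQ → GA → Matrix B B ℂ := fun c a =>
    tpr (X (gdata c).2.1) (X (gdata c).2.2.1) (X (gdata c).2.2.2) a
  have hP : ∀ x a, (P x a).IsHermitian ∧ P x a * P x a = P x a := by
    intro x a
    obtain ⟨xy, xz, yz, -⟩ := hrel' x
    exact ⟨tpr_herm (hH _) (hH _) (hH _) xy xz yz a,
      tpr_idem (hX _) (hX _) (hX _) xy xz yz a⟩
  have hP1 : ∀ x, ∑ a, P x a = 1 := fun x => tpr_sum _ _ _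
  have hl : ∀ c a k, bpr (X (gslot c k)) (gbit a k) * P c a = P c a := by
    intro c a k
    obtain ⟨xy, xz, yz, -⟩ := hrel' c
    obtain ⟨h1, h2, h3⟩ := tpr_left (hX _) (hX _) (hX _) xy xz yz a
    fin_cases k
    · exact h1
    · exact h2
    · exact h3
  have hr : ∀ c a k, P c a * bpr (X (gslot c k)) (gbit a k) = P c a := by
    intro c a k
    obtain ⟨xy, xz, yz, -⟩ := hrel' c
    obtain ⟨h1, h2, h3⟩ := tpr_right (hX _) (hX _) (hX _) xy xz yz a
    fin_cases k
    · exact h1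
    · exact h2
    · exact h3
  have hz : ∀ c c' a b k l, gslot c k = gslot c' l → gbit a k ≠ gbit b l →
      P c a * P c' b = 0 := by
    intro c c' a b k l h hne
    rw [← hr c a k, ← hl c' b l, Matrix.mul_assoc, ← Matrix.mul_assoc (bpr _ _), h,
      bpr_mul_ne (hX _) hne, Matrix.zero_mul, Matrix.mul_zero]
  have hcard : (0 : ℝ) < Fintype.card B := by exact_mod_cast Fintype.card_pos
  have hnn : ∀ x y a b, 0 ≤ (Matrix.trace (P x a * P y b)).re :=
    fun x y a b => trace_proj_nonneg (hP x a) (hP y b)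
  refine ⟨_, trace_strategy P hP hP1, ?_, ?_⟩
  · intro x y a b
    refine ⟨div_nonneg (hnn _ _ _ _) hcard.le, ?_⟩
    rw [div_le_one hcard]
    have hs : ∑ a, ∑ b, (Matrix.trace (P x a * P y b)).re = Fintype.card B := by
      simp only [← Complex.re_sum, ← Matrix.trace_sum, ← Matrix.mul_sum, hP1, Matrix.mul_one,
        Matrix.trace_one]
      simp
    rw [← hs]
    refine le_trans ?_ (Finset.single_le_sum
      (f := fun a => ∑ b, (Matrix.trace (P x a * P y b)).re)
      (fun a _ => Finset.sum_nonneg fun b _ => hnn _ _ _ _) (Finset.mem_univ a))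
    exact Finset.single_le_sum (f := fun b => (Matrix.trace (P x a * P y b)).re)
      (fun b _ => hnn _ _ _ _) (Finset.mem_univ b)
  · intro x y a b h
    have zero : P x a * P y b = 0 →
        (Matrix.trace (P x a * P y b)).re / (Fintype.card B : ℝ) ≤ ε := by
      intro h
      rw [h]; simpa using hε
    rcases h with ⟨rfl, h | h⟩ | ⟨k, l, h1, h2⟩ | ⟨rfl, rfl, h⟩
    · apply zero
      have : ∃ k, gbit a k ≠ gbit b k := by
        by_contra hc
        push Not at hc
        apply h
        obtain ⟨a0, a1, a2⟩ := a
        obtain ⟨b0, b1, b2⟩ := b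
        have e0 : a0 = b0 := hc 0
        have e1 : a1 = b1 := hc 1
        have e2 : a2 = b2 := hc 2
        rw [e0, e1, e2]
      obtain ⟨k, hk⟩ := this
      exact hz _ _ _ _ k k rfl hk
    · apply zero
      have : P x a = 0 := tpr_not_ok (hX _) (hX _) (hX _) (hrel' x) h
      rw [this, Matrix.zero_mul]
    · exact zero (hz _ _ _ _ k l h1 h2)
    · have e1 : P (.inl .E) a = tpr (X .E) (X .E) (X .E) a := rfl
      have e2 : P (.inl .Eh) b = tpr (X .Eh) (X .Eh) (X .Eh) b := rfl
      rw [tpr_same (hX _)] at e1 e2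
      split_ifs at e1
      · split_ifs at e2
        · change (Matrix.trace (P _ a * P _ b)).re / _ ≤ ε
          rw [e1, e2, div_le_iff₀ hcard]
          exact htr _ _ h
        · apply zero; rw [e2, Matrix.mul_zero]
      · apply zero; rw [e1, Matrix.zero_mul]

/-! ### The path model -/

theorem path_model (k : ℕ) : ∃ (Q : Type) (_ : Fintype Q) (_ : DecidableEq Q)
    (V : Bool → Q → Q) (t : Bool × Q ≃ Bool × Q),
    (∀ b q, V b (V b q) = q) ∧
    (∀ b q, t (!b, q) = ((t (b, q)).1, V false (t (b, q)).2)) ∧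
    (Finset.univ.filter fun z : Bool × Q =>
      t (z.1, V z.1 z.2) ≠ ((t z).1, V true (t z).2)).card ≤ 4 ∧
    Fintype.card Q = 2 ^ (k + 1) := by
  induction k with
  | zero =>
    refine ⟨Bool, inferInstance, inferInstance, fun b q => bif b then q else !q,
      Equiv.prodComm Bool Bool, ?_, ?_, ?_, rfl⟩
    · intro b q; cases b <;> simp
    · intro b q; simp
    · refine (Finset.card_le_univ _).trans ?_
      simp
  | succ k ih =>
    obtain ⟨Q, _, _, V, t, hV, ht, hbad, hcard⟩ := ih
    refine ⟨Bool × Q, inferInstance, inferInstance,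
      fun b z => bif b then (z.1, V z.1 z.2) else (!z.1, z.2),
      { toFun := fun z => ((t z.2).1, (z.1, (t z.2).2))
        invFun := fun z => (z.2.1, t.symm (z.1, z.2.2))
        left_inv := fun z => by simp
        right_inv := fun z => by simp }, ?_, ?_, ?_, ?_⟩
    · rintro (_ | _) ⟨b, q⟩
      · simp
      · simp [hV]
    · intro b q; simp
    · refine le_trans ?_ hbad
      refine Finset.card_le_card_of_injOn (fun z => z.2) ?_ ?_
      · rintro ⟨b, b', q⟩ hz
        simp only [Finset.coe_filter, Finset.mem_univ, true_and, Set.mem_setOf_eq] at hz ⊢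
        intro hc
        apply hz
        cases b
        · simp [ht]
        · simp [hc]
      · rintro ⟨b, b', q⟩ hz ⟨c, c', r⟩ hw h
        simp only [Finset.coe_filter, Finset.mem_univ, true_and, Set.mem_setOf_eq] at hz hw h
        have hb : b = true := by
          cases b
          · exact absurd (by simp [ht]) hz
          · rfl
        have hc : c = true := by
          cases c
          · exact absurd (by simp [ht]) hw
          · rfl
        rw [hb, hc, h]
    · rw [Fintype.card_prod, hcard, Fintype.card_bool]; ring

/-! ### Signed permutation matrices -/

/-- Signed permutation matrix. -/
def sp {B : Type} [DecidableEq B] (w : (B → B) × (B → ℤ)) : Matrix B B ℂ :=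
  Matrix.of fun i j => if j = w.1 i then (w.2 i : ℂ) else 0

section sp
variable {B : Type} [DecidableEq B] [Fintype B]

lemma sp_mul (w w' : (B → B) × (B → ℤ)) :
    sp w * sp w' = sp (fun i => w'.1 (w.1 i), fun i => w.2 i * w'.2 (w.1 i)) := by
  ext i j
  simp only [sp, Matrix.mul_apply, Matrix.of_apply, ite_mul, zero_mul, Finset.sum_ite_eq',
    Finset.sum_ite_eq, Finset.mem_univ, if_true]
  split_ifs <;> simp

lemma sp_one : (1 : Matrix B B ℂ) = sp (fun i => i, fun _ => 1) := by
  ext i j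
  simp [sp, Matrix.one_apply, eq_comm]

lemma sp_neg_one : (-1 : Matrix B B ℂ) = sp (fun i => i, fun _ => -1) := by
  ext i j
  by_cases h : i = j <;> simp [sp, h, Ne.symm]

lemma sp_ext {w w' : (B → B) × (B → ℤ)} (h : ∀ i, w.1 i = w'.1 i ∧ w.2 i = w'.2 i) :
    sp w = sp w' := by
  ext i j
  simp [sp, (h i).1, (h i).2]

lemma sp_invol {w : (B → B) × (B → ℤ)} (h : ∀ i, w.1 (w.1 i) = i ∧ w.2 i * w.2 (w.1 i) = 1) :
    sp w * sp w = 1 := by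
  rw [sp_mul, sp_one]
  exact sp_ext h

lemma sp_herm {w : (B → B) × (B → ℤ)} (h : ∀ i, w.1 (w.1 i) = i ∧ w.2 i * w.2 (w.1 i) = 1) :
    (sp w).IsHermitian := by
  ext i j
  have hs : w.2 (w.1 i) = w.2 i := by
    rcases Int.mul_eq_one_iff_eq_one_or_neg_one.mp (h i).2 with h | h <;> rw [h.1, h.2]
  simp only [sp, Matrix.conjTranspose_apply, Matrix.of_apply]
  by_cases hj : j = w.1 i
  · subst hj
    simp [(h i).1, hs]
  · have : i ≠ w.1 j := fun h' => hj (by rw [h', (h j).1])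
    simp [hj, this]

/-- Pointwise form of the relations. -/
def SRel (k : GKind) (A C D : (B → B) × (B → ℤ)) : Prop :=
  match k with
  | .prodp => ∀ i, D.1 (C.1 (A.1 i)) = i ∧ A.2 i * C.2 (A.1 i) * D.2 (C.1 (A.1 i)) = 1
  | .prodm => ∀ i, D.1 (C.1 (A.1 i)) = i ∧ A.2 i * C.2 (A.1 i) * D.2 (C.1 (A.1 i)) = -1
  | .selp => ∀ i, A.1 i = i ∧ (A.2 i = -1 ∨ (D.1 i = C.1 i ∧ D.2 i = C.2 i))
  | .selm => ∀ i, A.1 i = i ∧ (A.2 i = 1 ∨ (D.1 i = C.1 i ∧ D.2 i = C.2 i))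
  | .free => True

/-- Pointwise commutation. -/
def SComm (A C : (B → B) × (B → ℤ)) : Prop :=
  ∀ i, C.1 (A.1 i) = A.1 (C.1 i) ∧ A.2 i * C.2 (A.1 i) = C.2 i * A.2 (C.1 i)

lemma sp_comm {A C : (B → B) × (B → ℤ)} (h : SComm A C) : sp A * sp C = sp C * sp A := by
  rw [sp_mul, sp_mul]
  exact sp_ext h

lemma sp_rel {k : GKind} {A C D : (B → B) × (B → ℤ)} (h1 : SComm A C) (h2 : SComm A D)
    (h3 : SComm C D) (h : SRel k A C D) : GRel k (sp A) (sp C) (sp D) := by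
  refine ⟨sp_comm h1, sp_comm h2, sp_comm h3, ?_⟩
  cases k
  · change sp A * sp C * sp D = 1
    rw [sp_mul, sp_mul, sp_one]
    exact sp_ext h
  · change sp A * sp C * sp D = -1
    rw [sp_mul, sp_mul, sp_neg_one]
    exact sp_ext h
  · change sp D + sp A * sp D = sp C + sp A * sp C
    rw [sp_mul, sp_mul]
    ext i j
    obtain ⟨e, h | ⟨h, h'⟩⟩ := h i
    · simp only [sp, Matrix.add_apply, Matrix.of_apply, e, h]
      split_ifs <;> simp
    · simp only [sp, Matrix.add_apply, Matrix.of_apply, e, h, h']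
  · change sp D - sp A * sp D = sp C - sp A * sp C
    rw [sp_mul, sp_mul]
    ext i j
    obtain ⟨e, h | ⟨h, h'⟩⟩ := h i
    · simp only [sp, Matrix.sub_apply, Matrix.of_apply, e, h]
      split_ifs <;> simp
    · simp only [sp, Matrix.sub_apply, Matrix.of_apply, e, h, h']
  · trivial

lemma sp_trace (f g : B → B) (N : ℕ)
    (hN : (Finset.univ.filter fun i => f i ≠ g i).card ≤ N)
    (hg : ∀ i, g (g i) = i) (b c : Bool) (hbc : b ≠ c) :
    (Matrix.trace (bpr (sp (f, fun _ => 1)) b * bpr (sp (g, fun _ => 1)) c)).re ≤ N := by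
  have hsum : (N : ℝ) ≥ ∑ i, if f i ≠ g i then (1 : ℝ) else 0 := by
    rw [Finset.sum_boole]
    exact_mod_cast hN
  refine le_trans ?_ hsum
  rw [Matrix.trace, Complex.re_sum]
  refine Finset.sum_le_sum fun i _ => ?_
  have e : bpr (sp (f, fun _ => 1)) b * bpr (sp (g, fun _ => 1)) c =
      (4⁻¹ : ℂ) • (1 + bsg b • sp (f, fun _ => 1) + bsg c • sp (g, fun _ => 1) +
        (bsg b * bsg c) • sp (fun i => g (f i), fun _ => 1)) := by
    have := sp_mul (f, fun _ => 1) (g, fun _ => 1)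
    simp only [mul_one] at this
    rw [← this]
    unfold bpr
    simp only [mul_add, add_mul, smul_mul_assoc, mul_smul_comm, one_mul, mul_one]
    module
  rw [e]
  have hgf : i = g (f i) ↔ f i = g i := by
    constructor
    · intro h
      have := congrArg g h
      rw [hg] at this
      exact this.symm
    · intro h
      rw [h, hg]
  simp only [Matrix.diag_apply, Matrix.smul_apply, Matrix.add_apply, Matrix.one_apply_eq, sp,
    Matrix.of_apply, hgf, smul_eq_mul]
  by_cases h : f i = g i
  · cases b <;> cases c <;> simp [bsg] at hbc ⊢ <;> simp [h] <;> split_ifs <;> simp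
  · cases b <;> cases c <;> simp [bsg] at hbc ⊢ <;> simp [h] <;> split_ifs <;> norm_num

end sp

/-! ### The approximate models -/

/-- Sign of a bit. -/
def sgz (b : Bool) : ℤ := bif b then -1 else 1

/-- The signed permutations of the model. -/
def gm {Q : Type} (V : Bool → Q → Q) (t : Bool × Q ≃ Bool × Q) :
    GVar → (((Bool × Q) × Bool × Bool → (Bool × Q) × Bool × Bool) ×
      ((Bool × Q) × Bool × Bool → ℤ))
  | .u => (fun i => ((!i.1.1, i.1.2), i.2), fun _ => 1)
  | .s => (fun i => i, fun i => sgz i.1.1)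
  | .y => (fun i => (i.1, !i.2.1, i.2.2), fun _ => 1)
  | .S => (fun i => i, fun i => sgz i.2.1)
  | .uy => (fun i => ((!i.1.1, i.1.2), !i.2.1, i.2.2), fun _ => 1)
  | .Ss => (fun i => i, fun i => sgz i.2.1 * sgz i.1.1)
  | .uS => (fun i => ((!i.1.1, i.1.2), i.2), fun i => sgz i.2.1)
  | .ys => (fun i => (i.1, !i.2.1, i.2.2), fun i => sgz i.1.1)
  | .yy => (fun i => ((!i.1.1, i.1.2), !i.2.1, i.2.2), fun i => - (sgz i.2.1 * sgz i.1.1))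
  | .a => (fun i => i, fun i => sgz i.2.2)
  | .d => (fun i => (i.1, i.2.1, !i.2.2), fun _ => 1)
  | .x => (fun i => (bif i.2.1 then t.symm i.1 else t i.1, !i.2.1, i.2.2), fun _ => 1)
  | .ax => (fun i => (bif i.2.1 then t.symm i.1 else t i.1, !i.2.1, i.2.2), fun i => sgz i.2.2)
  | .Sd => (fun i => (i.1, i.2.1, !i.2.2), fun i => sgz i.2.1)
  | .aS => (fun i => i, fun i => sgz i.2.2 * sgz i.2.1)
  | .xd => (fun i => (bif i.2.1 then t.symm i.1 else t i.1, !i.2.1, !i.2.2), fun _ => 1)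
  | .zz => (fun i => (bif i.2.1 then t.symm i.1 else t i.1, !i.2.1, !i.2.2),
      fun i => sgz i.2.2 * sgz i.2.1)
  | .V0 => (fun i => ((i.1.1, V false i.1.2), i.2), fun _ => 1)
  | .V1 => (fun i => ((i.1.1, V true i.1.2), i.2), fun _ => 1)
  | .v => (fun i => ((i.1.1, V i.1.1 i.1.2), i.2), fun _ => 1)
  | .D => (fun i => (bif i.2.1 then (i.1.1, V false i.1.2) else (!i.1.1, i.1.2), i.2),
      fun _ => 1)
  | .E => (fun i => (bif i.2.1 then (i.1.1, V true i.1.2) else (i.1.1, V i.1.1 i.1.2), i.2),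
      fun _ => 1)
  | .Eh => (fun i => (bif i.2.1 then (i.1.1, V true i.1.2)
      else t.symm ((t i.1).1, V true (t i.1).2), i.2), fun _ => 1)
  | .W0 => (fun i => (bif i.1.1 then i.1 else (i.1.1, V false i.1.2), i.2), fun _ => 1)
  | .W1 => (fun i => (bif i.1.1 then (i.1.1, V true i.1.2) else i.1, i.2), fun _ => 1)
  | .W2 => (fun i => (bif i.2.1 then i.1 else (i.1.1, V i.1.1 i.1.2), i.2), fun _ => 1)
  | .W3 => (fun i => (bif i.2.1 then (i.1.1, V true i.1.2) else i.1, i.2), fun _ => 1)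

lemma sgz_sq (b : Bool) : sgz b * sgz b = 1 := by cases b <;> rfl

lemma gm_invol {Q : Type} (V : Bool → Q → Q) (t : Bool × Q ≃ Bool × Q)
    (hV : ∀ b q, V b (V b q) = q) (g : GVar) (i : (Bool × Q) × Bool × Bool) :
    (gm V t g).1 ((gm V t g).1 i) = i ∧ (gm V t g).2 i * (gm V t g).2 ((gm V t g).1 i) = 1 := by
  obtain ⟨⟨b, q⟩, S, c⟩ := i
  cases g <;> cases b <;> cases S <;> cases c <;> simp [gm, sgz, hV]

set_option maxHeartbeats 2000000 in
lemma gm_rel {Q : Type} [DecidableEq Q] [Fintype Q] (V : Bool → Q → Q)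
    (t : Bool × Q ≃ Bool × Q)
    (ht : ∀ b q, t (!b, q) = ((t (b, q)).1, V false (t (b, q)).2)) (c : Fin 28) :
    GRel (gctx c).1 (sp (gm V t (gctx c).2.1)) (sp (gm V t (gctx c).2.2.1))
      (sp (gm V t (gctx c).2.2.2)) := by
  have ht' : ∀ b q, t.symm (b, V false q) = (!(t.symm (b, q)).1, (t.symm (b, q)).2) := by
    intro b q
    rw [Equiv.symm_apply_eq, ht]
    simp
  have h1 : ∀ q, ((t (false, q)).1, V false (t (false, q)).2) = t (true, q) :=
    fun q => (ht false q).symm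
  have h2 : ∀ q, ((t (true, q)).1, V false (t (true, q)).2) = t (false, q) :=
    fun q => (ht true q).symm
  refine sp_rel ?_ ?_ ?_ ?_
  · rintro ⟨⟨b, q⟩, S, e⟩
    fin_cases c <;> cases b <;> cases S <;> cases e <;> simp [gctx, gm, sgz, ht', h1, h2]
  · rintro ⟨⟨b, q⟩, S, e⟩
    fin_cases c <;> cases b <;> cases S <;> cases e <;> simp [gctx, gm, sgz, ht', h1, h2]
  · rintro ⟨⟨b, q⟩, S, e⟩
    fin_cases c <;> cases b <;> cases S <;> cases e <;> simp [gctx, gm, sgz, ht', h1, h2]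
  · fin_cases c
    all_goals
      first
        | exact trivial
        | (rintro ⟨⟨b, q⟩, S, e⟩
           cases b <;> cases S <;> cases e <;> simp [gctx, gm, sgz])

theorem approx_strategy (k : ℕ) : ∃ p ∈ QCorr GQ GA,
    (∀ x y a b, 0 ≤ p x y a b ∧ p x y a b ≤ 1) ∧
      ∀ x y a b, glose x y a b → p x y a b ≤ (1 / 2 : ℝ) ^ k := by
  obtain ⟨Q, _, _, V, t, hV, ht, hbad, hcard⟩ := path_model k
  have hQ : Nonempty Q := by
    rw [← Fintype.card_pos_iff, hcard]; positivity
  have hinv := gm_invol V t hV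
  refine strategy_of_model (fun g => sp (gm V t g)) (fun g => sp_herm (hinv g))
    (fun g => sp_invol (hinv g)) (gm_rel V t ht) _ (by positivity) ?_
  intro b c hbc
  have hN : (Finset.univ.filter fun i => (gm V t .E).1 i ≠ (gm V t .Eh).1 i).card ≤ 8 := by
    have h8 : ((Finset.univ.filter fun z : Bool × Q =>
        t (z.1, V z.1 z.2) ≠ ((t z).1, V true (t z).2)) ×ˢ
          (Finset.univ : Finset Bool)).card ≤ 8 := by
      rw [Finset.card_product, Finset.card_univ, Fintype.card_bool]
      omega
    have hS : ∀ i, (gm V t .E).1 i ≠ (gm V t .Eh).1 i → i.2.1 = false := by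
      rintro ⟨z, S, e⟩ h
      cases S
      · rfl
      · exact absurd (by simp [gm]) h
    refine le_trans (Finset.card_le_card_of_injOn (fun i => (i.1, i.2.2)) ?_ ?_) h8
    · rintro ⟨z, S, e⟩ hi
      simp only [Finset.coe_filter, Finset.mem_univ, true_and, Set.mem_setOf_eq] at hi
      simp only [Finset.coe_product, Set.mem_prod, Finset.coe_filter, Finset.mem_univ, true_and,
        Set.mem_setOf_eq, Finset.coe_univ, Set.mem_univ, and_true]
      intro hc
      apply hi
      have := hS _ hi
      simp only at this
      subst this
      simp only [gm, cond_false]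
      rw [← hc, Equiv.symm_apply_apply]
    · rintro ⟨z, S, e⟩ hi ⟨z', S', e'⟩ hi' h
      simp only [Finset.coe_filter, Finset.mem_univ, true_and, Set.mem_setOf_eq] at hi hi'
      have h1 := hS _ hi
      have h2 := hS _ hi'
      simp only [Prod.mk.injEq] at h h1 h2
      rw [h1, h2, h.1, h.2]
  refine (sp_trace _ _ 8 hN (fun i => (hinv .Eh i).1) b c hbc).trans ?_
  have hB : Fintype.card ((Bool × Q) × Bool × Bool) = 2 ^ k * 16 := by
    simp only [Fintype.card_prod, hcard, Fintype.card_bool]; ring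
  rw [hB]
  push_cast
  rw [← mul_assoc, ← mul_pow]
  norm_num

theorem exists_qa : ∃ p ∈ closure (QCorr GQ GA), ∀ x y a b, glose x y a b → p x y a b = 0 := by
  choose p hp hb hl using approx_strategy
  have hmem : ∀ k, p k ∈ Set.Icc (0 : GQ → GQ → GA → GA → ℝ) 1 := fun k =>
    ⟨fun x y a b => (hb k x y a b).1, fun x y a b => (hb k x y a b).2⟩
  obtain ⟨q, hq, φ, hφ, hlim⟩ := isCompact_Icc.tendsto_subseq hmem
  refine ⟨q, mem_closure_of_tendsto hlim (Filter.Eventually.of_forall fun k => hp _), ?_⟩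
  intro x y a b h
  refine le_antisymm ?_ (hq.1 x y a b)
  have h1 : Filter.Tendsto (fun k => p (φ k) x y a b) Filter.atTop (nhds (q x y a b)) := by
    have := hlim
    simp only [tendsto_pi_nhds] at this
    exact this x y a b
  have h2 : Filter.Tendsto (fun k => (1 / 2 : ℝ) ^ (φ k)) Filter.atTop (nhds 0) :=
    (tendsto_pow_atTop_nhds_zero_of_lt_one (by norm_num) (by norm_num)).comp hφ.tendsto_atTop
  exact le_of_tendsto_of_tendsto' h1 h2 fun k => hl _ x y a b h

lemma qcorr_reindex {I O I' O' : Type} [Fintype I] [Fintype O] [Fintype I'] [Fintype O']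
    (e : I' ≃ I) (f : O' ≃ O) {p : I → I → O → O → ℝ} (hp : p ∈ QCorr I O) :
    (fun x y a b => p (e x) (e y) (f a) (f b)) ∈ QCorr I' O' := by
  obtain ⟨dA, dB, hA, hB, E, F, ψ, h1, h2, h3, h4, h5, h6⟩ := hp
  refine ⟨dA, dB, hA, hB, fun x a => E (e x) (f a), fun x a => F (e x) (f a), ψ,
    fun x a => h1 _ _, fun x => ?_, fun x a => h3 _ _, fun x => ?_, h5, fun x y a b => h6 _ _ _ _⟩
  · rw [← h2 (e x)]; exact Equiv.sum_comp f (E (e x))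
  · rw [← h4 (e x)]; exact Equiv.sum_comp f (F (e x))


/-- There is a synchronous game (given by its set of losing tuples: `lose x y a b`
means `λ(x,y,a,b) = 0`) with a perfect qa-strategy but no perfect q-strategy. -/
theorem exists_syncGame_perfect_qa_not_q :
    ∃ n m : ℕ, 1 ≤ n ∧ 1 ≤ m ∧
      ∃ lose : Fin n → Fin n → Fin m → Fin m → Prop,
        (∀ x a b, a ≠ b → lose x x a b) ∧
        (∃ p ∈ closure (QCorr (Fin n) (Fin m)),
          ∀ x y a b, lose x y a b → p x y a b = 0) ∧
        ¬ (∃ p ∈ QCorr (Fin n) (Fin m),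
          ∀ x y a b, lose x y a b → p x y a b = 0) := by
  classical
  let e : GQ ≃ Fin (Fintype.card GQ) := Fintype.equivFin GQ
  let f : GA ≃ Fin (Fintype.card GA) := Fintype.equivFin GA
  refine ⟨Fintype.card GQ, Fintype.card GA, Fintype.card_pos_iff.mpr ⟨.inr 0⟩,
    Fintype.card_pos_iff.mpr ⟨(true, true, true)⟩,
    fun x y a b => glose (e.symm x) (e.symm y) (f.symm a) (f.symm b), ?_, ?_, ?_⟩
  · intro x a b h
    exact Or.inl ⟨rfl, Or.inl fun h' => h (f.symm.injective h')⟩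
  · obtain ⟨p, hp, hl⟩ := exists_qa
    refine ⟨fun x y a b => p (e.symm x) (e.symm y) (f.symm a) (f.symm b), ?_,
      fun x y a b h => hl _ _ _ _ h⟩
    refine map_mem_closure (f := fun (p : GQ → GQ → GA → GA → ℝ) x y a b =>
      p (e.symm x) (e.symm y) (f.symm a) (f.symm b)) (by fun_prop) hp ?_
    intro p hp
    exact qcorr_reindex e.symm f.symm hp
  · rintro ⟨p, hp, hl⟩
    refine no_perfect_q _ (qcorr_reindex e f hp) ?_
    intro x y a b h
    apply hl
    simpa using h
end
end

section
/- Let d ≥ 1 and let p ∈ M_d(ℂ) be a positive contraction. Then there exists a projection q ∈ M_d(ℂ) commuting with p (namely the spectral projection of p for the interval [1/2, 1]) such that ‖p − q‖₂ ≤ 2√2 ‖p − p²‖₂. -/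
open Matrix
open scoped ComplexOrder

noncomputable section

/-- The Hilbert–Schmidt (Frobenius) norm `‖a‖₂ = (Tr(a* a))^(1/2)` of a complex matrix. -/
def hsNorm {d : ℕ} (a : Matrix (Fin d) (Fin d) ℂ) : ℝ :=
  Real.sqrt (Matrix.trace (aᴴ * a)).re

/-- For a positive contraction `p ∈ M_d(ℂ)` there is a projection `q` commuting
with `p` (the spectral projection of `p` for `[1/2, 1]`) with
`‖p − q‖₂ ≤ 2√2 ‖p − p²‖₂`. -/
theorem dist_to_spectral_projection (d : ℕ) (hd : 1 ≤ d)
    (p : Matrix (Fin d) (Fin d) ℂ)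
    (hpos : p.PosSemidef) (hcontr : (1 - p).PosSemidef) :
    ∃ q : Matrix (Fin d) (Fin d) ℂ,
      q.IsHermitian ∧ q * q = q ∧ p * q = q * p ∧
      hsNorm (p - q) ≤ 2 * Real.sqrt 2 * hsNorm (p - p * p) := by
  classical
  have key : ∀ (U : Matrix (Fin d) (Fin d) ℂ), star U * U = 1 → ∀ g : Fin d → ℝ,
      hsNorm (U * diagonal (fun i => (g i : ℂ)) * star U) = Real.sqrt (∑ i, g i ^ 2) := by
    intro U hU g
    have h1 : (U * diagonal (fun i => (g i : ℂ)) * star U)ᴴ *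
        (U * diagonal (fun i => (g i : ℂ)) * star U)
        = U * (diagonal (fun i => ((g i ^ 2 : ℝ) : ℂ)) * star U) := by
      have h2 : (diagonal (fun i => (g i : ℂ)))ᴴ = diagonal (fun i => (g i : ℂ)) := by
        rw [diagonal_conjTranspose]
        congr 1
        ext i
        simp
      have h3 : (diagonal (fun i => ((g i ^ 2 : ℝ) : ℂ)) : Matrix (Fin d) (Fin d) ℂ)
          = diagonal (fun i => (g i : ℂ)) * diagonal (fun i => (g i : ℂ)) := by
        rw [diagonal_mul_diagonal]
        congr 1
        ext i
        push_cast
        ring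
      rw [h3, conjTranspose_mul, conjTranspose_mul, h2, star_eq_conjTranspose,
        conjTranspose_conjTranspose]
      rw [star_eq_conjTranspose] at hU
      simp only [Matrix.mul_assoc]
      rw [← Matrix.mul_assoc Uᴴ U, hU, Matrix.one_mul]
    unfold hsNorm
    rw [h1, trace_mul_comm, Matrix.mul_assoc, hU, Matrix.mul_one, trace_diagonal,
      ← Complex.ofReal_sum, Complex.ofReal_re]
  have hA := hpos.1
  set l := hA.eigenvalues with hl
  obtain ⟨U, hU, hp⟩ : ∃ U : Matrix (Fin d) (Fin d) ℂ, star U * U = 1 ∧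
      p = U * diagonal (fun i => (l i : ℂ)) * star U := by
    refine ⟨hA.eigenvectorUnitary, Unitary.coe_star_mul_self _, ?_⟩
    have := hA.spectral_theorem
    rw [Unitary.conjStarAlgAut_apply] at this
    exact this
  have hmul : ∀ f g : Fin d → ℝ, (U * diagonal (fun i => (f i : ℂ)) * star U) *
      (U * diagonal (fun i => (g i : ℂ)) * star U)
      = U * diagonal (fun i => ((f i * g i : ℝ) : ℂ)) * star U := by
    intro f g
    have h3 : (diagonal (fun i => ((f i * g i : ℝ) : ℂ)) : Matrix (Fin d) (Fin d) ℂ)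
        = diagonal (fun i => (f i : ℂ)) * diagonal (fun i => (g i : ℂ)) := by
      rw [diagonal_mul_diagonal]
      simp
    rw [h3]
    simp only [Matrix.mul_assoc]
    rw [← Matrix.mul_assoc (star U) U, hU, Matrix.one_mul]
  have hsub : ∀ f g : Fin d → ℝ, (U * diagonal (fun i => (f i : ℂ)) * star U) -
      (U * diagonal (fun i => (g i : ℂ)) * star U)
      = U * diagonal (fun i => ((f i - g i : ℝ) : ℂ)) * star U := by
    intro f g
    rw [← Matrix.sub_mul, ← Matrix.mul_sub, diagonal_sub]
    simp
  set e : Fin d → ℝ := fun i => if 1 / 2 ≤ l i then 1 else 0 with he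
  refine ⟨U * diagonal (fun i => (e i : ℂ)) * star U, ?_, ?_, ?_, ?_⟩
  · unfold IsHermitian
    rw [star_eq_conjTranspose, conjTranspose_mul, conjTranspose_mul, conjTranspose_conjTranspose,
      diagonal_conjTranspose, Matrix.mul_assoc]
    congr 3
    ext i
    simp
  · rw [hmul]
    congr 3
    ext i
    simp only [he]
    split_ifs <;> simp
  · rw [hp, hmul, hmul]
    simp only [mul_comm]
  · rw [hp, hmul, hsub, hsub, key U hU, key U hU]
    have h2 : (2 : ℝ) ≤ 2 * Real.sqrt 2 := by
      have : (1 : ℝ) ≤ Real.sqrt 2 := Real.one_le_sqrt.2 (by norm_num)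
      linarith
    refine le_trans ?_ (mul_le_mul_of_nonneg_right h2 (Real.sqrt_nonneg _))
    rw [Real.sqrt_le_left (by positivity), mul_pow, Real.sq_sqrt (by positivity), Finset.mul_sum]
    refine Finset.sum_le_sum fun i _ => ?_
    rw [← mul_pow]
    apply sq_le_sq.2
    have h4 : 2 * (l i - l i * l i) = 2 * (l i * (1 - l i)) := by ring
    rw [h4, abs_mul, abs_mul]
    simp only [he]
    split_ifs with h
    · rw [abs_sub_comm, abs_two, abs_of_nonneg (by linarith : 0 ≤ l i)]
      nlinarith [abs_nonneg (1 - l i)]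
    · rw [sub_zero, abs_two, abs_of_nonneg (by linarith : 0 ≤ 1 - l i)]
      nlinarith [abs_nonneg (l i)]
end
end

section
/- Given ε > 0 and an integer m ≥ 1, there is a δ > 0 such that for every integer d ≥ 1, if p₁, …, p_m ∈ M_d(ℂ) are positive contractions with ‖p_i² − p_i‖₂ < δ for all i and ‖p_i p_j‖₂ < δ for all i ≠ j, then there exist mutually orthogonal projections q₁, …, q_m ∈ M_d(ℂ) (i.e., q_i q_j = 0 for i ≠ j) such that ‖p_i − q_i‖₂ < ε for all i = 1, …, m. -/
open Matrix
open scoped ComplexOrder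

noncomputable section

section Helpers

open scoped Matrix.Norms.Frobenius

variable {d : ℕ}

local notation "M" => Matrix (Fin d) (Fin d) ℂ

theorem hs_trace_re (a : M) : (Matrix.trace (aᴴ * a)).re = ∑ i, ∑ j, ‖a i j‖ ^ 2 := by
  rw [Finset.sum_comm]
  simp only [Matrix.trace, Matrix.diag, Matrix.mul_apply, Matrix.conjTranspose_apply,
    Complex.re_sum]
  refine Finset.sum_congr rfl fun i _ => Finset.sum_congr rfl fun j _ => ?_
  rw [Complex.star_def, ← Complex.normSq_eq_conj_mul_self, Complex.ofReal_re,
    Complex.normSq_eq_norm_sq]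

theorem hsNorm_eq (a : M) : hsNorm a = ‖a‖ := by
  rw [hsNorm, hs_trace_re, Matrix.frobenius_norm_def, Real.sqrt_eq_rpow]
  simp

theorem hs_ct (a : M) : ‖aᴴ‖ = ‖a‖ := Matrix.frobenius_norm_conjTranspose a

def PC (p : M) : Prop := p.PosSemidef ∧ (1 - p).PosSemidef

theorem PC.sq {p : M} (h : PC p) : (1 - p * p).PosSemidef := by
  have h1 := h.1.conjTranspose_mul_mul_same (1 - p)
  have h2 := h.2.conjTranspose_mul_mul_same p
  rw [h.1.isHermitian.eq] at h2
  rw [h.2.isHermitian.eq] at h1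
  have := (h1.add h2).add h.2
  convert this using 1
  noncomm_ring

theorem PC.left {p : M} (h : PC p) (a : M) : ‖p * a‖ ≤ ‖a‖ := by
  rw [← hsNorm_eq, ← hsNorm_eq]
  apply Real.sqrt_le_sqrt
  have h1 := (h.sq.conjTranspose_mul_mul_same a).trace_nonneg
  have h2 : aᴴ * (1 - p * p) * a = aᴴ * a - (p * a)ᴴ * (p * a) := by
    rw [Matrix.conjTranspose_mul, h.1.isHermitian.eq]; noncomm_ring
  rw [h2, Matrix.trace_sub] at h1
  have h3 := (Complex.le_def.1 h1).1
  simp only [Complex.zero_re, Complex.sub_re] at h3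
  linarith

theorem PC.right {p : M} (h : PC p) (a : M) : ‖a * p‖ ≤ ‖a‖ := by
  rw [← hs_ct (a * p), ← hs_ct a, Matrix.conjTranspose_mul, h.1.isHermitian.eq]
  exact h.left _

theorem proj_psd {q : M} (h : q.IsHermitian) (hq : q * q = q) : q.PosSemidef := by
  have := Matrix.posSemidef_conjTranspose_mul_self q
  rwa [h.eq, hq] at this

theorem proj_compl {q : M} (h : q.IsHermitian) (hq : q * q = q) :
    (1 - q).IsHermitian ∧ (1 - q) * (1 - q) = 1 - q := by
  refine ⟨Matrix.isHermitian_one.sub h, ?_⟩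
  have : (1 - q) * (1 - q) = 1 - q - q + q * q := by noncomm_ring
  rw [this, hq]; noncomm_ring

theorem proj_PC {q : M} (h : q.IsHermitian) (hq : q * q = q) : PC q :=
  ⟨proj_psd h hq, proj_psd (proj_compl h hq).1 (proj_compl h hq).2⟩

theorem norm_conj_diag {U : M} (hU : Uᴴ * U = 1) (f : Fin d → ℂ) :
    ‖U * diagonal f * Uᴴ‖ = Real.sqrt (∑ i, ‖f i‖ ^ 2) := by
  rw [← hsNorm_eq, hsNorm]
  congr 1
  have : (U * diagonal f * Uᴴ)ᴴ * (U * diagonal f * Uᴴ)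
      = U * ((diagonal f)ᴴ * diagonal f * Uᴴ) := by
    simp only [Matrix.conjTranspose_mul, Matrix.conjTranspose_conjTranspose]
    calc _ = U * (diagonal f)ᴴ * (Uᴴ * U) * diagonal f * Uᴴ := by noncomm_ring
      _ = _ := by rw [hU]; noncomm_ring
  rw [this, Matrix.trace_mul_comm, Matrix.mul_assoc, hU, Matrix.mul_one, hs_trace_re]
  refine Finset.sum_congr rfl fun i _ => ?_
  rw [Finset.sum_eq_single i]
  · simp
  · intro j _ hj
    simp [Matrix.diagonal_apply_ne' _ hj]
  · simp

theorem conj_diag_mul {U : M} (hU : Uᴴ * U = 1) (f g : Fin d → ℂ) :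
    (U * diagonal f * Uᴴ) * (U * diagonal g * Uᴴ) = U * diagonal (fun i => f i * g i) * Uᴴ := by
  rw [← Matrix.diagonal_mul_diagonal]
  calc _ = U * diagonal f * (Uᴴ * U) * diagonal g * Uᴴ := by noncomm_ring
      _ = _ := by rw [hU]; noncomm_ring

theorem conj_diag_sub {U : M} (f g : Fin d → ℂ) :
    (U * diagonal f * Uᴴ) - (U * diagonal g * Uᴴ) = U * diagonal (fun i => f i - g i) * Uᴴ := by
  rw [← Matrix.diagonal_sub]
  noncomm_ring

theorem scalar_bound (t : ℝ) :
    |t - (if 1 / 2 ≤ t then 1 else 0)| ≤ 2 * |t * t - t| := by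
  have h0 : t * t - t = t * (t - 1) := by ring
  rw [h0, abs_mul]
  split_ifs with h
  · have : 1 / 2 ≤ |t| := le_trans h (le_abs_self t)
    nlinarith [abs_nonneg (t - 1)]
  · have : 1 / 2 ≤ |t - 1| := by rw [abs_sub_comm]; exact le_trans (by linarith) (le_abs_self _)
    rw [sub_zero]
    nlinarith [abs_nonneg t]

theorem spectral_proj {h : M} (hh : h.IsHermitian) :
    ∃ q g : M, q.IsHermitian ∧ q * q = q ∧ q = g * h ∧ ‖h - q‖ ≤ 2 * ‖h * h - h‖ := by
  set U : M := (hh.eigenvectorUnitary : M) with hUdef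
  have hU : Uᴴ * U = 1 := Unitary.coe_star_mul_self hh.eigenvectorUnitary
  set e := hh.eigenvalues
  have hs : h = U * diagonal (fun i => (e i : ℂ)) * Uᴴ := by
    have := hh.spectral_theorem
    rw [Unitary.conjStarAlgAut_apply] at this
    exact this
  let c : Fin d → ℂ := fun i => ((if 1 / 2 ≤ e i then 1 else 0 : ℝ) : ℂ)
  let g : Fin d → ℂ := fun i => ((if 1 / 2 ≤ e i then (e i)⁻¹ else 0 : ℝ) : ℂ)
  refine ⟨U * diagonal c * Uᴴ, U * diagonal g * Uᴴ, ?_, ?_, ?_, ?_⟩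
  · apply Matrix.isHermitian_mul_mul_conjTranspose
    rw [Matrix.isHermitian_diagonal_iff]
    intro i
    simp [c, IsSelfAdjoint]
  · rw [conj_diag_mul hU]
    congr 3
    ext i
    simp only [c]
    split_ifs <;> simp
  · rw [hs, conj_diag_mul hU]
    congr 3
    ext i
    simp only [c, g]
    split_ifs with hi
    · have : e i ≠ 0 := by intro h0; rw [h0] at hi; norm_num at hi
      rw [← Complex.ofReal_mul, inv_mul_cancel₀ this]
    · simp
  · rw [hs, conj_diag_mul hU, conj_diag_sub, conj_diag_sub, norm_conj_diag hU, norm_conj_diag hU]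
    have : (2 : ℝ) = Real.sqrt (2 ^ 2) := by simp
    rw [this, ← Real.sqrt_mul (by positivity), Finset.mul_sum]
    apply Real.sqrt_le_sqrt
    refine Finset.sum_le_sum fun i _ => ?_
    rw [← mul_pow]
    refine pow_le_pow_left₀ (norm_nonneg _) ?_ 2
    simp only [c]
    rw [← Complex.ofReal_sub, ← Complex.ofReal_mul, ← Complex.ofReal_sub, Complex.norm_real,
      Complex.norm_real]
    exact scalar_bound (e i)

theorem step_lemma {p Q : M} (hp : PC p) (hQ : Q.IsHermitian) (hQ2 : Q * Q = Q) :
    ∃ q : M, q.IsHermitian ∧ q * q = q ∧ q * Q = 0 ∧ Q * q = 0 ∧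
      ‖p - q‖ ≤ 14 * ‖Q * p‖ + 2 * ‖p * p - p‖ := by
  obtain ⟨hS, hS2⟩ := proj_compl hQ hQ2
  set S := 1 - Q with hSd
  have hSPC := proj_PC hS hS2
  have hh : (S * p * S).IsHermitian := by
    have := Matrix.isHermitian_mul_mul_conjTranspose S hp.1.isHermitian
    rwa [hS.eq] at this
  set h := S * p * S with hhd
  obtain ⟨q, g, hq, hq2, hqg, hn⟩ := spectral_proj hh
  have hSQ : S * Q = 0 := by rw [hSd, Matrix.sub_mul, hQ2, Matrix.one_mul, sub_self]
  have hqQ : q * Q = 0 := by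
    rw [hqg, hhd, Matrix.mul_assoc, Matrix.mul_assoc, hSQ]; simp
  refine ⟨q, hq, hq2, hqQ, ?_, ?_⟩
  · have := congrArg Matrix.conjTranspose hqQ
    rwa [Matrix.conjTranspose_mul, hq.eq, hQ.eq, Matrix.conjTranspose_zero] at this
  have hpQ : ‖p * Q‖ = ‖Q * p‖ := by
    rw [← hs_ct, Matrix.conjTranspose_mul, hQ.eq, hp.1.isHermitian.eq]
  have e1 : p - h = Q * p + S * (p * Q) := by
    rw [hhd, hSd]; noncomm_ring
  have n1 : ‖p - h‖ ≤ 2 * ‖Q * p‖ := by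
    rw [e1]
    have := norm_add_le (Q * p) (S * (p * Q))
    have := hSPC.left (p * Q)
    linarith
  have n2 : ‖h * (p - h)‖ ≤ ‖p - h‖ := by
    rw [hhd, Matrix.mul_assoc, Matrix.mul_assoc]
    exact (hSPC.left _).trans ((hp.left _).trans (hSPC.left _))
  have n3 : ‖(p - h) * p‖ ≤ ‖p - h‖ := hp.right _
  have e2 : h * h - h = (p * p - p) + (p - h) - h * (p - h) - (p - h) * p := by noncomm_ring
  have n4 : ‖h * h - h‖ ≤ ‖p * p - p‖ + 3 * ‖p - h‖ := by
    rw [e2]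
    have a1 := norm_sub_le ((p * p - p) + (p - h) - h * (p - h)) ((p - h) * p)
    have a2 := norm_sub_le ((p * p - p) + (p - h)) (h * (p - h))
    have a3 := norm_add_le (p * p - p) (p - h)
    linarith
  have n5 := norm_sub_le_norm_sub_add_norm_sub p h q
  linarith

theorem main_ind (m : ℕ) : ∀ ε : ℝ, 0 < ε → ∃ δ > (0 : ℝ), ∀ d : ℕ,
      ∀ p : Fin m → Matrix (Fin d) (Fin d) ℂ,
        (∀ i, PC (p i)) →
        (∀ i, ‖p i * p i - p i‖ < δ) →
        (∀ i j, i ≠ j → ‖p i * p j‖ < δ) →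
        ∃ q : Fin m → Matrix (Fin d) (Fin d) ℂ,
          (∀ i, (q i).IsHermitian ∧ q i * q i = q i) ∧
          (∀ i j, i ≠ j → q i * q j = 0) ∧
          (∀ i, ‖p i - q i‖ < ε) := by
  induction m with
  | zero =>
    intro ε _
    exact ⟨1, one_pos, fun d p _ _ _ => ⟨p, fun i => i.elim0, fun i => i.elim0, fun i => i.elim0⟩⟩
  | succ m ih =>
    intro ε hε
    have hm : (0 : ℝ) ≤ m := Nat.cast_nonneg m
    obtain ⟨ε', hε'⟩ : ∃ x : ℝ, x = ε / (100 * (m + 1)) := ⟨_, rfl⟩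
    have hε0 : 0 < ε' := by rw [hε']; positivity
    have hεε : ε = ε' * (100 * (m + 1)) := by rw [hε']; field_simp
    have hle : ε' ≤ ε := by rw [hεε]; nlinarith
    obtain ⟨δ, hδ, H⟩ := ih ε' hε0
    refine ⟨min δ ε', lt_min hδ hε0, fun d p hp h1 h2 => ?_⟩
    obtain ⟨q, hq, hqo, hqn⟩ := H d (fun i => p i.castSucc) (fun i => hp _)
      (fun i => (h1 _).trans_le (min_le_left _ _))
      (fun i j hij => (h2 _ _ (fun h => hij (Fin.castSucc_injective _ h))).trans_le
        (min_le_left _ _))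
    have qQ : ∀ i, q i * (∑ j, q j) = q i := by
      intro i
      rw [Finset.mul_sum, Finset.sum_eq_single i]
      · exact (hq i).2
      · intro j _ hj; exact hqo i j hj.symm
      · simp
    have hQ : (∑ j, q j).IsHermitian := by
      rw [Matrix.IsHermitian, Matrix.conjTranspose_sum]
      exact Finset.sum_congr rfl fun i _ => (hq i).1
    have hQ2 : (∑ j, q j) * (∑ j, q j) = ∑ j, q j := by
      rw [Finset.sum_mul]
      exact Finset.sum_congr rfl fun i _ => qQ i
    have Qq : ∀ i, (∑ j, q j) * q i = q i := by
      intro i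
      have := congrArg Matrix.conjTranspose (qQ i)
      rwa [Matrix.conjTranspose_mul, hQ.eq, (hq i).1.eq] at this
    obtain ⟨r, hr, hr2, hrQ, hQr, hrn⟩ := step_lemma (hp (Fin.last m)) hQ hQ2
    have nη : ‖(∑ j, q j) * p (Fin.last m)‖ ≤ m * (2 * ε') := by
      rw [Finset.sum_mul]
      refine (norm_sum_le _ _).trans ?_
      have : ∀ i ∈ (Finset.univ : Finset (Fin m)), ‖q i * p (Fin.last m)‖ ≤ 2 * ε' := by
        intro i _
        have e : q i * p (Fin.last m) = p i.castSucc * p (Fin.last m)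
            - (p i.castSucc - q i) * p (Fin.last m) := by noncomm_ring
        rw [e]
        have a1 := norm_sub_le (p i.castSucc * p (Fin.last m))
          ((p i.castSucc - q i) * p (Fin.last m))
        have a2 := (hp (Fin.last m)).right (p i.castSucc - q i)
        have a3 := (h2 i.castSucc (Fin.last m) (Fin.castSucc_lt_last i).ne).trans_le
          (min_le_right _ _)
        have a4 := hqn i
        linarith
      refine (Finset.sum_le_card_nsmul _ _ _ this).trans ?_
      simp
    have h1' := (h1 (Fin.last m)).trans_le (min_le_right _ _)
    refine ⟨Fin.snoc (α := fun _ => Matrix (Fin d) (Fin d) ℂ) q r, ?_, ?_, ?_⟩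
    · intro i
      induction i using Fin.lastCases with
      | last => simpa using ⟨hr, hr2⟩
      | cast i => simpa using hq i
    · intro i j hij
      induction i using Fin.lastCases with
      | last =>
        induction j using Fin.lastCases with
        | last => exact absurd rfl hij
        | cast j =>
          simp only [Fin.snoc_last, Fin.snoc_castSucc]
          rw [← Qq j, ← Matrix.mul_assoc, hrQ, Matrix.zero_mul]
      | cast i =>
        induction j using Fin.lastCases with
        | last =>
          simp only [Fin.snoc_last, Fin.snoc_castSucc]
          rw [← qQ i, Matrix.mul_assoc, hQr, Matrix.mul_zero]
        | cast j =>
          simp only [Fin.snoc_castSucc]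
          exact hqo i j (fun h => hij (by rw [h]))
    · intro i
      induction i using Fin.lastCases with
      | last =>
        simp only [Fin.snoc_last]
        rw [hεε]
        nlinarith [mul_nonneg hm hε0.le]
      | cast i =>
        simp only [Fin.snoc_castSucc]
        exact (hqn i).trans_le hle

end Helpers

/-- Almost-projections which are almost mutually orthogonal (in `‖·‖₂`) are close to
genuinely mutually orthogonal projections. -/
theorem stability_of_almost_orthogonal_projections
    (ε : ℝ) (hε : 0 < ε) (m : ℕ) (hm : 1 ≤ m) :
    ∃ δ > (0 : ℝ), ∀ d : ℕ, 1 ≤ d →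
      ∀ p : Fin m → Matrix (Fin d) (Fin d) ℂ,
        (∀ i, (p i).PosSemidef ∧ (1 - p i).PosSemidef) →
        (∀ i, hsNorm (p i * p i - p i) < δ) →
        (∀ i j, i ≠ j → hsNorm (p i * p j) < δ) →
        ∃ q : Fin m → Matrix (Fin d) (Fin d) ℂ,
          (∀ i, (q i).IsHermitian ∧ q i * q i = q i) ∧
          (∀ i j, i ≠ j → q i * q j = 0) ∧
          (∀ i, hsNorm (p i - q i) < ε) := by
  obtain ⟨δ, hδ, H⟩ := main_ind m ε hε
  refine ⟨δ, hδ, fun d _ p hp h1 h2 => ?_⟩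
  simp only [hsNorm_eq] at h1 h2 ⊢
  exact H d p hp h1 h2
end
end

section
/- Given ε > 0 and an integer m ≥ 1, there is a δ > 0 such that for every integer d ≥ 1, if p₁, …, p_m ∈ M_d(ℂ) are positive contractions with ‖p_i² − p_i‖₂ < δ for all i, ‖p_i p_j‖₂ < δ for all i ≠ j, and ‖Σ_{i=1}^m p_i − I‖₂ < δ, then there exist mutually orthogonal projections q₁, …, q_m ∈ M_d(ℂ) with Σ_{i=1}^m q_i = I and ‖p_i − q_i‖₂ < ε for all i = 1, …, m. -/
open Matrix
open scoped ComplexOrder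

noncomputable section

section aux

attribute [local instance] Matrix.frobeniusNormedAddCommGroup Matrix.frobeniusNormedSpace
  Matrix.frobeniusNormedRing

variable {d : ℕ}

lemma trace_re_eq (a : Matrix (Fin d) (Fin d) ℂ) :
    (Matrix.trace (aᴴ * a)).re = ∑ i, ∑ j, ‖a i j‖ ^ 2 := by
  rw [Finset.sum_comm]
  simp only [Matrix.trace, Matrix.diag, Matrix.mul_apply, Complex.re_sum, conjTranspose_apply]
  refine Finset.sum_congr rfl fun i _ => Finset.sum_congr rfl fun j _ => ?_
  rw [Complex.star_def, mul_comm, Complex.mul_conj, Complex.ofReal_re, Complex.normSq_eq_norm_sq]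

lemma hsNorm_eq_s5 (a : Matrix (Fin d) (Fin d) ℂ) : hsNorm a = ‖a‖ := by
  rw [hsNorm, trace_re_eq, Matrix.frobenius_norm_def, Real.sqrt_eq_rpow]
  simp

lemma norm_sq_eq (a : Matrix (Fin d) (Fin d) ℂ) : ‖a‖ ^ 2 = (Matrix.trace (aᴴ * a)).re := by
  rw [← hsNorm_eq_s5, hsNorm, Real.sq_sqrt]
  rw [trace_re_eq]; positivity

/-- left multiplication by `b` is a Frobenius contraction -/
lemma contr_left {b : Matrix (Fin d) (Fin d) ℂ} (hb : b.IsHermitian)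
    (h : (1 - b * b).PosSemidef) (a : Matrix (Fin d) (Fin d) ℂ) : ‖b * a‖ ≤ ‖a‖ := by
  have h1 := (h.conjTranspose_mul_mul_same a).trace_nonneg
  have h2 : aᴴ * (1 - b * b) * a = aᴴ * a - (b * a)ᴴ * (b * a) := by
    rw [conjTranspose_mul, hb.eq]; noncomm_ring
  rw [h2, Matrix.trace_sub] at h1
  have h3 := (Complex.le_def.1 h1).1
  rw [Complex.sub_re, ← norm_sq_eq, ← norm_sq_eq] at h3
  simp only [Complex.zero_re] at h3
  exact le_of_sq_le_sq (by linarith) (norm_nonneg _)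

lemma contr_right {b : Matrix (Fin d) (Fin d) ℂ} (hb : b.IsHermitian)
    (h : (1 - b * b).PosSemidef) (a : Matrix (Fin d) (Fin d) ℂ) : ‖a * b‖ ≤ ‖a‖ := by
  have := contr_left hb h aᴴ
  rw [← Matrix.frobenius_norm_conjTranspose (a * b), ← Matrix.frobenius_norm_conjTranspose a,
    conjTranspose_mul, hb.eq]
  exact this

lemma sq_psd_of_contr {b : Matrix (Fin d) (Fin d) ℂ} (hb : b.PosSemidef)
    (h : (1 - b).PosSemidef) : (1 - b * b).PosSemidef := by
  have e : 1 - b * b = (1 - b) + (bᴴ * (1 - b) * b + (1 - b)ᴴ * b * (1 - b)) := by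
    rw [hb.isHermitian.eq, h.isHermitian.eq]; noncomm_ring
  rw [e]
  exact h.add ((h.conjTranspose_mul_mul_same b).add (hb.conjTranspose_mul_mul_same (1 - b)))

lemma sq_psd_of_proj {b : Matrix (Fin d) (Fin d) ℂ} (hb : b.IsHermitian)
    (h : b * b = b) : (1 - b * b).PosSemidef := by
  have e : 1 - b * b = (1 - b)ᴴ * (1 - b) := by
    rw [conjTranspose_sub, conjTranspose_one, hb.eq, h, sub_mul, mul_sub, mul_sub, h]; simp
  rw [e]
  exact Matrix.posSemidef_conjTranspose_mul_self _

lemma norm_unitary_conj (U : Matrix.unitaryGroup (Fin d) ℂ) (a : Matrix (Fin d) (Fin d) ℂ) :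
    ‖(U : Matrix (Fin d) (Fin d) ℂ) * a * (U : Matrix (Fin d) (Fin d) ℂ)ᴴ‖ = ‖a‖ := by
  have hU : (U : Matrix (Fin d) (Fin d) ℂ)ᴴ * (U : Matrix (Fin d) (Fin d) ℂ) = 1 :=
    Matrix.UnitaryGroup.star_mul_self U
  have : ‖(U : Matrix (Fin d) (Fin d) ℂ) * a * (U : Matrix (Fin d) (Fin d) ℂ)ᴴ‖ ^ 2 = ‖a‖ ^ 2 := by
    rw [norm_sq_eq, norm_sq_eq]
    congr 1
    set V := (U : Matrix (Fin d) (Fin d) ℂ)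
    have : (V * a * Vᴴ)ᴴ * (V * a * Vᴴ) = V * (aᴴ * (Vᴴ * V) * a * Vᴴ) := by
      simp only [conjTranspose_mul, conjTranspose_conjTranspose, mul_assoc]
    rw [this, hU, Matrix.trace_mul_comm, mul_assoc, hU]
    simp
  exact (sq_eq_sq₀ (norm_nonneg _) (norm_nonneg _)).1 this

lemma norm_diag_le (u v : Fin d → ℂ) (h : ∀ i, ‖u i‖ ≤ 2 * ‖v i‖) :
    ‖(diagonal u : Matrix (Fin d) (Fin d) ℂ)‖ ≤ 2 * ‖(diagonal v : Matrix (Fin d) (Fin d) ℂ)‖ := by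
  refine le_of_sq_le_sq ?_ (by positivity)
  rw [mul_pow, norm_sq_eq, norm_sq_eq, trace_re_eq, trace_re_eq, Finset.mul_sum]
  refine Finset.sum_le_sum fun i _ => ?_
  rw [Finset.mul_sum]
  refine Finset.sum_le_sum fun j _ => ?_
  by_cases hij : i = j
  · subst hij
    simp only [diagonal_apply_eq]
    have := pow_le_pow_left₀ (norm_nonneg _) (h i) 2
    rwa [mul_pow] at this
  · simp [diagonal_apply_ne _ hij]

/-- rounding a Hermitian matrix to a projection -/
lemma round_proj {h : Matrix (Fin d) (Fin d) ℂ} (hh : h.IsHermitian) :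
    ∃ q : Matrix (Fin d) (Fin d) ℂ, q.IsHermitian ∧ q * q = q ∧ (∃ g, q = h * g) ∧
      ‖q - h‖ ≤ 2 * ‖h * h - h‖ := by
  set U := hh.eigenvectorUnitary
  set V := (U : Matrix (Fin d) (Fin d) ℂ) with hV
  have hU : Vᴴ * V = 1 := Matrix.UnitaryGroup.star_mul_self U
  set l : Fin d → ℂ := fun i => (hh.eigenvalues i : ℂ) with hl
  have hs : h = V * diagonal l * Vᴴ := by
    have := hh.spectral_theorem
    rw [Unitary.conjStarAlgAut_apply] at this
    exact this
  let c : Fin d → ℂ := fun i => if 1 / 2 ≤ hh.eigenvalues i then 1 else 0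
  have hmul : ∀ u v : Fin d → ℂ, (V * diagonal u * Vᴴ) * (V * diagonal v * Vᴴ)
      = V * diagonal (fun i => u i * v i) * Vᴴ := by
    intro u v
    rw [← diagonal_mul_diagonal]
    calc _ = V * diagonal u * (Vᴴ * V) * diagonal v * Vᴴ := by simp only [mul_assoc]
      _ = _ := by rw [hU]; simp only [mul_assoc, mul_one]
  have hsub : ∀ u v : Fin d → ℂ, (V * diagonal u * Vᴴ) - (V * diagonal v * Vᴴ)
      = V * diagonal (fun i => u i - v i) * Vᴴ := by
    intro u v
    rw [← diagonal_sub, mul_sub, sub_mul]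
  refine ⟨V * diagonal c * Vᴴ, ?_, ?_, ⟨V * diagonal (fun i => c i / l i) * Vᴴ, ?_⟩, ?_⟩
  · refine Matrix.isHermitian_mul_mul_conjTranspose V ?_
    rw [Matrix.isHermitian_diagonal_iff]
    intro i
    simp only [c]
    split_ifs <;> simp
  · rw [hmul]
    congr 3
    ext i
    simp only [c]
    split_ifs <;> simp
  · conv_rhs => rw [hs]
    rw [hmul]
    congr 3
    ext i
    simp only [c, l]
    split_ifs with hi
    · have : (hh.eigenvalues i : ℂ) ≠ 0 := by
        norm_cast
        intro h0
        rw [h0] at hi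
        norm_num at hi
      field_simp
    · simp
  · have e1 : V * diagonal c * Vᴴ - h = V * diagonal (fun i => c i - l i) * Vᴴ := by
      conv_lhs => rw [hs]
      rw [hsub]
    have e2 : h * h - h = V * diagonal (fun i => l i * l i - l i) * Vᴴ := by
      conv_lhs => rw [hs]
      rw [hmul, hsub]
    rw [e1, e2, hV, norm_unitary_conj, norm_unitary_conj]
    refine norm_diag_le _ _ fun i => ?_
    simp only [c, l]
    generalize hh.eigenvalues i = t
    have e3 : (t : ℂ) * t - t = ((t * t - t : ℝ) : ℂ) := by push_cast; ring
    rw [e3, Complex.norm_real, Real.norm_eq_abs, show t * t - t = t * (t - 1) by ring, abs_mul]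
    split_ifs with hi
    · have e4 : (1 : ℂ) - t = ((1 - t : ℝ) : ℂ) := by push_cast; ring
      rw [e4, Complex.norm_real, Real.norm_eq_abs, abs_sub_comm, abs_of_nonneg (a := t) (by linarith)]
      nlinarith [abs_nonneg (t - 1)]
    · push Not at hi
      rw [zero_sub, norm_neg, Complex.norm_real, Real.norm_eq_abs, abs_of_neg (a := t - 1) (by linarith)]
      nlinarith [abs_nonneg t]

/-- one step: rounding `p` inside the projection `Q` -/
lemma step {p Q : Matrix (Fin d) (Fin d) ℂ} (hp : p.PosSemidef) (hp1 : (1 - p).PosSemidef)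
    (hQ : Q.IsHermitian) (hQQ : Q * Q = Q) {η δ : ℝ} (hη : ‖(1 - Q) * p‖ ≤ η)
    (hδ : ‖p * p - p‖ ≤ δ) :
    ∃ q : Matrix (Fin d) (Fin d) ℂ, q.IsHermitian ∧ q * q = q ∧ Q * q = q ∧
      ‖p - q‖ ≤ 14 * η + 2 * δ := by
  have pc := sq_psd_of_contr hp hp1
  have Qc := sq_psd_of_proj hQ hQQ
  have hH : (Q * p * Q).IsHermitian := by
    have := Matrix.isHermitian_mul_mul_conjTranspose Q hp.isHermitian
    rwa [hQ.eq] at this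
  obtain ⟨q, q1, q2, ⟨g, hg⟩, q3⟩ := round_proj hH
  refine ⟨q, q1, q2, ?_, ?_⟩
  · rw [hg, ← mul_assoc, ← mul_assoc, ← mul_assoc, hQQ]
  · set h := Q * p * Q with hh
    have hη' : ‖p * (1 - Q)‖ ≤ η := by
      rw [← Matrix.frobenius_norm_conjTranspose, conjTranspose_mul, hp.isHermitian.eq,
        conjTranspose_sub, conjTranspose_one, hQ.eq]
      exact hη
    have a1 : ‖p - h‖ ≤ 2 * η := by
      have e : p - h = (1 - Q) * p + Q * (p * (1 - Q)) := by rw [hh]; noncomm_ring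
      rw [e]
      have := norm_add_le ((1 - Q) * p) (Q * (p * (1 - Q)))
      have := contr_left hQ Qc (p * (1 - Q))
      linarith
    have a2 : ‖h * (p - h)‖ ≤ 2 * η := by
      rw [hh, mul_assoc, mul_assoc]
      exact (contr_left hQ Qc _).trans ((contr_left hp.isHermitian pc _).trans
        ((contr_left hQ Qc _).trans a1))
    have a3 : ‖(p - h) * p‖ ≤ 2 * η := (contr_right hp.isHermitian pc _).trans a1
    have a4 : ‖h * h - h‖ ≤ 6 * η + δ := by
      have e : h * h - h = (p * p - p) + (p - h) - (p - h) * p - h * (p - h) := by noncomm_ring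
      rw [e]
      have := norm_sub_le ((p * p - p) + (p - h) - (p - h) * p) (h * (p - h))
      have := norm_sub_le ((p * p - p) + (p - h)) ((p - h) * p)
      have := norm_add_le (p * p - p) (p - h)
      linarith
    have := norm_sub_le (p - h) (q - h)
    rw [sub_sub_sub_cancel_right] at this
    linarith

lemma almost_orth (m : ℕ) : ∀ ε : ℝ, 0 < ε → 
    ∃ δ > (0 : ℝ), ∀ d : ℕ, 
      ∀ p : Fin m → Matrix (Fin d) (Fin d) ℂ,
        (∀ i, (p i).PosSemidef ∧ (1 - p i).PosSemidef) →
        (∀ i, ‖p i * p i - p i‖ < δ) →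
        (∀ i j, i ≠ j → ‖p i * p j‖ < δ) →
        ∃ q : Fin m → Matrix (Fin d) (Fin d) ℂ,
          (∀ i, (q i).IsHermitian ∧ q i * q i = q i) ∧
          (∀ i j, i ≠ j → q i * q j = 0) ∧
          (∀ i, ‖p i - q i‖ < ε) := by
  induction m with
  | zero => 
    intro ε hε
    exact ⟨1, one_pos, fun d p _ _ _ => ⟨p, fun i => i.elim0, fun i => i.elim0, fun i => i.elim0⟩⟩
  | succ m ih =>
    intro ε hε
    have hm : (0 : ℝ) < 32 * (m + 1) := by positivity
    obtain ⟨e, he⟩ : ∃ e, e = ε / (32 * (m + 1)) := ⟨_, rfl⟩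
    have he0 : 0 < e := by rw [he]; positivity
    have hee : e * (32 * (m + 1)) = ε := by rw [he]; field_simp
    have hme : 0 ≤ (m : ℝ) * e := by positivity
    obtain ⟨δ', hδ', H⟩ := ih e he0
    refine ⟨min δ' e, lt_min hδ' he0, fun d p hp h1 h2 => ?_⟩
    obtain ⟨q, hq, ho, hc⟩ := H d (fun i => p i.succ) (fun i => hp _)
      (fun i => (h1 _).trans_le (min_le_left _ _))
      (fun i j hij => (h2 _ _ (by simpa using hij)).trans_le (min_le_left _ _))
    have hSS : (∑ i, q i) * (∑ i, q i) = ∑ i, q i := by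
      rw [Finset.sum_mul]
      refine Finset.sum_congr rfl fun i _ => ?_
      rw [Finset.mul_sum, Finset.sum_eq_single i, (hq i).2]
      · intro j _ hj
        exact ho i j hj.symm
      · simp
    have hSH : (∑ i, q i)ᴴ = ∑ i, q i := by
      rw [conjTranspose_sum]
      exact Finset.sum_congr rfl fun i _ => (hq i).1
    set S := ∑ i, q i with hS
    have hη : ‖(1 - (1 - S)) * p 0‖ ≤ m * (2 * e) := by
      rw [sub_sub_cancel, hS, Finset.sum_mul]
      refine (norm_sum_le _ _).trans ?_
      have : ∀ i ∈ (Finset.univ : Finset (Fin m)), ‖q i * p 0‖ ≤ 2 * e := by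
        intro i _
        have e1 : q i * p 0 = p i.succ * p 0 - (p i.succ - q i) * p 0 := by noncomm_ring
        rw [e1]
        have b1 := norm_sub_le (p i.succ * p 0) ((p i.succ - q i) * p 0)
        have b2 := contr_right (hp 0).1.isHermitian (sq_psd_of_contr (hp 0).1 (hp 0).2)
          (p i.succ - q i)
        have b3 := (h2 i.succ 0 (Fin.succ_ne_zero i)).trans_le (min_le_right _ _)
        have b4 := hc i
        linarith
      refine (Finset.sum_le_sum this).trans ?_
      simp
    obtain ⟨r, r1, r2, r3, r4⟩ := step (Q := 1 - S) (hp 0).1 (hp 0).2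
      (by rw [Matrix.IsHermitian, conjTranspose_sub, conjTranspose_one, hSH])
      (by rw [sub_mul, mul_sub, mul_sub, hSS]; simp) hη ((h1 0).le.trans (min_le_right _ _))
    have hSr : S * r = 0 := by
      rw [sub_mul, one_mul] at r3
      exact sub_eq_self.1 r3
    have hqS : ∀ i, q i * S = q i := by
      intro i
      rw [hS, Finset.mul_sum, Finset.sum_eq_single i, (hq i).2]
      · intro j _ hj
        exact ho i j hj.symm
      · simp
    have hqr : ∀ i, q i * r = 0 := by
      intro i
      rw [← hqS i, mul_assoc, hSr, mul_zero]
    have hrq : ∀ i, r * q i = 0 := by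
      intro i
      have := congrArg conjTranspose (hqr i)
      rwa [conjTranspose_mul, (hq i).1.eq, r1.eq, conjTranspose_zero] at this
    refine ⟨Fin.cons r q, ?_, ?_, ?_⟩
    · intro i
      refine Fin.cases ?_ (fun i => ?_) i
      · exact ⟨r1, r2⟩
      · exact hq i
    · intro i j
      refine Fin.cases ?_ (fun i => ?_) i <;> refine Fin.cases ?_ (fun j => ?_) j
      · intro h; exact absurd rfl h
      · intro _; exact hrq j
      · intro _; exact hqr i
      · intro h; exact ho i j (fun h' => h (by rw [h']))
    · intro i
      refine Fin.cases ?_ (fun i => ?_) i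
      · simp only [Fin.cons_zero]
        nlinarith
      · simp only [Fin.cons_succ]
        have := hc i
        nlinarith

lemma main_aux
    (ε : ℝ) (hε : 0 < ε) (m : ℕ) :
    ∃ δ > (0 : ℝ), ∀ d : ℕ,
      ∀ p : Fin m → Matrix (Fin d) (Fin d) ℂ,
        (∀ i, (p i).PosSemidef ∧ (1 - p i).PosSemidef) →
        (∀ i, ‖p i * p i - p i‖ < δ) →
        (∀ i j, i ≠ j → ‖p i * p j‖ < δ) →
        ‖(∑ i, p i) - 1‖ < δ →
        ∃ q : Fin m → Matrix (Fin d) (Fin d) ℂ,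
          (∀ i, (q i).IsHermitian ∧ q i * q i = q i) ∧
          (∀ i j, i ≠ j → q i * q j = 0) ∧
          (∑ i, q i) = 1 ∧
          (∀ i, ‖p i - q i‖ < ε) := by
  obtain ⟨e, he⟩ : ∃ e : ℝ, e = 1 / (2 * (m + 1)) := ⟨_, rfl⟩
  have he0 : 0 < e := by rw [he]; positivity
  have hee : e * (2 * (m + 1)) = 1 := by rw [he]; field_simp
  obtain ⟨δ', hδ', H⟩ := almost_orth m (min ε e) (lt_min hε he0)
  refine ⟨min δ' (1 / 2), lt_min hδ' (by norm_num), fun d p hp h1 h2 h3 => ?_⟩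
  obtain ⟨q, hq, ho, hc⟩ := H d p hp (fun i => (h1 i).trans_le (min_le_left _ _))
    (fun i j hij => (h2 i j hij).trans_le (min_le_left _ _))
  refine ⟨q, hq, ho, ?_, fun i => (hc i).trans_le (min_le_left _ _)⟩
  have hSS : (∑ i, q i) * (∑ i, q i) = ∑ i, q i := by
    rw [Finset.sum_mul]
    refine Finset.sum_congr rfl fun i _ => ?_
    rw [Finset.mul_sum, Finset.sum_eq_single i, (hq i).2]
    · intro j _ hj
      exact ho i j hj.symm
    · simp
  have hd : ‖∑ i, (p i - q i)‖ ≤ m * e := by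
    refine (norm_sum_le _ _).trans ?_
    refine (Finset.sum_le_sum fun i _ => ((hc i).le.trans (min_le_right _ _))).trans ?_
    simp
  rw [Finset.sum_sub_distrib] at hd
  set S := ∑ i, q i with hS
  have hlt : ‖1 - S‖ < 1 := by
    have e1 : 1 - S = (∑ i, p i - S) - (∑ i, p i - 1) := by abel
    rw [e1]
    have := norm_sub_le (∑ i, p i - S) (∑ i, p i - 1)
    have := h3.trans_le (min_le_right _ _)
    nlinarith
  have hid : (1 - S) * (1 - S) = 1 - S := by rw [sub_mul, mul_sub, mul_sub, hSS]; simp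
  have hle : ‖1 - S‖ ≤ ‖1 - S‖ * ‖1 - S‖ := by
    conv_lhs => rw [← hid]
    exact Matrix.frobenius_norm_mul _ _
  have h0 : ‖1 - S‖ = 0 := by nlinarith [norm_nonneg (1 - S)]
  exact (sub_eq_zero.1 (norm_eq_zero.1 h0)).symm

end aux

/-- Almost-projections which are almost mutually orthogonal and almost sum to the
identity (in `‖·‖₂`) are close to mutually orthogonal projections summing to `1`. -/
theorem stability_of_almost_PVMs
    (ε : ℝ) (hε : 0 < ε) (m : ℕ) (hm : 1 ≤ m) :
    ∃ δ > (0 : ℝ), ∀ d : ℕ, 1 ≤ d →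
      ∀ p : Fin m → Matrix (Fin d) (Fin d) ℂ,
        (∀ i, (p i).PosSemidef ∧ (1 - p i).PosSemidef) →
        (∀ i, hsNorm (p i * p i - p i) < δ) →
        (∀ i j, i ≠ j → hsNorm (p i * p j) < δ) →
        hsNorm ((∑ i, p i) - 1) < δ →
        ∃ q : Fin m → Matrix (Fin d) (Fin d) ℂ,
          (∀ i, (q i).IsHermitian ∧ q i * q i = q i) ∧
          (∀ i j, i ≠ j → q i * q j = 0) ∧
          (∑ i, q i) = 1 ∧
          (∀ i, hsNorm (p i - q i) < ε) := by
  obtain ⟨δ, hδ, H⟩ := main_aux ε hε m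
  refine ⟨δ, hδ, fun d _ p => ?_⟩
  simp only [hsNorm_eq_s5]
  exact H d p
end
end
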